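/- Let K be a number field and let D be a central division K-algebra of exponent 2, i.e., D is K-isomorphic to its opposite algebra D^op. Then D is either equal to K (degree 1) or a quaternion algebra (degree 2, i.e., dim_K D = 4). -/

import Mathlib

set_option linter.unusedSectionVars false
set_option linter.deprecated false

open WithZero

namespace Loc

variable {K : Type*} [Field K] [CharZero K]

section
variable (w : Valuation K ℤᵐ⁰)

lemma two_le : w 2 ≤ 1 := by
  rw [← one_add_one_eq_two]
  exact w.map_add_le (by simp) (by simp)

lemma four_eq : w 4 = w 2 * w 2 := by rw [← map_mul]; norm_num

lemma four_le : w 4 ≤ 1 := by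
  rw [four_eq]; exact mul_le_one' (two_le w) (two_le w)

lemma four_pos : 0 < w 4 := by
  rw [zero_lt_iff, Valuation.ne_zero_iff]; norm_num

lemma val_eq_one {w : Valuation K ℤᵐ⁰} {x : K} (h : w (x - 1) < w 4) : w x = 1 := by
  have := w.map_one_add_of_lt (h.trans_le (four_le w))
  simpa using this

lemma val_eq_of_sub {w : Valuation K ℤᵐ⁰} {x y : K} (h : w (x - y) < w y) : w x = w y := by
  have := w.map_add_eq_of_lt_left h
  simpa using this

/-- local square-class subgroup at a valuation -/
def H : Subgroup Kˣ where
  carrier := {x | ∃ y : K, y ≠ 0 ∧ w ((x : K) * y ^ 2 - 1) < w 4}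
  one_mem' := ⟨1, one_ne_zero, by simpa using four_pos w⟩
  mul_mem' := by
    rintro a b ⟨y, hy, h1⟩ ⟨z, hz, h2⟩
    refine ⟨y * z, mul_ne_zero hy hz, ?_⟩
    have : ((a * b : Kˣ) : K) * (y * z) ^ 2 - 1 =
      ((a : K) * y ^ 2 - 1) * (b * z ^ 2) + (b * z ^ 2 - 1) := by push_cast; ring
    rw [this]
    refine w.map_add_lt ?_ h2
    rw [map_mul, val_eq_one h2, mul_one]; exact h1
  inv_mem' := by
    rintro a ⟨y, hy, h1⟩
    refine ⟨y⁻¹, inv_ne_zero hy, ?_⟩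
    have : ((a⁻¹ : Kˣ) : K) * (y⁻¹) ^ 2 - 1 = -(a * y ^ 2 - 1) * (a * y ^ 2)⁻¹ := by
      have := a.ne_zero
      push_cast; field_simp; ring
    rw [this, map_mul, Valuation.map_neg, map_inv₀, val_eq_one h1]
    simpa using h1

variable {w}

lemma mem_H {x : Kˣ} : x ∈ H w ↔ ∃ y : K, y ≠ 0 ∧ w ((x : K) * y ^ 2 - 1) < w 4 := Iff.rfl

lemma sq_mem_H (x : Kˣ) : x ^ 2 ∈ H w :=
  ⟨(x : K)⁻¹, inv_ne_zero x.ne_zero, by simpa using four_pos w⟩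

lemma mem_H_of_close {x : Kˣ} (h : w ((x : K) - 1) < w 4) : x ∈ H w :=
  ⟨1, one_ne_zero, by simpa using h⟩

lemma div_mem_H {x y : Kˣ} (h : w ((x : K) - y) < w (4 * y)) : x / y ∈ H w := by
  apply mem_H_of_close
  have : ((x / y : Kˣ) : K) - 1 = (x - y) * (y : K)⁻¹ := by
    have := y.ne_zero
    push_cast; field_simp
  rw [this, map_mul, map_inv₀]
  rw [map_mul] at h
  have h0 : 0 < w (y : K) := zero_lt_iff.mpr ((Valuation.ne_zero_iff _).mpr y.ne_zero)
  rwa [← div_eq_mul_inv, div_lt_iff₀ h0]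

lemma hensel {x : Kˣ} (h : x ∈ H w) {g : ℤᵐ⁰} (hg : g ≠ 0) :
    ∃ y : K, y ≠ 0 ∧ w ((x : K) * y ^ 2 - 1) < g := by
  have key : ∀ n : ℕ, ∃ y : K, y ≠ 0 ∧ w ((x : K) * y ^ 2 - 1) < w 4 * exp (-(n : ℤ)) := by
    intro n
    induction n with
    | zero => simpa [mem_H] using h
    | succ n ih =>
      obtain ⟨y, hy, h1⟩ := ih
      set c : K := ((x : K) * y ^ 2 - 1) / 4 with hc
      have hxy : (x : K) * y ^ 2 = 1 + 4 * c := by rw [hc]; ring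
      have hc1 : w c < exp (-(n : ℤ)) := by
        rw [hc, map_div₀, div_lt_iff₀ (four_pos w), mul_comm (exp _)]; exact h1
      have hc1' : w c < 1 := hc1.trans_le (by rw [← exp_zero, exp_le_exp]; lia)
      have hcc : w c ≤ exp (-1) := by
        by_cases h0 : w c = 0
        · rw [h0]; exact zero_le
        · rw [← exp_zero, ← log_lt_iff_lt_exp (a := 0) h0] at hc1'
          rw [← log_le_iff_le_exp h0]; lia
      have h2c : w (1 + 2 * c) = 1 := by
        apply w.map_one_add_of_lt
        rw [map_mul]
        calc w 2 * w c ≤ 1 * w c := by gcongr; exact two_le w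
          _ < 1 := by simpa using hc1'
      have h2c0 : (1 + 2 * c) ≠ 0 := by
        intro h; rw [h] at h2c; simp at h2c
      refine ⟨y / (1 + 2 * c), div_ne_zero hy h2c0, ?_⟩
      have : (x : K) * (y / (1 + 2 * c)) ^ 2 - 1 = -(4 * (c * c)) / (1 + 2 * c) ^ 2 := by
        rw [div_pow, mul_div_assoc', hxy]
        rw [eq_div_iff (pow_ne_zero 2 h2c0), sub_mul, div_mul_cancel₀ _ (pow_ne_zero 2 h2c0)]; ring
      rw [this, map_div₀, Valuation.map_neg, map_pow, h2c, map_mul, map_mul]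
      simp only [one_pow, div_one]
      have h4 := four_pos w
      have : w c * w c < exp (-((n : ℤ)+1)) := by
        calc w c * w c ≤ w c * exp (-1) := by gcongr
          _ < exp (-(n : ℤ)) * exp (-1) := by
            apply mul_lt_mul_of_pos_right hc1; simp
          _ = _ := by rw [← exp_add]; congr 1; ring
      push_cast
      exact mul_lt_mul_of_pos_left this h4
  obtain ⟨n, hn⟩ := exists_exp_neg_natCast_lt hg
  obtain ⟨y, hy, h1⟩ := key n
  refine ⟨y, hy, h1.trans_le (le_trans ?_ hn.le)⟩
  exact mul_le_of_le_one_left' (four_le w)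

end

/-- The norm group of `K(√a)`. -/
def norms (a : K) : Subgroup Kˣ where
  carrier := {x | ∃ y z : K, (x : K) = y ^ 2 - a * z ^ 2}
  one_mem' := ⟨1, 0, by simp⟩
  mul_mem' := by
    rintro x x' ⟨y, z, h⟩ ⟨y', z', h'⟩
    exact ⟨y * y' + a * z * z', y * z' + z * y', by push_cast; rw [h, h']; ring⟩
  inv_mem' := by
    rintro x ⟨y, z, h⟩
    refine ⟨y / x, z / x, ?_⟩
    have := x.ne_zero
    push_cast
    field_simp
    linear_combination h

lemma mem_norms {a : K} {x : Kˣ} : x ∈ norms a ↔ ∃ y z : K, (x : K) = y ^ 2 - a * z ^ 2 := Iff.rfl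

lemma norms_mul_sq (a s : K) (hs : s ≠ 0) : norms (a * s ^ 2) = norms a := by
  ext x
  constructor
  · rintro ⟨y, z, h⟩; exact ⟨y, s * z, by rw [h]; ring⟩
  · rintro ⟨y, z, h⟩; exact ⟨y, z / s, by rw [h]; field_simp⟩

variable (w : Valuation K ℤᵐ⁰)

/-- local norm group -/
def N (a : K) : Subgroup Kˣ := norms a ⊔ H w

variable {w}

lemma H_le_N (a : K) : H w ≤ N w a := le_sup_right
lemma norms_le_N (a : K) : norms a ≤ N w a := le_sup_left

lemma N_mul_sq (a s : K) (hs : s ≠ 0) : N w (a * s ^ 2) = N w a := by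
  rw [N, N, norms_mul_sq a s hs]

lemma mem_N_iff {a : K} {b : Kˣ} :
    b ∈ N w a ↔ ∃ y z : K, w (y ^ 2 - a * z ^ 2 - b) < w (4 * b) := by
  constructor
  · intro hb
    obtain ⟨n, ⟨y, z, hn⟩, h, ⟨s, hs, hh⟩, rfl⟩ := Subgroup.mem_sup.mp hb
    refine ⟨y / s, z / s, ?_⟩
    have e : (y / s) ^ 2 - a * (z / s) ^ 2 - ((n * h : Kˣ) : K) = -(n * (h * s ^ 2 - 1)) / s ^ 2 := by
      field_simp; rw [← hn]; push_cast; ring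
    have hs' : 0 < w s := zero_lt_iff.mpr ((Valuation.ne_zero_iff _).mpr hs)
    have hn' : 0 < w n := zero_lt_iff.mpr ((Valuation.ne_zero_iff _).mpr n.ne_zero)
    rw [e, map_div₀, Valuation.map_neg, map_mul, map_pow, div_lt_iff₀ (pow_pos hs' 2)]
    have : w (4 * ((n * h : Kˣ) : K)) * w s ^ 2 = w n * w 4 := by
      have := val_eq_one hh
      rw [map_mul, map_pow] at this
      rw [map_mul]; push_cast; rw [map_mul, mul_assoc, mul_assoc, this, mul_one, mul_comm]
    rw [this]
    exact mul_lt_mul_of_pos_left hh hn'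
  · rintro ⟨y, z, h⟩
    have h1 : w (y ^ 2 - a * z ^ 2) = w b := by
      apply val_eq_of_sub
      refine h.trans_le ?_
      rw [map_mul]; exact mul_le_of_le_one_left' (four_le w)
    have h0 : y ^ 2 - a * z ^ 2 ≠ 0 := by
      rw [← Valuation.ne_zero_iff w, h1, Valuation.ne_zero_iff]; exact b.ne_zero
    have hm : Units.mk0 _ h0 / b ∈ H w := div_mem_H (by simpa using h)
    have hn : Units.mk0 _ h0 ∈ norms a := ⟨y, z, rfl⟩
    have : b = Units.mk0 _ h0 * (Units.mk0 _ h0 / b)⁻¹ := by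
      simp
    rw [this]
    exact mul_mem (norms_le_N a hn) (H_le_N a (inv_mem hm))

lemma vpos {x : K} (hx : x ≠ 0) : 0 < w x := zero_lt_iff.mpr ((Valuation.ne_zero_iff _).mpr hx)

lemma N_eq_top {a : Kˣ} (h : a ∈ H w) : N w (a : K) = ⊤ := by
  rw [eq_top_iff]
  intro x _
  rw [mem_N_iff]
  set Z : K := (x - 1) / 2
  set Y : K := (x + 1) / 2
  by_cases hZ : Z = 0
  · refine ⟨Y, 0, ?_⟩
    have : (x : K) = 1 := by
      have : ((x : K) - 1) / 2 * 2 = 0 := by rw [show ((x : K) - 1) / 2 = Z from rfl, hZ]; simp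
      linear_combination this
    have e : Y = 1 := by simp only [Y]; rw [this]; norm_num
    rw [e, this]; simpa using four_pos w
  have hg : w (4 * (x : K)) / w Z ^ 2 ≠ 0 :=
    div_ne_zero (vpos (by simp)).ne' (pow_ne_zero _ (vpos hZ).ne')
  obtain ⟨s, hs, h1⟩ := hensel h hg
  refine ⟨Y, Z * s, ?_⟩
  have e : Y ^ 2 - a * (Z * s) ^ 2 - x = - (Z ^ 2 * (a * s ^ 2 - 1)) := by
    simp only [Y, Z]; ring
  have hZ' : 0 < w Z := vpos hZ
  rw [e, Valuation.map_neg, map_mul, map_pow, mul_comm, ← lt_div_iff₀ (pow_pos hZ' 2)]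
  exact h1

lemma N_symm {a b : Kˣ} (hb : b ∈ N w (a : K)) : a ∈ N w (b : K) := by
  obtain ⟨n, ⟨y, z, hn⟩, h, hh, rfl⟩ := Subgroup.mem_sup.mp hb
  by_cases hz : z = 0
  · have : n * h ∈ H w := by
      refine mul_mem ?_ hh
      have : y ≠ 0 := by rintro rfl; apply n.ne_zero; rw [hn, hz]; simp
      have : n = (Units.mk0 y this) ^ 2 := by ext; simp [hn, hz]
      rw [this]; exact sq_mem_H _
    rw [N_eq_top this]; trivial
  rw [mem_N_iff]
  have hn0 : 0 < w n := vpos n.ne_zero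
  have hz0 : 0 < w z := vpos hz
  obtain ⟨s, hs, h1⟩ := hensel hh (g := w (4 * a) * w z ^ 2 / w n)
    (div_ne_zero (mul_ne_zero (vpos (by simp)).ne' (pow_pos hz0 2).ne') hn0.ne')
  refine ⟨y / z, s / z, ?_⟩
  have e : (y / z) ^ 2 - ((n * h : Kˣ) : K) * (s / z) ^ 2 - a = -(n * (h * s ^ 2 - 1)) / z ^ 2 := by
    field_simp; push_cast; rw [hn]; ring
  rw [e, map_div₀, Valuation.map_neg, map_mul, map_pow, div_lt_iff₀ (pow_pos hz0 2), mul_comm,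
    ← lt_div_iff₀ hn0]
  exact h1

end Loc


set_option linter.unusedSectionVars false
set_option linter.deprecated false

open WithZero

namespace Loc

variable {K : Type*} [Field K] [CharZero K]

/-- facts about a discrete valuation with finite residue field -/
structure Good (w : Valuation K ℤᵐ⁰) : Prop where
  unif : ∃ p : K, w p = exp (-1)
  r1 : ∃ d : K, w d ≤ 1 ∧ ∀ t : K, w t ≤ 1 → w (t ^ 2 - t + d) = 1
  r2 : w 2 < 1 → ∀ u : K, w u = 1 → ∃ r : K, w r ≤ 1 ∧ w (r ^ 2 - u) < 1
  r3 : w 2 = 1 → ∀ a b : K, w a = 1 → w b = 1 → ∃ y z : K, w (y ^ 2 - a * z ^ 2 - b) < 1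

variable {w : Valuation K ℤᵐ⁰}

lemma Q_val {d : K} (hd : w d ≤ 1) (h : ∀ t : K, w t ≤ 1 → w (t ^ 2 - t + d) = 1) (Y Z : K) :
    w (Y ^ 2 - Y * Z + d * Z ^ 2) = (max (w Y) (w Z)) ^ 2 := by
  rcases le_or_gt (w Y) (w Z) with hYZ | hYZ
  · rw [max_eq_right hYZ]
    by_cases hZ : Z = 0
    · subst hZ
      have : Y = 0 := by
        rw [← w.zero_iff]
        simpa using hYZ
      subst this; simp
    have e : Y ^ 2 - Y * Z + d * Z ^ 2 = Z ^ 2 * ((Y / Z) ^ 2 - Y / Z + d) := by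
      field_simp
    have : w (Y / Z) ≤ 1 := by
      rw [map_div₀]; exact div_le_one_of_le₀ hYZ zero_le
    rw [e, map_mul, h _ this, mul_one, map_pow]
  · rw [max_eq_left hYZ.le]
    have hY : 0 < w Y := lt_of_le_of_lt zero_le hYZ
    rw [show Y ^ 2 - Y * Z + d * Z ^ 2 = Y ^ 2 - (Y * Z - d * Z ^ 2) by ring]
    rw [Valuation.map_sub_eq_of_lt_left, map_pow]
    apply Valuation.map_sub_lt
    · rw [map_mul, map_pow, pow_two]
      exact mul_lt_mul_of_pos_left hYZ hY
    · rw [map_mul, map_pow, map_pow]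
      calc w d * w Z ^ 2 ≤ 1 * w Z ^ 2 := by gcongr
        _ < w Y ^ 2 := by rw [one_mul]; exact pow_lt_pow_left₀ hYZ zero_le two_ne_zero

lemma eps_even {d : K} (hd : w d ≤ 1) (h : ∀ t : K, w t ≤ 1 → w (t ^ 2 - t + d) = 1) {b : Kˣ}
    (hb : b ∈ N w (1 - 4 * d)) : ∃ g : ℤ, w b = exp (2 * g) := by
  obtain ⟨y, z, h1⟩ := mem_N_iff.mp hb
  have h2 : w (y ^ 2 - (1 - 4 * d) * z ^ 2) = w b := by
    apply val_eq_of_sub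
    refine h1.trans_le ?_
    rw [map_mul]; exact mul_le_of_le_one_left' (four_le w)
  have e : y ^ 2 - (1 - 4 * d) * z ^ 2 = (y + z) ^ 2 - (y + z) * (2 * z) + d * (2 * z) ^ 2 := by ring
  rw [e, Q_val hd h] at h2
  set m := max (w (y + z)) (w (2 * z))
  have hm : m ≠ 0 := by
    intro h0; rw [h0] at h2
    have := vpos (w := w) b.ne_zero
    rw [← h2] at this; simp at this
  refine ⟨log m, ?_⟩
  rw [← h2]
  conv_lhs => rw [← exp_log hm]
  rw [two_mul, exp_add, pow_two]

lemma eps_unit {d : K} (hd : w d ≤ 1) (h : ∀ t : K, w t ≤ 1 → w (t ^ 2 - t + d) = 1) :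
    w (1 - 4 * d) = 1 := by
  rcases (two_le w).lt_or_eq with h2 | h2
  · have : w (4 * d) < 1 := by
      rw [map_mul, four_eq, mul_assoc]
      refine mul_lt_one_of_lt_of_le h2 (mul_le_one' (two_le w) hd)
    simpa using w.map_sub_eq_of_lt_left (x := 1) (by simpa using this)
  · have h4 : w 4 = 1 := by rw [four_eq, h2, one_mul]
    have := h (1 / 2) (by simp [h2])
    rw [show (1 / 2 : K) ^ 2 - 1 / 2 + d = -(1 - 4 * d) / 4 by ring] at this
    rw [map_div₀, Valuation.map_neg, h4, div_one] at this
    exact this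

lemma unit_mem_eps (hw : Good w) (h2 : w 2 < 1) {d : K} (hd : w d ≤ 1)
    (h : ∀ t : K, w t ≤ 1 → w (t ^ 2 - t + d) = 1) {A : Kˣ} (hA : w A = 1) :
    A ∈ N w (1 - 4 * d) := by
  have hd1 : w d = 1 := by simpa using h 0 (by simp)
  have hd0 : d ≠ 0 := by rintro rfl; simp at hd1
  obtain ⟨r, hr, hr'⟩ := hw.r2 h2 (A / d) (by simp [hA, hd1])
  have hr1 : w r = 1 := by
    have : w (r ^ 2) = 1 := by
      rw [val_eq_of_sub (y := (A : K) / d)]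
      · simp [hA, hd1]
      · simpa [hA, hd1] using hr'
    rw [map_pow] at this
    exact (pow_eq_one_iff_of_nonneg zero_le two_ne_zero).mp this
  have key : ∀ n : ℕ, ∃ Y : K, w Y < 1 ∧ w (Y ^ 2 - Y * r + d * r ^ 2 - A) < exp (-(n : ℤ)) := by
    intro n
    induction n with
    | zero =>
      refine ⟨0, by simp, ?_⟩
      have : (0 : K) ^ 2 - 0 * r + d * r ^ 2 - A = d * (r ^ 2 - A / d) := by field_simp; ring
      rw [this, map_mul, hd1, one_mul]; simpa using hr'
    | succ n ih =>
      obtain ⟨Y, hY, hQ⟩ := ih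
      have hQ1 : w (Y ^ 2 - Y * r + d * r ^ 2 - A) < 1 :=
        hQ.trans_le (by rw [← exp_zero, exp_le_exp]; lia)
      set q := Y ^ 2 - Y * r + d * r ^ 2 - A with hq
      have hqq : w q ≤ exp (-1) := by
        by_cases h0 : w q = 0
        · rw [h0]; exact zero_le
        · rw [← exp_zero, ← log_lt_iff_lt_exp (a := 0) h0] at hQ1
          rw [← log_le_iff_le_exp h0]; lia
      have hder : w (r - 2 * Y) = 1 := by
        rw [Valuation.map_sub_eq_of_lt_left, hr1]
        rw [hr1, map_mul]
        exact (mul_le_of_le_one_left' (two_le w)).trans_lt hY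
      have hder0 : r - 2 * Y ≠ 0 := by intro h; rw [h] at hder; simp at hder
      refine ⟨Y + q / (r - 2 * Y), ?_, ?_⟩
      · apply Valuation.map_add_lt _ hY
        rw [map_div₀, hder, div_one]; exact hQ1
      · have : (Y + q / (r - 2 * Y)) ^ 2 - (Y + q / (r - 2 * Y)) * r + d * r ^ 2 - A
            = (q / (r - 2 * Y)) ^ 2 := by
          have e1 : q / (r - 2 * Y) * (r - 2 * Y) = q := div_mul_cancel₀ _ hder0
          linear_combination (-1 : K) * e1 - hq
        rw [this, map_pow, map_div₀, hder, div_one, pow_two]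
        calc w q * w q ≤ w q * exp (-1) := by gcongr
          _ < exp (-(n : ℤ)) * exp (-1) := by
            apply mul_lt_mul_of_pos_right hQ; simp
          _ = _ := by rw [← exp_add]; congr 1; push_cast; ring
  rw [mem_N_iff]
  obtain ⟨n, hn⟩ := exists_exp_neg_natCast_lt (four_pos w).ne'
  obtain ⟨Y, hY, hQ⟩ := key n
  refine ⟨Y - r / 2, r / 2, ?_⟩
  rw [show (Y - r / 2) ^ 2 - (1 - 4 * d) * (r / 2) ^ 2 - A = Y ^ 2 - Y * r + d * r ^ 2 - A by ring]
  rw [map_mul, hA, mul_one]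
  exact hQ.trans hn

lemma H_mul_sq {a : Kˣ} (s : Kˣ) : a * s ^ 2 ∈ H w ↔ a ∈ H w :=
  Subgroup.mul_mem_cancel_right _ (sq_mem_H s)

lemma even_val {x : K} (hx : x ≠ 0) : ∃ m : ℤ, w x = exp m :=
  ⟨log (w x), (exp_log (vpos hx).ne').symm⟩

lemma exists_val (hw : Good w) (n : ℤ) : ∃ s : Kˣ, w s = exp n := by
  obtain ⟨p, hp⟩ := hw.unif
  have hp0 : p ≠ 0 := by rintro rfl; rw [map_zero] at hp; exact exp_ne_zero hp.symm
  refine ⟨(Units.mk0 p hp0) ^ (-n), ?_⟩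
  push_cast
  rw [map_zpow₀, Units.val_mk0, hp, ← exp_zsmul]; simp

/-- odd valuation gives a nontrivial local norm group etc. -/
lemma exists_notMem_unit_close (hw : Good w) {a : Kˣ} (ha : a ∉ H w) (ha1 : w a = 1)
    (hc : w ((a : K) - 1) ≤ w 4) : ∃ b, b ∉ N w (a : K) := by
  set d : K := (1 - a) / 4 with hd
  have had : (a : K) = 1 - 4 * d := by rw [hd]; ring
  have hd1 : w d ≤ 1 := by
    rw [hd, map_div₀, Valuation.map_sub_swap]
    exact div_le_one_of_le₀ hc zero_le
  by_cases h : ∀ t : K, w t ≤ 1 → w (t ^ 2 - t + d) = 1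
  · obtain ⟨s, hs⟩ := exists_val hw 1
    refine ⟨s, fun hmem => ?_⟩
    rw [had] at hmem
    obtain ⟨g, hg⟩ := eps_even hd1 h hmem
    rw [hs, exp_inj] at hg; lia
  · exfalso
    push Not at h
    obtain ⟨t, ht, ht'⟩ := h
    have ht2 : w (t ^ 2 - t + d) < 1 := by
      refine lt_of_le_of_ne ?_ ht'
      refine w.map_add_le (w.map_sub_le ?_ ht) hd1
      rw [map_pow]; exact pow_le_one' ht 2
    have e : (1 - 2 * t) ^ 2 - (a : K) = 4 * (t ^ 2 - t + d) := by rw [had]; ring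
    have hlt : w ((1 - 2 * t) ^ 2 - (a : K)) < w (4 * a) := by
      rw [e, map_mul, map_mul, ha1]
      exact mul_lt_mul_of_pos_left ht2 (four_pos w)
    have h1 : w ((1 - 2 * t) ^ 2) = w a := by
      apply val_eq_of_sub
      refine hlt.trans_le ?_
      rw [map_mul]; exact mul_le_of_le_one_left' (four_le w)
    have hne : (1 - 2 * t) ≠ 0 := by
      intro h0; rw [h0, ha1] at h1; simp at h1
    have := div_mem_H (x := (Units.mk0 _ hne) ^ 2) (y := a) (w := w) (by simpa using hlt)
    apply ha
    have h2 := mul_mem (inv_mem this) (sq_mem_H (w := w) (Units.mk0 _ hne))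
    simpa using h2

lemma exists_notMem_dyadic (hw : Good w) (h2 : w 2 < 1) {a : Kˣ} (ha1 : w a = 1)
    (h4 : w 4 < w ((a : K) - 1))
    (hmin : ∀ s : Kˣ, w ((a : K) - 1) ≤ w ((a : K) * s ^ 2 - 1)) : ∃ b, b ∉ N w (a : K) := by
  obtain ⟨d, hd, h⟩ := hw.r1
  set c : K := a - 1 with hc
  have hac : (a : K) = 1 + c := by rw [hc]; ring
  have hc1 : w c < 1 := by
    obtain ⟨r, hr, hr'⟩ := hw.r2 h2 (a : K)⁻¹ (by simp [ha1])
    have e : (a : K) * r ^ 2 - 1 = a * (r ^ 2 - (a : K)⁻¹) := by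
      have := a.ne_zero
      field_simp
    have h3 : w ((a : K) * r ^ 2 - 1) < 1 := by rw [e, map_mul, ha1, one_mul]; exact hr'
    have hr0 : r ≠ 0 := by
      rintro rfl; simp at h3
    exact (hmin (Units.mk0 r hr0)).trans_lt (by simpa using h3)
  have hc0 : c ≠ 0 := by
    intro h0; rw [h0] at h4; simp at h4
  obtain ⟨m, hm⟩ := even_val (w := w) hc0
  have hodd : ∀ j : ℤ, m ≠ 2 * j := by
    rintro j rfl
    have hj : exp j < (1 : ℤᵐ⁰) := by
      rw [hm, ← exp_zero, exp_lt_exp] at hc1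
      rw [← exp_zero, exp_lt_exp]; lia
    have hwj : w 2 < exp j := by
      rw [hm, four_eq, two_mul, exp_add] at h4
      by_contra hcon
      push Not at hcon
      exact absurd h4 (not_lt.mpr (mul_le_mul' hcon hcon))
    obtain ⟨s, hs⟩ := exists_val hw j
    obtain ⟨r, hr, hr'⟩ := hw.r2 h2 (c / s ^ 2) (by
      rw [map_div₀, hm, map_pow, hs, two_mul, exp_add, pow_two]; simp)
    have hs0 := s.ne_zero
    have hsr : w (s * r) < 1 := by
      rw [map_mul, hs]; exact mul_lt_one_of_lt_of_le hj hr
    have h1 : w (1 + s * r) = 1 := w.map_one_add_of_lt hsr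
    have hne : 1 + s * r ≠ 0 := by intro h0; rw [h0] at h1; simp at h1
    have := hmin (Units.mk0 _ hne)⁻¹
    have e : (a : K) * (((Units.mk0 _ hne)⁻¹ : Kˣ) : K) ^ 2 - 1 =
        (- (s ^ 2 * (r ^ 2 - c / s ^ 2)) - 2 * (s * r)) / (1 + s * r) ^ 2 := by
      rw [hac]
      have e2 : (s : K) ^ 2 * (r ^ 2 - c / s ^ 2) = s ^ 2 * r ^ 2 - c := by field_simp
      rw [e2, Units.val_inv_eq_inv_val, Units.val_mk0]
      field_simp
      ring
    rw [e, map_div₀, map_pow, h1] at this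
    simp only [one_pow, div_one] at this
    refine absurd this (not_le.mpr ?_)
    rw [hm]
    apply Valuation.map_sub_lt
    · rw [Valuation.map_neg, map_mul, map_pow, hs, two_mul, exp_add, ← pow_two]
      conv_rhs => rw [← mul_one (exp j ^ 2)]
      exact mul_lt_mul_of_pos_left hr' (by simp [zero_lt_iff])
    · rw [map_mul, map_mul, hs, two_mul, exp_add]
      calc w 2 * (exp j * w r) ≤ w 2 * (exp j * 1) := by gcongr
        _ < exp j * exp j := by
          rw [mul_one]; exact mul_lt_mul_of_pos_right hwj (by simp [zero_lt_iff])
  set B : K := -c - 4 * d with hB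
  have hwB : w B = w c := by
    rw [hB, Valuation.map_sub_eq_of_lt_left, Valuation.map_neg]
    rw [Valuation.map_neg, map_mul]
    exact (mul_le_of_le_one_right' hd).trans_lt h4
  have hB0 : B ≠ 0 := by rw [← w.ne_zero_iff, hwB, w.ne_zero_iff]; exact hc0
  have he1 := eps_unit hd h
  have he0 : 1 - 4 * d ≠ 0 := by intro h0; rw [h0] at he1; simp at he1
  set b : Kˣ := Units.mk0 B hB0
  set ε : Kˣ := Units.mk0 _ he0
  refine ⟨b, fun hb => ?_⟩
  have hA : ε ∈ N w (a : K) := N_symm (a := ε) (b := a) (unit_mem_eps hw h2 hd h ha1)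
  have h5 : a ∈ N w ((b / ε : Kˣ) : K) := N_symm (div_mem hb hA)
  have h6 : b / ε ∈ N w ((a / ε : Kˣ) : K) := by
    apply norms_le_N
    refine ⟨1, 1, ?_⟩
    have : (a : K) + B = 1 - 4 * d := by rw [hac, hB]; ring
    simp only [b, ε]
    push_cast
    simp only [Units.val_mk0]
    field_simp
    linear_combination this
  have h7 : a / (a / ε) ∈ N w ((b / ε : Kˣ) : K) := div_mem h5 (N_symm h6)
  rw [div_div_cancel] at h7
  have h8 : b / ε ∈ N w (ε : K) := N_symm h7
  obtain ⟨g, hg⟩ := eps_even hd h (b := b / ε) h8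
  apply hodd g
  rw [Units.val_div_eq_div_val, map_div₀] at hg
  simp only [b, ε, Units.val_mk0, he1, hwB, hm, div_one, exp_inj] at hg
  exact hg

theorem exists_notMem_N (hw : Good w) {a : Kˣ} (ha : a ∉ H w) : ∃ b, b ∉ N w (a : K) := by
  obtain ⟨m, hm⟩ := even_val (w := w) a.ne_zero
  rcases Int.even_or_odd m with ⟨j, hj⟩ | hodd
  · -- even
    obtain ⟨s, hs⟩ := exists_val hw (-j)
    have h0 : w ((a * s ^ 2 : Kˣ) : K) = 1 := by
      push_cast
      rw [map_mul, map_pow, hm, hs, hj, pow_two, ← exp_add, ← exp_add]; simp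
    have hN : ∀ s : Kˣ, N w ((a * s ^ 2 : Kˣ) : K) = N w (a : K) := fun s => by
      push_cast; exact N_mul_sq _ _ s.ne_zero
    by_cases hex : ∃ t : Kˣ, w ((a * t ^ 2 : Kˣ) : K) = 1 ∧ w (((a * t ^ 2 : Kˣ) : K) - 1) ≤ w 4
    · obtain ⟨t, ht1, ht2⟩ := hex
      rw [← hN t]
      exact exists_notMem_unit_close hw (by rwa [H_mul_sq]) ht1 ht2
    push Not at hex
    have h2 : w 2 < 1 := by
      refine lt_of_le_of_ne (two_le w) fun h2 => ?_
      refine absurd (hex s h0) (not_lt.mpr ?_)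
      rw [four_eq, h2, one_mul]
      exact w.map_sub_le h0.le (by simp)
    -- minimal choice
    let P : ℕ → Prop := fun n => ∃ t : Kˣ, w ((a * t ^ 2 : Kˣ) : K) = 1 ∧
      log (w (((a * t ^ 2 : Kˣ) : K) - 1)) = n + log (w 4)
    have hP : ∀ t : Kˣ, w ((a * t ^ 2 : Kˣ) : K) = 1 →
        ∃ n : ℕ, log (w (((a * t ^ 2 : Kˣ) : K) - 1)) = n + log (w 4) := by
      intro t ht
      have h1 := hex t ht
      have : log (w 4) < log (w (((a * t ^ 2 : Kˣ) : K) - 1)) := by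
        rw [log_lt_log (four_pos w).ne' (lt_trans (four_pos w) h1).ne']; exact h1
      refine ⟨(log (w (((a * t ^ 2 : Kˣ) : K) - 1)) - log (w 4)).toNat, ?_⟩
      lia
    have hex' : ∃ n, P n := by
      obtain ⟨n, hn⟩ := hP s h0
      exact ⟨n, s, h0, hn⟩
    classical
    obtain ⟨t, ht1, ht2⟩ := Nat.find_spec hex'
    rw [← hN t]
    refine exists_notMem_dyadic hw h2 ht1 (hex t ht1) fun r => ?_
    have e : ((a * t ^ 2 : Kˣ) : K) * r ^ 2 = ((a * (t * r) ^ 2 : Kˣ) : K) := by push_cast; ring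
    rw [e]
    by_cases hr : w ((a * (t * r) ^ 2 : Kˣ) : K) = 1
    · obtain ⟨n, hn⟩ := hP _ hr
      have := Nat.find_min' hex' ⟨_, hr, hn⟩
      have hpos := (lt_trans (four_pos w) (hex _ hr)).ne'
      have hpos' := (lt_trans (four_pos w) (hex _ ht1)).ne'
      rw [← log_le_log hpos' hpos]
      rw [ht2, hn]; lia
    · have h1 : w (((a * t ^ 2 : Kˣ) : K) - 1) ≤ 1 := w.map_sub_le ht1.le (by simp)
      refine h1.trans ?_
      rcases lt_or_gt_of_ne hr with h | h
      · rw [Valuation.map_sub_eq_of_lt_right]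
        · simp
        · simpa using h
      · rw [Valuation.map_sub_eq_of_lt_left]
        · exact h.le
        · simpa using h
  · obtain ⟨d, hd, h⟩ := hw.r1
    have he1 := eps_unit hd h
    have he0 : 1 - 4 * d ≠ 0 := by intro h0; rw [h0] at he1; simp at he1
    refine ⟨Units.mk0 _ he0, fun hb => ?_⟩
    have := N_symm hb
    obtain ⟨g, hg⟩ := eps_even hd h (by simpa using this)
    rw [hm, exp_inj] at hg
    obtain ⟨k, hk⟩ := hodd
    lia

/-- A6 -/
theorem mem_N_of_even (hw : Good w) (h2 : w 2 = 1) {a b : Kˣ} (ha : ∃ m : ℤ, w a = exp (2 * m))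
    (hb : ∃ m : ℤ, w b = exp (2 * m)) : b ∈ N w (a : K) := by
  obtain ⟨m, hm⟩ := ha
  obtain ⟨n, hn⟩ := hb
  obtain ⟨s, hs⟩ := exists_val hw (-m)
  obtain ⟨t, ht⟩ := exists_val hw (-n)
  rw [← N_mul_sq _ _ s.ne_zero, ← Subgroup.mul_mem_cancel_right _ (H_le_N _ (sq_mem_H t))]
  have h1 : w ((a : K) * s ^ 2) = 1 := by
    rw [map_mul, map_pow, hm, hs, pow_two, ← exp_add, ← exp_add, ← exp_zero]; congr 1; ring
  have h1' : w ((b : K) * t ^ 2) = 1 := by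
    rw [map_mul, map_pow, hn, ht, pow_two, ← exp_add, ← exp_add, ← exp_zero]; congr 1; ring
  obtain ⟨y, z, h⟩ := hw.r3 h2 _ _ h1 h1'
  rw [mem_N_iff]
  refine ⟨y, z, ?_⟩
  push_cast
  rw [map_mul, h1', four_eq, h2, one_mul, one_mul]
  exact h

end Loc


set_option linter.unusedSectionVars false
set_option linter.deprecated false
set_option linter.style.haveILetI false

open WithZero IsDedekindDomain NumberField

/-- finite primes of a number field -/
abbrev Pl (K : Type*) [Field K] [NumberField K] := HeightOneSpectrum (𝓞 K)

namespace Loc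

variable {K : Type*} [Field K] [NumberField K]

/-- the valuation attached to a prime -/
noncomputable abbrev vl (v : Pl K) : Valuation K ℤᵐ⁰ := v.valuation K

lemma vl_int_lt (v : Pl K) (r : 𝓞 K) : vl v (r : K) < 1 ↔ r ∈ v.asIdeal :=
  v.valuation_lt_one_iff_mem r

lemma vl_int_le (v : Pl K) (r : 𝓞 K) : vl v (r : K) ≤ 1 := v.valuation_le_one r

lemma approx (v : Pl K) {x : K} (hx : vl v x ≤ 1) {g : ℤᵐ⁰} (hg : g ≠ 0) :
    ∃ r : 𝓞 K, vl v (x - r) < g := by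
  obtain ⟨a, ha⟩ := v.exists_valuation_sub_lt_of_integer hx (Units.mk0 g hg)
  exact ⟨a, by rw [Valuation.map_sub_swap]; exact ha⟩

lemma good (v : Pl K) : Good (vl v) := by
  have hmax : v.asIdeal.IsMaximal := v.isMaximal
  letI : Field (𝓞 K ⧸ v.asIdeal) := Ideal.Quotient.field _
  haveI : Finite (𝓞 K ⧸ v.asIdeal) := Ring.HasFiniteQuotients.finiteQuotient v.ne_bot
  letI : Fintype (𝓞 K ⧸ v.asIdeal) := Fintype.ofFinite _
  have mk_eq : ∀ r : 𝓞 K, Ideal.Quotient.mk v.asIdeal r = 0 ↔ vl v (r : K) < 1 := fun r => by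
    rw [Ideal.Quotient.eq_zero_iff_mem, vl_int_lt]
  refine ⟨v.valuation_exists_uniformizer K, ?_, ?_, ?_⟩
  · have hns : ¬ Function.Surjective (fun t : 𝓞 K ⧸ v.asIdeal => t - t ^ 2) := by
      rw [← Finite.injective_iff_surjective]
      intro hinj
      have := @hinj 0 1 (by simp)
      simp at this
    simp only [Function.Surjective, not_forall, not_exists] at hns
    obtain ⟨d, hd⟩ := hns
    obtain ⟨d, rfl⟩ := Ideal.Quotient.mk_surjective d
    refine ⟨d, vl_int_le v d, fun t ht => ?_⟩
    obtain ⟨r, hr⟩ := approx v ht one_ne_zero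
    have h1 : vl v ((r ^ 2 - r + d : 𝓞 K) : K) = 1 := by
      refine le_antisymm (vl_int_le v _) (not_lt.mp fun h => ?_)
      rw [← mk_eq] at h
      apply hd (Ideal.Quotient.mk _ r)
      simp only [map_add, map_sub, map_pow] at h
      linear_combination -h
    rw [show t ^ 2 - t + (d : K) = ((r ^ 2 - r + d : 𝓞 K) : K) + (t - r) * (t + r - 1) by
      push_cast; ring]
    rw [Valuation.map_add_eq_of_lt_left, h1]
    rw [h1, map_mul]
    refine mul_lt_one_of_lt_of_le hr ?_
    exact Valuation.map_sub_le _ (Valuation.map_add_le _ ht (vl_int_le v r)) (by simp)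
  · intro h2 u hu
    have h20 : (2 : 𝓞 K ⧸ v.asIdeal) = 0 := by
      have := (mk_eq 2).mpr h2
      exact this
    have hs : Function.Surjective (fun t : 𝓞 K ⧸ v.asIdeal => t ^ 2) := by
      rw [← Finite.injective_iff_surjective]
      intro x y hxy
      have : (x - y) ^ 2 = 0 := by
        simp only at hxy
        linear_combination hxy + (y ^ 2 - x * y) * h20
      exact sub_eq_zero.mp (pow_eq_zero_iff two_ne_zero |>.mp this)
    obtain ⟨a, ha⟩ := approx v hu.le one_ne_zero
    obtain ⟨r, hr⟩ := hs (Ideal.Quotient.mk _ a)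
    obtain ⟨r, rfl⟩ := Ideal.Quotient.mk_surjective r
    refine ⟨r, vl_int_le v r, ?_⟩
    rw [show (r : K) ^ 2 - u = ((r ^ 2 - a : 𝓞 K) : K) - (u - a) by push_cast; ring]
    refine Valuation.map_sub_lt _ ?_ ha
    rw [← mk_eq]
    simp only [map_sub, map_pow] at hr ⊢
    rw [hr, sub_self]
  · intro h2 a b ha hb
    have hchar : ringChar (𝓞 K ⧸ v.asIdeal) ≠ 2 := by
      intro hc
      have : ((2 : ℕ) : 𝓞 K ⧸ v.asIdeal) = 0 := by rw [← hc]; exact ringChar.Nat.cast_ringChar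
      have h3 := (mk_eq 2).mp this
      exact absurd h3 (not_lt.mpr h2.ge)
    obtain ⟨a', ha'⟩ := approx v ha.le one_ne_zero
    obtain ⟨b', hb'⟩ := approx v hb.le one_ne_zero
    have ha0 : Ideal.Quotient.mk v.asIdeal a' ≠ 0 := by
      rw [Ne, mk_eq]
      intro h
      have := Valuation.map_add_lt _ ha' h
      rw [sub_add_cancel, ha] at this
      exact lt_irrefl _ this
    open Polynomial in
    obtain ⟨y, z, hyz⟩ := FiniteField.exists_root_sum_quadratic
      (f := (X ^ 2 - C (Ideal.Quotient.mk v.asIdeal b')))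
      (g := (C (-Ideal.Quotient.mk v.asIdeal a') * X ^ 2)) (by compute_degree!)
      (by compute_degree!) (FiniteField.odd_card_of_char_ne_two hchar)
    obtain ⟨y, rfl⟩ := Ideal.Quotient.mk_surjective y
    obtain ⟨z, rfl⟩ := Ideal.Quotient.mk_surjective z
    refine ⟨y, z, ?_⟩
    rw [show (y : K) ^ 2 - a * z ^ 2 - b = ((y ^ 2 - a' * z ^ 2 - b' : 𝓞 K) : K) - (a - a') * z ^ 2
      - (b - b') by push_cast; ring]
    refine Valuation.map_sub_lt _ (Valuation.map_sub_lt _ ?_ ?_) hb'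
    · rw [← mk_eq]
      simp at hyz
      simp only [map_sub, map_mul, map_pow]
      linear_combination hyz
    · rw [map_mul, map_pow]
      exact mul_lt_one_of_lt_of_le ha' (pow_le_one' (vl_int_le v z) 2)

lemma index_le_of_fun {G : Type*} [CommGroup G] (P : Subgroup G) {α : Type*} [Finite α] (f : G → α)
    (h : ∀ x y, f x = f y → x / y ∈ P) : P.index ≠ 0 ∧ P.index ≤ Nat.card α := by
  have hinj : Function.Injective (fun q : G ⧸ P => f q.out) := by
    intro p q hpq
    have := h _ _ hpq
    rw [← QuotientGroup.out_eq' p, ← QuotientGroup.out_eq' q, QuotientGroup.eq]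
    have h2 := inv_mem this
    rwa [inv_div, div_eq_mul_inv, mul_comm] at h2
  haveI : Finite (G ⧸ P) := Finite.of_injective _ hinj
  refine ⟨Subgroup.index_ne_zero_of_finite, ?_⟩
  rw [Subgroup.index]
  exact Nat.card_le_card_of_injective _ hinj

/-- local units -/
def U (w : Valuation K ℤᵐ⁰) : Subgroup Kˣ where
  carrier := {x | w x = 1}
  one_mem' := by simp
  mul_mem' := by intro a b ha hb; simp at *; simp [ha, hb]
  inv_mem' := by intro a ha; simp at *; simp [ha]

/-- local principal units of level 4 times p -/
def U1 (w : Valuation K ℤᵐ⁰) : Subgroup Kˣ where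
  carrier := {x | w ((x : K) - 1) < w 4}
  one_mem' := by simpa using four_pos w
  mul_mem' := by
    intro a b ha hb
    simp only [Set.mem_setOf_eq] at *
    rw [show ((a * b : Kˣ) : K) - 1 = (a - 1) * b + (b - 1) by push_cast; ring]
    refine w.map_add_lt ?_ hb
    rw [map_mul, val_eq_one hb, mul_one]; exact ha
  inv_mem' := by
    intro a ha
    simp only [Set.mem_setOf_eq] at *
    rw [show ((a⁻¹ : Kˣ) : K) - 1 = -((a - 1) * (a : K)⁻¹) by
      have := a.ne_zero
      push_cast; field_simp; ring]
    rw [Valuation.map_neg, map_mul, map_inv₀, val_eq_one ha]; simpa using ha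

lemma mem_U1 {w : Valuation K ℤᵐ⁰} {x : Kˣ} : x ∈ U1 w ↔ w ((x : K) - 1) < w 4 := Iff.rfl

lemma div_mem_U1 {w : Valuation K ℤᵐ⁰} {x y : Kˣ} (hy : w y = 1) (h : w ((x : K) - y) < w 4) :
    x / y ∈ U1 w := by
  rw [mem_U1, show ((x / y : Kˣ) : K) - 1 = (x - y) / y by
    have := y.ne_zero
    push_cast; field_simp]
  rwa [map_div₀, hy, div_one]

lemma U1_le_H (w : Valuation K ℤᵐ⁰) : U1 w ≤ H w := fun _ hx => mem_H_of_close hx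

lemma H_index_two (v : Pl K) : (H (vl v) ⊔ U (vl v)).index ≠ 0 ∧ (H (vl v) ⊔ U (vl v)).index ≤ 2 := by
  have := index_le_of_fun (H (vl v) ⊔ U (vl v)) (α := Bool) (fun x => decide (Even (log (vl v x)))) ?_
  · simpa using this
  intro x y hxy
  have hpar : Even (log (vl v x) - log (vl v y)) := by
    rw [Int.even_sub]; simpa using hxy
  obtain ⟨k, hk⟩ := hpar
  obtain ⟨s, hs⟩ := exists_val (good v) k
  have : x / y = s ^ 2 * (x / y / s ^ 2) := by simp
  rw [this]
  refine mul_mem (Subgroup.mem_sup_left (sq_mem_H s)) (Subgroup.mem_sup_right ?_)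
  change vl v _ = 1
  push_cast
  have hx := (vpos (w := vl v) x.ne_zero).ne'
  have hy := (vpos (w := vl v) y.ne_zero).ne'
  rw [map_div₀, map_div₀, map_pow, hs, ← exp_log hx, ← exp_log hy, ← exp_sub, hk, exp_add, pow_two]
  simp

/-- units modulo principal units -/
abbrev UQ (w : Valuation K ℤᵐ⁰) := U w ⧸ (U1 w).subgroupOf (U w)

theorem H_relIndex (v : Pl K) (e : ℕ) (he : vl v 2 = exp (-(e : ℤ))) :
    (H (vl v)).relIndex (U (vl v)) ≠ 0 ∧
      (H (vl v)).relIndex (U (vl v)) ≤ 2 * (Ideal.absNorm v.asIdeal) ^ e := by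
  set w := vl v with hw
  have h4 : w 4 = exp (-(2 * e : ℤ)) := by rw [four_eq, he, ← exp_add]; congr 1; ring
  haveI hfin : ∀ n : ℕ, Finite (𝓞 K ⧸ v.asIdeal ^ n) := fun n =>
    Ring.HasFiniteQuotients.finiteQuotient (pow_ne_zero n v.ne_bot)
  -- U / U1 finite
  have hap : ∀ (n : ℕ) (x : K), ∃ r : 𝓞 K, w x ≤ 1 → w (x - r) < exp (-(n : ℤ)) := by
    intro n x
    by_cases hx : w x ≤ 1
    · obtain ⟨r, hr⟩ := approx v hx (g := exp (-(n : ℤ))) exp_ne_zero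
      exact ⟨r, fun _ => hr⟩
    · exact ⟨0, fun h => absurd h hx⟩
  choose F hF using hap
  have hclose : ∀ (n : ℕ) (x y : K), w x ≤ 1 → w y ≤ 1 →
      (Ideal.Quotient.mk (v.asIdeal ^ n) (F n x) = Ideal.Quotient.mk (v.asIdeal ^ n) (F n y)) →
      w (x - y) ≤ exp (-(n : ℤ)) := by
    intro n x y hx hy hxy
    rw [Ideal.Quotient.eq, ← v.intValuation_le_pow_iff_mem, ← v.valuation_of_algebraMap (K := K)] at hxy
    rw [show x - y = (x - F n x) - (y - F n y) + algebraMap (𝓞 K) K (F n x - F n y) by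
      simp only [map_sub]; ring]
    refine w.map_add_le (w.map_sub_le (hF n x hx).le (hF n y hy).le) hxy
  haveI hGf : Finite (UQ w) := by
    have := index_le_of_fun ((U1 w).subgroupOf (U w)) (α := 𝓞 K ⧸ v.asIdeal ^ (2 * e + 1))
      (fun x => Ideal.Quotient.mk _ (F (2 * e + 1) (x : Kˣ))) (fun x y hxy => by
        have hx : w ((x : Kˣ) : K) = 1 := x.2
        have hy : w ((y : Kˣ) : K) = 1 := y.2
        have := hclose _ _ _ hx.le hy.le hxy
        rw [Subgroup.mem_subgroupOf]
        apply div_mem_U1 hy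
        refine this.trans_lt ?_
        rw [h4, exp_lt_exp]; push_cast; lia)
    exact Subgroup.index_ne_zero_iff_finite.mp this.1
  let sq : UQ w →* UQ w :=
    { toFun := fun g => g ^ 2
      map_one' := one_pow 2
      map_mul' := fun a b => by
        induction a using QuotientGroup.induction_on with | H a => ?_
        induction b using QuotientGroup.induction_on with | H b => ?_
        exact congrArg _ (mul_pow a b 2) }
  have hindex : sq.range.index = Nat.card sq.ker := by
    have h1 := Subgroup.card_mul_index sq.ker
    have h2 := Subgroup.card_mul_index sq.range
    rw [Subgroup.index_ker] at h1
    have h3 : 0 < Nat.card sq.range := Nat.card_pos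
    apply Nat.eq_of_mul_eq_mul_left h3
    rw [h2, ← h1, mul_comm]
  have hle : sq.range.comap (QuotientGroup.mk' ((U1 w).subgroupOf (U w))) ≤ (H w).subgroupOf (U w) := by
    intro u hu
    obtain ⟨g, hg⟩ := hu
    obtain ⟨t, rfl⟩ := QuotientGroup.mk_surjective g
    change ((t ^ 2 : U w) : UQ w) = (u : UQ w) at hg
    rw [QuotientGroup.eq, Subgroup.mem_subgroupOf] at hg
    rw [Subgroup.mem_subgroupOf]
    have h1 := mul_mem (sq_mem_H (w := w) (t : Kˣ)) (U1_le_H w hg)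
    simpa using h1
  have hcard : Nat.card sq.ker ≤ 2 * (Ideal.absNorm v.asIdeal) ^ e := by
    obtain ⟨p, hp⟩ := exists_val (good v) (-(e + 1 : ℤ))
    have hpe : ∀ y : K, w (y - 1) < w 2 → w ((y - 1) / p) ≤ 1 := by
      intro y hy
      rw [map_div₀, hp]
      refine div_le_one_of_le₀ ?_ zero_le
      by_cases h0 : w (y - 1) = 0
      · rw [h0]; exact zero_le
      · rw [he, ← log_lt_iff_lt_exp h0] at hy
        rw [← log_le_iff_le_exp h0]; lia
    have hsign : ∀ y : Kˣ, y ^ 2 ∈ U1 w → ∃ s : Bool, w ((bif s then (y : K) else -y) - 1) < w 2 := by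
      intro y hy
      rw [mem_U1] at hy
      by_contra hcon
      push Not at hcon
      have h1 := hcon true
      have h2 := hcon false
      simp only [cond_true, cond_false] at h1 h2
      rw [show (-y : K) - 1 = -(y + 1) by ring, Valuation.map_neg] at h2
      refine absurd hy (not_lt.mpr ?_)
      rw [show ((y ^ 2 : Kˣ) : K) - 1 = (y - 1) * (y + 1) by push_cast; ring, map_mul, four_eq]
      exact mul_le_mul' h1 h2
    have hker : ∀ g : sq.ker, ((g : UQ w).out : Kˣ) ^ 2 ∈ U1 w := by
      intro g
      have h1 : (g : UQ w) ^ 2 = 1 := g.2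
      rw [← QuotientGroup.out_eq' (g : UQ w), ← QuotientGroup.mk_pow, QuotientGroup.eq_one_iff,
        Subgroup.mem_subgroupOf] at h1
      simpa using h1
    choose s hs using fun g : sq.ker => hsign _ (hker g)
    let f : sq.ker → Bool × (𝓞 K ⧸ v.asIdeal ^ e) := fun g =>
      (s g, Ideal.Quotient.mk _ (F e (((bif s g then (((g : UQ w).out : Kˣ) : K)
        else -(((g : UQ w).out : Kˣ) : K)) - 1) / p)))
    have hf : Function.Injective f := by
      intro g g' hgg
      simp only [f, Prod.mk.injEq] at hgg
      obtain ⟨h1, h2⟩ := hgg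
      have h3 := hclose _ _ _ (hpe _ (hs g)) (hpe _ (hs g')) h2
      have hy : w (((g' : UQ w).out : Kˣ) : K) = 1 := ((g' : UQ w).out).2
      have h5 : w ((((g : UQ w).out : Kˣ) : K) - (((g' : UQ w).out : Kˣ) : K)) < w 4 := by
        have h6 : w ((bif s g then (((g : UQ w).out : Kˣ) : K) else -(((g : UQ w).out : Kˣ) : K))
           - (bif s g' then (((g' : UQ w).out : Kˣ) : K) else -(((g' : UQ w).out : Kˣ) : K))) < w 4 := by
          rw [← sub_div, map_div₀, hp, div_le_iff₀ (by simp [zero_lt_iff]), ← exp_add,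
            sub_sub_sub_cancel_right] at h3
          refine h3.trans_lt ?_
          rw [h4, exp_lt_exp]; lia
        rw [← h1] at h6
        cases hsg : s g
        · rw [hsg] at h6
          simp only [cond_false] at h6
          rw [neg_sub_neg, Valuation.map_sub_swap] at h6; exact h6
        · rw [hsg] at h6
          exact h6
      have h7 := div_mem_U1 hy h5
      apply Subtype.ext
      rw [← QuotientGroup.out_eq' (g : UQ w), ← QuotientGroup.out_eq' (g' : UQ w), QuotientGroup.eq,
        Subgroup.mem_subgroupOf]
      have h8 := inv_mem h7
      rw [inv_div, div_eq_mul_inv, mul_comm] at h8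
      simpa using h8
    have := Nat.card_le_card_of_injective f hf
    refine this.trans (le_of_eq ?_)
    rw [Nat.card_prod, ← Submodule.cardQuot_apply, ← Ideal.absNorm_apply, map_pow]
    simp
  have hi : (sq.range.comap (QuotientGroup.mk' ((U1 w).subgroupOf (U w)))).index = sq.range.index :=
    Subgroup.index_comap_of_surjective _ (QuotientGroup.mk'_surjective _)
  have hne : sq.range.index ≠ 0 := Subgroup.index_ne_zero_of_finite
  have hdvd := Subgroup.index_dvd_of_le hle
  rw [hi] at hdvd
  refine ⟨fun h0 => hne ?_, ?_⟩
  · rw [Subgroup.relIndex] at h0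
    rw [h0] at hdvd
    exact Nat.eq_zero_of_zero_dvd hdvd
  · refine (Nat.le_of_dvd (Nat.pos_of_ne_zero hne) hdvd).trans ?_
    rw [hindex]; exact hcard

theorem H_index (v : Pl K) (e : ℕ) (he : vl v 2 = exp (-(e : ℤ))) :
    (H (vl v)).index ≠ 0 ∧ (H (vl v)).index ≤ 4 * (Ideal.absNorm v.asIdeal) ^ e := by
  have hrel := H_relIndex v e he
  set w := vl v with hw
  have h2 := H_index_two v
  have h3 := Subgroup.relIndex_mul_index (H := H w) (K := H w ⊔ U w) le_sup_left
  have h4 : (H w).relIndex (H w ⊔ U w) = (H w).relIndex (U w) := by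
    rw [sup_comm]; exact Subgroup.relIndex_sup_right _ _
  rw [← h3, h4]
  refine ⟨mul_ne_zero hrel.1 h2.1, ?_⟩
  calc _ ≤ (2 * (Ideal.absNorm v.asIdeal) ^ e) * 2 := Nat.mul_le_mul hrel.2 h2.2
    _ = _ := by ring

lemma odd_mul_mem (v : Pl K) (h2 : vl v 2 = 1) {a x : Kˣ} (ha : vl v a = 1) (hx : vl v x = 1)
    (ha' : a ∉ H (vl v)) (hx' : x ∉ H (vl v)) : a * x ∈ H (vl v) := by
  have hrel := H_relIndex v 0 (by simpa using h2)
  have h3 : ((H (vl v)).subgroupOf (U (vl v))).index = 2 := by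
    have h4 : ((H (vl v)).subgroupOf (U (vl v))).index ≠ 1 := by
      intro h
      rw [Subgroup.index_eq_one, Subgroup.subgroupOf_eq_top] at h
      exact ha' (h ha)
    have h5 := hrel.1
    have h6 := hrel.2
    simp only [Subgroup.relIndex] at h5 h6
    lia
  have := Subgroup.mul_mem_iff_of_index_two h3 (a := ⟨a, ha⟩) (b := ⟨x, hx⟩)
  simp only [Subgroup.mem_subgroupOf] at this
  exact this.mpr (iff_of_false ha' hx')

end Loc


set_option linter.unusedSectionVars false
set_option linter.deprecated false
set_option linter.style.haveILetI false

open WithZero IsDedekindDomain NumberField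

namespace Loc

variable {K : Type*} [Field K] [NumberField K]

/-- places of a number field -/
abbrev Place (K : Type*) [Field K] [NumberField K] := Pl K ⊕ InfinitePlace K

/-- local square class group at an infinite place -/
noncomputable def HI (p : InfinitePlace K) : Subgroup Kˣ where
  carrier := {x | ∀ hp : p.IsReal, 0 < InfinitePlace.embedding_of_isReal hp x}
  one_mem' := by simp
  mul_mem' := by
    intro a b ha hb hp
    rw [Units.val_mul, map_mul]
    exact mul_pos (ha hp) (hb hp)
  inv_mem' := by
    intro a ha hp
    rw [Units.val_inv_eq_inv_val, map_inv₀]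
    exact inv_pos.mpr (ha hp)

lemma mem_HI {p : InfinitePlace K} {x : Kˣ} :
    x ∈ HI p ↔ ∀ hp : p.IsReal, 0 < InfinitePlace.embedding_of_isReal hp x := Iff.rfl

/-- local square class group at a place -/
noncomputable def HP : Place K → Subgroup Kˣ
  | Sum.inl v => H (vl v)
  | Sum.inr p => HI p

/-- local norm group at a place -/
noncomputable def NP (p : Place K) (a : K) : Subgroup Kˣ := norms a ⊔ HP p

lemma emb_ne {p : InfinitePlace K} (hp : p.IsReal) (x : Kˣ) :
    InfinitePlace.embedding_of_isReal hp x ≠ 0 := by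
  rw [map_ne_zero]; exact x.ne_zero

lemma sq_mem_HP (p : Place K) (x : Kˣ) : x ^ 2 ∈ HP p := by
  rcases p with v | p
  · exact sq_mem_H x
  · intro hp
    rw [Units.val_pow_eq_pow_val, map_pow]
    have := emb_ne hp x
    positivity

lemma HP_le_NP (p : Place K) (a : K) : HP p ≤ NP p a := le_sup_right
lemma norms_le_NP (p : Place K) (a : K) : norms a ≤ NP p a := le_sup_left

lemma NP_eq_top {p : Place K} {a : Kˣ} (h : a ∈ HP p) : NP p (a : K) = ⊤ := by
  rcases p with v | p
  · exact N_eq_top h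
  by_cases hp : p.IsReal
  swap
  · rw [eq_top_iff]
    intro x _
    exact HP_le_NP _ _ (fun hp' => absurd hp' hp)
  rw [eq_top_iff]
  intro x _
  have ha := h hp
  set f := InfinitePlace.embedding_of_isReal hp with hf
  have key : ∃ y : Kˣ, y ∈ norms (a : K) ∧ f y < 0 := by
    obtain ⟨n, hn⟩ := exists_nat_gt (1 / f a)
    have hn0 : (0 : ℝ) < n := lt_trans (by positivity) hn
    have hlt : f (1 - a * (n : K) ^ 2) < 0 := by
      rw [div_lt_iff₀ ha] at hn
      simp only [map_sub, map_one, map_mul, map_pow, map_natCast]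
      have hn1 : (1 : ℝ) ≤ n := by
        have : 0 < n := by exact_mod_cast hn0
        exact_mod_cast this
      nlinarith
    have hne : (1 - a * (n : K) ^ 2 : K) ≠ 0 := by
      intro h0; rw [h0] at hlt; simp at hlt
    exact ⟨Units.mk0 _ hne, ⟨1, n, by simp⟩, hlt⟩
  obtain ⟨y, hy, hy0⟩ := key
  rcases lt_or_gt_of_ne (emb_ne hp x) with hx | hx
  · have : x = y * (x / y) := by simp
    rw [this]
    refine mul_mem (norms_le_NP _ _ hy) (HP_le_NP _ _ fun hp' => ?_)
    rw [Units.val_div_eq_div_val, map_div₀]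
    exact div_pos_of_neg_of_neg hx hy0
  · exact HP_le_NP _ _ fun hp' => hx

lemma exists_notMem_NP {p : Place K} {a : Kˣ} (h : a ∉ HP p) : ∃ b, b ∉ NP p (a : K) := by
  rcases p with v | p
  · exact exists_notMem_N (good v) h
  · have h' : ∃ hp : p.IsReal, InfinitePlace.embedding_of_isReal hp a < 0 := by
      by_contra hcon
      push Not at hcon
      exact h fun hp => lt_of_le_of_ne (hcon hp) (emb_ne hp a).symm
    obtain ⟨hp, ha⟩ := h'
    refine ⟨-1, fun hmem => ?_⟩
    have hle : NP (Sum.inr p) (a : K) ≤ HI p := by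
      refine sup_le ?_ le_rfl
      rintro x ⟨y, z, hx⟩ hp'
      have hx0 := emb_ne hp' x
      refine lt_of_le_of_ne ?_ hx0.symm
      rw [hx]
      simp only [map_sub, map_mul, map_pow]
      nlinarith [sq_nonneg (InfinitePlace.embedding_of_isReal hp y),
        sq_nonneg (InfinitePlace.embedding_of_isReal hp z)]
    have := hle hmem hp
    simp at this
    linarith

lemma HI_index_real (p : InfinitePlace K) : (HI p).index ≠ 0 ∧ (HI p).index ≤ 2 := by
  classical
  have := index_le_of_fun (HI p) (α := Bool)
    (fun x => decide (∃ hp : p.IsReal, 0 < InfinitePlace.embedding_of_isReal hp x)) ?_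
  · simpa using this
  intro x y hxy hp
  rw [Units.val_div_eq_div_val, map_div₀]
  simp only [decide_eq_decide] at hxy
  rcases lt_or_gt_of_ne (emb_ne hp x) with hx | hx <;> rcases lt_or_gt_of_ne (emb_ne hp y) with hy | hy
  · exact div_pos_of_neg_of_neg hx hy
  · obtain ⟨_, h⟩ := hxy.mpr ⟨hp, hy⟩
    exact absurd hx h.not_gt
  · obtain ⟨_, h⟩ := hxy.mp ⟨hp, hx⟩
    exact absurd hy h.not_gt
  · exact div_pos hx hy

lemma HI_complex {p : InfinitePlace K} (hp : p.IsComplex) : HI p = ⊤ := by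
  rw [eq_top_iff]
  intro x _ hp'
  exact absurd hp' (InfinitePlace.not_isReal_iff_isComplex.mpr hp)

lemma exists_int_mul_sq (x : Kˣ) : ∃ (r : 𝓞 K) (s : Kˣ), (r : K) = x * (s : K) ^ 2 := by
  obtain ⟨n, d, hd, h⟩ := IsFractionRing.div_surjective (A := 𝓞 K) (x : K)
  have hd0 : (algebraMap (𝓞 K) K d) ≠ 0 := by
    simpa using nonZeroDivisors.ne_zero hd
  refine ⟨n * d, Units.mk0 _ hd0, ?_⟩
  rw [← h]
  simp
  field_simp

lemma div_mul_sq_mem {G : Type*} [CommGroup G] (P : Subgroup G) {x t s : G} (hs : s ^ 2 ∈ P)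
    (h : x / (t * s ^ 2) ∈ P) : x / t ∈ P := by
  have : x / t = x / (t * s ^ 2) * s ^ 2 := by
    rw [div_mul_eq_div_div]; simp
  rw [this]; exact mul_mem h hs

lemma ip_neg (p : InfinitePlace K) (x : K) : p (-x) = p x := by
  rw [← InfinitePlace.norm_embedding_eq, ← InfinitePlace.norm_embedding_eq, map_neg, norm_neg]

lemma ip_nat (p : InfinitePlace K) (n : ℕ) : p (n : K) = n := by
  rw [← InfinitePlace.norm_embedding_eq, map_natCast]; simp

lemma sign_approx (c : InfinitePlace K → Kˣ) : ∃ z : 𝓞 K, z ≠ 0 ∧ ∀ p (hp : p.IsReal),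
    0 < InfinitePlace.embedding_of_isReal hp (z / c p : K) := by
  have hd := InfinitePlace.denseRange_algebraMap_pi K
  let O : Set ((v : InfinitePlace K) → WithAbs v.1) :=
    Set.pi Set.univ fun p => Metric.ball (WithAbs.toAbs p.1 (c p : K)) (p (c p : K))
  have hO : IsOpen O := isOpen_set_pi Set.finite_univ fun p _ => Metric.isOpen_ball
  have hne : O.Nonempty := ⟨fun p => WithAbs.toAbs p.1 (c p : K), fun p _ =>
    Metric.mem_ball_self (InfinitePlace.pos_iff.mpr (c p).ne_zero)⟩
  obtain ⟨z, hz⟩ := hd.exists_mem_open hO hne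
  have hz' : ∀ p : InfinitePlace K, p (z - c p) < p (c p) := by
    intro p
    have := hz p trivial
    rw [Metric.mem_ball, dist_eq_norm] at this
    exact this
  have hpos : ∀ p (hp : p.IsReal), 0 < InfinitePlace.embedding_of_isReal hp (z / c p : K) := by
    intro p hp
    have h1 := hz' p
    rw [← InfinitePlace.norm_embedding_of_isReal hp, ← InfinitePlace.norm_embedding_of_isReal hp,
      map_sub, Real.norm_eq_abs, Real.norm_eq_abs] at h1
    rw [map_div₀]
    have h0 := emb_ne hp (c p)
    rcases lt_or_gt_of_ne h0 with hx | hx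
    · rw [abs_of_neg hx, abs_lt] at h1
      exact div_pos_of_neg_of_neg (by linarith) hx
    · rw [abs_of_pos hx, abs_lt] at h1
      exact div_pos (by linarith) hx
  have hz0 : z ≠ 0 := by
    rintro rfl
    have p : InfinitePlace K := Classical.arbitrary _
    have := hz' p
    rw [zero_sub, ip_neg] at this
    exact lt_irrefl _ this
  obtain ⟨r, s, hr⟩ := exists_int_mul_sq (Units.mk0 z hz0)
  refine ⟨r, ?_, fun p hp => ?_⟩
  · rintro rfl
    simp [hz0] at hr
  · rw [hr, Units.val_mk0, mul_div_right_comm, map_mul, map_pow]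
    have := emb_ne hp s
    exact mul_pos (hpos p hp) (by positivity)

theorem weak_approx (S : Finset (Pl K)) (t : Pl K → Kˣ) (c : InfinitePlace K → Kˣ) :
    ∃ x : Kˣ, (∀ v ∈ S, x / t v ∈ H (vl v)) ∧ ∀ p, x / c p ∈ HI p := by
  classical
  obtain ⟨z, hz0, hz⟩ := sign_approx c
  choose r s hr using fun v => exists_int_mul_sq (t v)
  have hm : ∀ v : Pl K, ∃ m : ℕ, ∀ u : 𝓞 K, u ∈ v.asIdeal ^ m → vl v (u : K) < vl v (4 * (r v : K)) := by
    intro v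
    have h0 : vl v (4 * (r v : K)) ≠ 0 := by
      rw [Valuation.ne_zero_iff, hr]
      simp
    obtain ⟨m, hm⟩ := even_val (w := vl v) ((Valuation.ne_zero_iff _).mp h0)
    refine ⟨(-m).toNat + 1, fun u hu => ?_⟩
    rw [← v.intValuation_le_pow_iff_mem, ← v.valuation_of_algebraMap (K := K)] at hu
    refine hu.trans_lt ?_
    rw [hm, exp_lt_exp]; push_cast; lia
  choose m hm using hm
  obtain ⟨y, hy⟩ := IsDedekindDomain.exists_forall_sub_mem_ideal (s := S)
    (fun v : Pl K => v.asIdeal) m (fun v _ => v.prime)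
    (fun v _ w _ h h' => h (HeightOneSpectrum.ext h')) (fun v => r v)
  set I : Ideal (𝓞 K) := ∏ v ∈ S, v.asIdeal ^ m v with hI
  have hI0 : I ≠ ⊥ := by
    rw [hI, ← Ideal.zero_eq_bot, Finset.prod_ne_zero_iff]
    exact fun v _ => pow_ne_zero _ v.ne_bot
  set M0 := Ideal.absNorm I with hM0
  have hM0' : 0 < M0 := Nat.pos_of_ne_zero (by rwa [hM0, Ne, Ideal.absNorm_eq_zero_iff])
  have hM0mem : ∀ v ∈ S, (M0 : 𝓞 K) ∈ v.asIdeal ^ m v := fun v hv =>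
    (Ideal.prod_le_inf.trans (Finset.inf_le hv)) (Ideal.absNorm_mem I)
  have hzK : ∀ p : InfinitePlace K, 0 < p (z : K) := fun p =>
    InfinitePlace.pos_iff.mpr (by simpa using hz0)
  obtain ⟨Nn, hNn⟩ : ∃ Nn : ℕ, ∀ p : InfinitePlace K, p (y : K) < Nn * p (z : K) := by
    choose f hf using fun p : InfinitePlace K => exists_nat_gt (p (y : K) / p (z : K))
    refine ⟨∑ p, f p, fun p => ?_⟩
    rw [← div_lt_iff₀ (hzK p)]
    refine (hf p).trans_le ?_
    exact_mod_cast Finset.single_le_sum (f := f) (fun _ _ => Nat.zero_le _) (Finset.mem_univ p)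
  set M := M0 * Nn with hM
  have hMlt : ∀ p : InfinitePlace K, p (y : K) < M * p (z : K) := fun p => by
    refine (hNn p).trans_le (mul_le_mul_of_nonneg_right ?_ (hzK p).le)
    exact_mod_cast Nat.le_mul_of_pos_left _ hM0'
  set X : 𝓞 K := y + z * M with hX
  have hcast : (X : K) = y + z * M := by rw [hX]; simp
  have hX0 : (X : K) ≠ 0 := by
    intro h0
    have p : InfinitePlace K := Classical.arbitrary _
    have h1 : (y : K) = - (z * M) := by rw [hcast] at h0; linear_combination h0
    have := hMlt p
    rw [h1, ip_neg, map_mul, mul_comm, ip_nat] at this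
    exact lt_irrefl _ this
  refine ⟨Units.mk0 (X : K) hX0, fun v hv => ?_, fun p hp => ?_⟩
  · apply div_mul_sq_mem _ (s := s v) (sq_mem_H _)
    apply div_mem_H
    push_cast
    rw [← hr, Units.val_mk0, ← map_sub]
    apply hm
    rw [show X - r v = (y - r v) + z * Nn * M0 by rw [hX, hM]; push_cast; ring]
    exact Ideal.add_mem _ (hy v hv) (Ideal.mul_mem_left _ _ (hM0mem v hv))
  · have h1 := hz p hp
    have h2 := hMlt p
    rw [← InfinitePlace.norm_embedding_of_isReal hp, ← InfinitePlace.norm_embedding_of_isReal hp,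
      Real.norm_eq_abs, Real.norm_eq_abs] at h2
    rw [Units.val_div_eq_div_val, Units.val_mk0, hcast]
    rw [map_div₀] at h1 ⊢
    rw [map_add, map_mul, map_natCast]
    have h0 := emb_ne hp (c p)
    rcases lt_or_gt_of_ne h0 with hx | hx
    · have hz1 : InfinitePlace.embedding_of_isReal hp (z : K) < 0 := by
        by_contra hcon
        exact absurd h1 (not_lt.mpr (div_nonpos_of_nonneg_of_nonpos (not_lt.mp hcon) hx.le))
      rw [abs_of_neg hz1, abs_lt] at h2
      exact div_pos_of_neg_of_neg (by linarith) hx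
    · have hz1 : 0 < InfinitePlace.embedding_of_isReal hp (z : K) := by
        by_contra hcon
        exact absurd h1 (not_lt.mpr (div_nonpos_of_nonpos_of_nonneg (not_lt.mp hcon) hx.le))
      rw [abs_of_pos hz1, abs_lt] at h2
      exact div_pos (by linarith) hx

end Loc


set_option linter.unusedSectionVars false
set_option linter.deprecated false
set_option linter.style.haveILetI false

open WithZero IsDedekindDomain NumberField

namespace Loc

variable {K : Type*} [Field K] [NumberField K]

/-- S-units -/
def SU (S : Finset (Pl K)) : Subgroup Kˣ where
  carrier := {x | ∀ v ∉ S, vl v (x : K) = 1}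
  one_mem' := by simp
  mul_mem' := by
    intro a b ha hb v hv
    rw [Units.val_mul, map_mul, ha v hv, hb v hv, one_mul]
  inv_mem' := by
    intro a ha v hv
    rw [Units.val_inv_eq_inv_val, map_inv₀, ha v hv, inv_one]

lemma mem_SU {S : Finset (Pl K)} {x : Kˣ} : x ∈ SU S ↔ ∀ v ∉ S, vl v (x : K) = 1 := Iff.rfl

lemma SU_mono {S T : Finset (Pl K)} (h : S ⊆ T) : SU S ≤ SU T := fun _ hx v hv =>
  hx v fun hv' => hv (h hv')

structure GoodS (S : Finset (Pl K)) : Prop where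
  dy : ∀ v ∉ S, vl v (2 : K) = 1
  pi : ∀ v ∉ S, ∃ p : Kˣ, vl v (p : K) = exp (-1 : ℤ) ∧ ∀ w ∉ S, w ≠ v → vl w (p : K) = 1

lemma GoodS.mono {S T : Finset (Pl K)} (hS : GoodS S) (h : S ⊆ T) : GoodS T where
  dy v hv := hS.dy v fun hv' => hv (h hv')
  pi v hv := by
    obtain ⟨p, h1, h2⟩ := hS.pi v fun hv' => hv (h hv')
    exact ⟨p, h1, fun w hw hwv => h2 w (fun hv' => hw (h hv')) hwv⟩

lemma supp_finite (x : Kˣ) : {v : Pl K | vl v (x : K) ≠ 1}.Finite := by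
  have h : ∀ x : 𝓞 K, x ≠ 0 → {v : Pl K | vl v (x : K) ≠ 1}.Finite := by
    intro x hx
    have := Ideal.finite_factors (I := Ideal.span {x}) (by simpa using hx)
    refine this.subset fun v hv => ?_
    have h1 : vl v (x : K) < 1 := lt_of_le_of_ne (vl_int_le v x) hv
    rw [vl_int_lt] at h1
    simpa [Ideal.dvd_span_singleton] using h1
  obtain ⟨n, d, hd, hx⟩ := IsFractionRing.div_surjective (A := 𝓞 K) (x : K)
  have hd0 := nonZeroDivisors.ne_zero hd
  have hn0 : n ≠ 0 := by
    rintro rfl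
    simp at hx
    exact x.ne_zero hx.symm
  refine ((h n hn0).union (h d hd0)).subset fun v hv => ?_
  by_contra hcon
  simp only [Set.mem_union, Set.mem_setOf_eq, not_or, not_not] at hcon
  apply hv
  rw [← hx, map_div₀, hcon.1, hcon.2, div_one]

lemma exists_good (S0 : Finset (Pl K)) : ∃ S : Finset (Pl K), S0 ⊆ S ∧ GoodS S := by
  classical
  choose J hJ using fun c : ClassGroup (𝓞 K) => ClassGroup.mk0_surjective c
  have hf : ∀ c, {v : Pl K | v.asIdeal ∣ (J c : Ideal (𝓞 K))}.Finite := fun c =>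
    Ideal.finite_factors (nonZeroDivisors.ne_zero (J c).2)
  have hfin : (⋃ c, {v : Pl K | v.asIdeal ∣ (J c : Ideal (𝓞 K))}).Finite := Set.finite_iUnion hf
  have h2 := supp_finite (K := K) (Units.mk0 2 two_ne_zero)
  refine ⟨S0 ∪ hfin.toFinset ∪ h2.toFinset, ?_, ?_, ?_⟩
  · intro x hx; simp [hx]
  · intro v hv
    by_contra hcon
    apply hv
    simp only [Finset.mem_union, Set.Finite.mem_toFinset]
    right; exact hcon
  · intro v hv
    have hndvd : ∀ w : Pl K, w ∉ S0 ∪ hfin.toFinset ∪ h2.toFinset → ∀ c, ¬ w.asIdeal ∣ (J c : Ideal (𝓞 K)) := by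
      intro w hw c hc
      apply hw
      simp only [Finset.mem_union, Set.Finite.mem_toFinset, Set.mem_iUnion]
      left; right; exact ⟨c, hc⟩
    let V : nonZeroDivisors (Ideal (𝓞 K)) := ⟨v.asIdeal, mem_nonZeroDivisors_of_ne_zero v.ne_bot⟩
    set c := (ClassGroup.mk0 V)⁻¹ with hc
    have h1 : ClassGroup.mk0 (V * J c) = 1 := by rw [map_mul, hJ, hc]; simp
    rw [ClassGroup.mk0_eq_one_iff] at h1
    obtain ⟨r, hr⟩ := h1
    have hr' : v.asIdeal * J c = Ideal.span {r} := hr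
    have hJ0 : (J c : Ideal (𝓞 K)) ≠ 0 := nonZeroDivisors.ne_zero (J c).2
    have hr0 : r ≠ 0 := by
      rintro rfl
      have : v.asIdeal * (J c : Ideal (𝓞 K)) = 0 := by rw [hr']; simp
      rcases mul_eq_zero.mp this with h | h
      · exact v.ne_bot h
      · exact hJ0 h
    have hrK : (r : K) ≠ 0 := by simpa using hr0
    refine ⟨Units.mk0 (r : K) hrK, ?_, ?_⟩
    · have ha : vl v (r : K) ≤ exp (-((1 : ℕ) : ℤ)) := by
        rw [v.valuation_of_algebraMap (K := K), v.intValuation_le_pow_iff_mem, pow_one,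
          ← Ideal.dvd_span_singleton, ← hr']
        exact dvd_mul_right _ _
      have hb : ¬ vl v (r : K) ≤ exp (-((2 : ℕ) : ℤ)) := by
        rw [v.valuation_of_algebraMap (K := K), v.intValuation_le_pow_iff_mem,
          ← Ideal.dvd_span_singleton, ← hr', pow_two]
        intro h
        exact hndvd v hv c ((mul_dvd_mul_iff_left v.ne_bot).mp h)
      obtain ⟨m, hm⟩ := even_val (w := vl v) hrK
      rw [Units.val_mk0]
      rw [hm, exp_le_exp] at ha hb
      rw [hm]; congr 1; push_cast at *; lia
    · intro w hw hwv
      refine le_antisymm (vl_int_le w r) (not_lt.mp fun hlt => ?_)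
      have hlt' : vl w (r : K) < 1 := hlt
      rw [vl_int_lt, ← Ideal.dvd_span_singleton, ← hr'] at hlt'
      rcases (w.prime.dvd_mul).mp hlt' with h | h
      · apply hwv
        apply HeightOneSpectrum.ext
        exact (v.isMaximal.eq_of_le w.isPrime.ne_top (Ideal.dvd_iff_le.mp h)).symm
      · exact hndvd w hw c h

lemma even_ord {S : Finset (Pl K)} (hS : GoodS S) (m : Kˣ)
    (hm : ∀ v ∉ S, ∃ k : ℤ, vl v (m : K) = exp (2 * k)) : ∃ k : Kˣ, m / k ^ 2 ∈ SU S := by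
  classical
  choose! k hk using hm
  choose! p hp1 hp2 using hS.pi
  set T := (supp_finite m).toFinset.filter (· ∉ S) with hT
  refine ⟨∏ v ∈ T, p v ^ (-k v), fun w hw => ?_⟩
  have hval : vl w ((∏ v ∈ T, p v ^ (-k v) : Kˣ) : K) = exp (k w) := by
    rw [Units.coe_prod, map_prod]
    by_cases hwT : w ∈ T
    · rw [Finset.prod_eq_single w]
      · rw [Units.val_zpow_eq_zpow_val, map_zpow₀, hp1 w hw, ← exp_zsmul]; simp
      · intro v hv hvw
        have hvS : v ∉ S := (Finset.mem_filter.mp hv).2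
        rw [Units.val_zpow_eq_zpow_val, map_zpow₀, hp2 v hvS w hw hvw.symm, one_zpow]
      · exact fun h => absurd hwT h
    · rw [Finset.prod_eq_one]
      · have h1 : vl w (m : K) = 1 := by
          by_contra h
          exact hwT (Finset.mem_filter.mpr ⟨by simpa using h, hw⟩)
        rw [hk w hw] at h1
        have : 2 * k w = 0 := by rwa [exp_eq_one] at h1
        have : k w = 0 := by lia
        rw [this, exp_zero]
      · intro v hv
        have hvS : v ∉ S := (Finset.mem_filter.mp hv).2
        have hvw : v ≠ w := fun h => hwT (h ▸ hv)
        rw [Units.val_zpow_eq_zpow_val, map_zpow₀, hp2 v hvS w hw hvw.symm, one_zpow]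
  rw [Units.val_div_eq_div_val, Units.val_pow_eq_pow_val, map_div₀, map_pow, hval, hk w hw, two_mul,
    exp_add, pow_two, div_self]
  simp

end Loc


set_option linter.unusedSectionVars false
set_option linter.deprecated false
set_option linter.style.haveILetI false

open WithZero IsDedekindDomain NumberField

namespace Loc

lemma rank_nullity {M N : Type*} [AddCommGroup M] [AddCommGroup N] [Module.Finite ℤ M] (f : M →ₗ[ℤ] N) :
    Module.finrank ℤ (LinearMap.range f) + Module.finrank ℤ (LinearMap.ker f) = Module.finrank ℤ M := by
  rw [← Submodule.finrank_quotient_add_finrank (LinearMap.ker f), f.quotKerEquivRange.finrank_eq]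

lemma finrank_finite {M : Type*} [AddCommGroup M] [Finite M] : Module.finrank ℤ M = 0 := by
  rw [Module.finrank_eq_zero_iff]
  intro x
  refine ⟨(Nat.card M : ℤ), by exact_mod_cast Nat.card_pos.ne', ?_⟩
  rw [natCast_zsmul]
  exact card_nsmul_eq_zero'

lemma index_range_finite {T : Type*} [AddCommGroup T] [Finite T] :
    (nsmulAddMonoidHom 2 : T →+ T).range.index = Nat.card (nsmulAddMonoidHom 2 : T →+ T).ker := by
  have h1 := AddSubgroup.card_mul_index (nsmulAddMonoidHom 2 : T →+ T).ker
  have h2 := AddSubgroup.card_mul_index (nsmulAddMonoidHom 2 : T →+ T).range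
  rw [AddSubgroup.index_ker] at h1
  have h3 : 0 < Nat.card (nsmulAddMonoidHom 2 : T →+ T).range := Nat.card_pos
  apply Nat.eq_of_mul_eq_mul_left h3
  rw [h2, ← h1, mul_comm]

lemma index_two_free (n : ℕ) : (nsmulAddMonoidHom 2 : (Fin n →₀ ℤ) →+ (Fin n →₀ ℤ)).range.index = 2 ^ n := by
  let f : (Fin n →₀ ℤ) →+ (Fin n → ZMod 2) :=
    { toFun := fun x i => (x i : ZMod 2)
      map_zero' := by ext; simp
      map_add' := by intros; ext; simp }
  have hf : Function.Surjective f := by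
    intro y
    refine ⟨Finsupp.equivFunOnFinite.symm fun i => ((y i).val : ℤ), ?_⟩
    ext i
    simp [f]
  have hker : f.ker = (nsmulAddMonoidHom 2 : (Fin n →₀ ℤ) →+ (Fin n →₀ ℤ)).range := by
    ext x
    constructor
    · intro hx
      have hx' : ∀ i, (2 : ℤ) ∣ x i := by
        intro i
        have := congrFun hx i
        exact (ZMod.intCast_zmod_eq_zero_iff_dvd _ 2).mp this
      choose y hy using hx'
      refine ⟨Finsupp.equivFunOnFinite.symm y, ?_⟩
      ext i
      simp [hy]
    · rintro ⟨y, rfl⟩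
      change f _ = 0
      ext i
      have : (2 : ZMod 2) = 0 := by decide
      simp [f, this]
  rw [← hker, AddSubgroup.index_ker, AddMonoidHom.range_eq_top.mpr hf]
  simp

lemma index_two_add {M : Type*} [AddCommGroup M] [Module.Finite ℤ M] :
    (nsmulAddMonoidHom 2 : M →+ M).range.index =
      2 ^ (Module.finrank ℤ M) * Nat.card (nsmulAddMonoidHom 2 : M →+ M).ker := by
  haveI : AddGroup.FG M := AddGroup.fg_iff_addMonoid_fg.mpr (Module.Finite.iff_addGroup_fg.mp ‹_› |> AddGroup.fg_iff_addMonoid_fg.mp)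
  obtain ⟨n, ι, hι, p, hp, e, ⟨φ⟩⟩ := AddCommGroup.equiv_free_prod_directSum_zmod M
  set T := DirectSum ι fun i => ZMod (p i ^ e i) with hT
  haveI : ∀ i, NeZero (p i ^ e i) := fun i => ⟨pow_ne_zero _ (hp i).ne_zero⟩
  haveI : Finite T := Finite.of_equiv _ (DirectSum.addEquivProd fun i => ZMod (p i ^ e i)).symm.toEquiv
  have hφ2 : ∀ x, φ (2 • x) = 2 • φ x := fun x => map_nsmul φ 2 x
  have h1 : (nsmulAddMonoidHom 2 : M →+ M).range =
      ((nsmulAddMonoidHom 2 : (Fin n →₀ ℤ) →+ (Fin n →₀ ℤ)).range.prod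
        (nsmulAddMonoidHom 2 : T →+ T).range).comap (φ : M →+ (Fin n →₀ ℤ) × T) := by
    ext x
    constructor
    · rintro ⟨y, rfl⟩
      refine ⟨⟨(φ y).1, ?_⟩, ⟨(φ y).2, ?_⟩⟩
      · change 2 • (φ y).1 = (φ (2 • y)).1
        rw [hφ2]; rfl
      · change 2 • (φ y).2 = (φ (2 • y)).2
        rw [hφ2]; rfl
    · rintro ⟨⟨y, hy⟩, ⟨z, hz⟩⟩
      refine ⟨φ.symm (y, z), φ.injective ?_⟩
      change φ (2 • _) = _
      rw [hφ2, AddEquiv.apply_symm_apply]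
      exact Prod.ext hy hz
  have h2 : Nat.card (nsmulAddMonoidHom 2 : M →+ M).ker = Nat.card (nsmulAddMonoidHom 2 : T →+ T).ker := by
    refine Nat.card_congr ⟨fun x => ⟨(φ x).2, ?_⟩, fun t => ⟨φ.symm (0, t), ?_⟩, ?_, ?_⟩
    · have h : 2 • (x : M) = 0 := x.2
      change 2 • (φ x).2 = 0
      rw [← Prod.smul_snd, ← hφ2, h, map_zero]; rfl
    · have h : 2 • (t : T) = 0 := t.2
      change 2 • φ.symm _ = 0
      rw [← map_nsmul, Prod.smul_mk, h, smul_zero]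
      exact map_zero _
    · intro x
      have h : 2 • (x : M) = 0 := x.2
      have h0 : (φ x).1 = 0 := by
        have : 2 • (φ x).1 = 0 := by rw [← Prod.smul_fst, ← hφ2, h, map_zero]; rfl
        simpa using this
      apply Subtype.ext
      apply φ.injective
      change φ (φ.symm _) = _
      rw [AddEquiv.apply_symm_apply]
      exact Prod.ext h0.symm rfl
    · intro t
      apply Subtype.ext
      change (φ (φ.symm _)).2 = _
      rw [AddEquiv.apply_symm_apply]
  have h3 : Module.finrank ℤ M = n := by
    have e1 : Module.finrank ℤ M = Module.finrank ℤ ((Fin n →₀ ℤ) × T) :=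
      LinearEquiv.finrank_eq φ.toIntLinearEquiv
    rw [e1, ← rank_nullity (LinearMap.fst ℤ (Fin n →₀ ℤ) T), LinearMap.range_eq_top.mpr LinearMap.fst_surjective, LinearMap.ker_fst,
      (LinearEquiv.ofInjective (LinearMap.inr ℤ (Fin n →₀ ℤ) T) LinearMap.inr_injective).symm.finrank_eq,
      finrank_finite (M := T)]
    simp
  rw [h1, AddSubgroup.index_comap_of_surjective _ φ.surjective, AddSubgroup.index_prod, index_two_free,
    index_range_finite, h2, h3]

lemma index_two_mul {A : Type*} [CommGroup A] [Module.Finite ℤ (Additive A)]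
    (h2 : Nat.card (powMonoidHom 2 : A →* A).ker = 2) :
    (powMonoidHom 2 : A →* A).range.index = 2 ^ (Module.finrank ℤ (Additive A) + 1) := by
  have := index_two_add (M := Additive A)
  have e1 : (nsmulAddMonoidHom 2 : Additive A →+ Additive A).range =
    Subgroup.toAddSubgroup (powMonoidHom 2 : A →* A).range := rfl
  have e2 : Nat.card (nsmulAddMonoidHom 2 : Additive A →+ Additive A).ker =
    Nat.card (powMonoidHom 2 : A →* A).ker := rfl
  rw [e1, e2, Subgroup.index_toAddSubgroup, h2] at this
  rw [this, pow_succ]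

/-- units groups: two square roots of one -/
lemma card_two_tors {L : Type*} [Field L] [CharZero L] (A : Subgroup Lˣ) (h : -1 ∈ A) :
    Nat.card (powMonoidHom 2 : A →* A).ker = 2 := by
  rw [Nat.card_eq_two_iff]
  refine ⟨1, ⟨⟨-1, h⟩, ?_⟩, ?_, ?_⟩
  · rw [MonoidHom.mem_ker]
    apply Subtype.ext
    simp
  · intro heq
    have := congrArg (fun x : (powMonoidHom 2 : A →* A).ker => (((x : A) : Lˣ) : L)) heq
    simp at this
    norm_num at this
  · rw [Set.eq_univ_iff_forall]
    intro x
    have hx := x.2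
    rw [MonoidHom.mem_ker] at hx
    have h1 : ((((x : A) : Lˣ) : L)) ^ 2 = 1 := by
      have := congrArg (fun x : A => ((x : Lˣ) : L)) hx
      simpa using this
    rcases (mul_self_eq_one_iff.mp ((pow_two _).symm.trans h1)) with h | h
    · left
      apply Subtype.ext; apply Subtype.ext; apply Units.ext; simpa using h
    · right
      apply Subtype.ext; apply Subtype.ext; apply Units.ext; simpa using h

/-- abstract Herbrand type lemma -/
lemma herbrand {F U : Type*} [CommGroup F] [CommGroup U] (N : U →* F) (i : F →* U) (σ : U →* U)
    (h1 : ∀ x, N (i x) = x ^ 2) (h2 : ∀ u, i (N u) = u * σ u)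
    (h3 : ∀ w, σ w = w → ∃ x, i x = w) (h4 : ∀ u, N u = 1 → ∃ w, u = w / σ w)
    (h5 : ∀ u, N (σ u) = N u) :
    (powMonoidHom 2 : F →* F).range.index =
      N.range.index * (powMonoidHom 2 : N.ker →* N.ker).range.index := by
  set Q : Subgroup U := i.range ⊔ (powMonoidHom 2 : U →* U).range with hQ
  have hle : (powMonoidHom 2 : F →* F).range ≤ N.range := by
    rintro _ ⟨x, rfl⟩
    exact ⟨i x, h1 x⟩
  have hmap : Q.map N = (powMonoidHom 2 : F →* F).range := by
    apply le_antisymm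
    · rw [hQ, Subgroup.map_sup]
      refine sup_le ?_ ?_
      · rintro _ ⟨_, ⟨x, rfl⟩, rfl⟩
        exact ⟨x, (h1 x).symm⟩
      · rintro _ ⟨_, ⟨x, rfl⟩, rfl⟩
        exact ⟨N x, (map_pow N x 2).symm⟩
    · rintro _ ⟨x, rfl⟩
      exact ⟨i x, Subgroup.mem_sup_left ⟨x, rfl⟩, h1 x⟩
  have hw : ∀ w, w / σ w = w ^ 2 * (i (N w))⁻¹ := by
    intro w
    rw [h2, pow_two, mul_inv, div_eq_mul_inv]
    simp [mul_assoc]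
  have hker : N.ker ≤ Q := by
    intro u hu
    obtain ⟨w, rfl⟩ := h4 u hu
    rw [hw]
    exact mul_mem (Subgroup.mem_sup_right ⟨w, rfl⟩) (inv_mem (Subgroup.mem_sup_left ⟨_, rfl⟩))
  have e1 := Subgroup.relIndex_mul_index hle
  have e2 := Subgroup.relIndex_map_map N Q ⊤
  rw [hmap, ← MonoidHom.range_eq_map, sup_eq_left.mpr hker, top_sup_eq, Subgroup.relIndex_top_right] at e2
  let δ : U →* N.ker :=
    { toFun := fun w => ⟨w / σ w, by rw [MonoidHom.mem_ker, map_div, h5, div_self']⟩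
      map_one' := by ext; simp
      map_mul' := by intro a b; ext; simp [mul_div_mul_comm] }
  have hδ : Function.Surjective δ := by
    rintro ⟨u, hu⟩
    obtain ⟨w, rfl⟩ := h4 u hu
    exact ⟨w, rfl⟩
  have e3 : (powMonoidHom 2 : N.ker →* N.ker).range.comap δ = Q := by
    apply le_antisymm
    · rintro w ⟨v, hv⟩
      obtain ⟨w', rfl⟩ := hδ v
      have h6 : δ (w / w' ^ 2) = 1 := by
        rw [map_div, map_pow, ← hv]; simp
      have h7 : σ (w / w' ^ 2) = w / w' ^ 2 := by
        have := congrArg Subtype.val h6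
        exact (div_eq_one.mp this).symm
      obtain ⟨x, hx⟩ := h3 _ h7
      have : w = i x * w' ^ 2 := by rw [hx]; simp
      rw [this]
      exact mul_mem (Subgroup.mem_sup_left ⟨_, rfl⟩) (Subgroup.mem_sup_right ⟨w', rfl⟩)
    · refine sup_le ?_ ?_
      · rintro _ ⟨x, rfl⟩
        have h8 : σ (i x) = i x := by
          have := h2 (i x)
          rw [h1, map_pow, pow_two] at this
          exact (mul_left_cancel this).symm
        have : δ (i x) = 1 := by
          apply Subtype.ext
          change i x / σ (i x) = 1
          rw [h8, div_self']
        rw [Subgroup.mem_comap, this]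
        exact one_mem _
      · rintro _ ⟨x, rfl⟩
        exact ⟨δ x, (map_pow δ x 2).symm⟩
  rw [← e1, e2, ← e3, Subgroup.index_comap_of_surjective _ hδ, mul_comm]

end Loc


set_option linter.unusedSectionVars false
set_option linter.deprecated false
set_option linter.style.haveILetI false

open WithZero IsDedekindDomain NumberField

namespace Loc

variable {K : Type*} [Field K] [NumberField K]

/-- order vector of an S-unit -/
noncomputable def ordS (S : Finset (Pl K)) : Additive (SU S) →+ (S → ℤ) where
  toFun x v := log (vl (v : Pl K) ((Additive.toMul x : SU S) : Kˣ))
  map_zero' := by ext; simp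
  map_add' x y := by
    ext v
    simp only [toMul_add, Subgroup.coe_mul, Units.val_mul, map_mul, Pi.add_apply]
    exact log_mul (vpos (Units.ne_zero _)).ne' (vpos (Units.ne_zero _)).ne'

lemma mem_int_of_val {x : K} (h : ∀ v : Pl K, vl v x = 1) : ∃ r : 𝓞 K, (r : K) = x :=
  HeightOneSpectrum.mem_integers_of_valuation_le_one K x fun v => (h v).le

/-- inclusion of units -/
noncomputable def unitsSU (S : Finset (Pl K)) : (𝓞 K)ˣ →* SU S where
  toFun u := ⟨Units.map (algebraMap (𝓞 K) K : 𝓞 K →* K) u, fun v _ => by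
    refine le_antisymm (vl_int_le v u) ?_
    have h1 := vl_int_le v ((u⁻¹ : (𝓞 K)ˣ) : 𝓞 K)
    have h2 : vl v (((u : 𝓞 K)) : K) * vl v (((u⁻¹ : (𝓞 K)ˣ) : 𝓞 K) : K) = 1 := by
      rw [← map_mul, ← map_mul, Units.mul_inv]; simp
    by_contra hcon
    have h3 : vl v (((u : 𝓞 K)) : K) < 1 := not_le.mp hcon
    have := mul_lt_one_of_lt_of_le h3 h1
    exact absurd h2 this.ne⟩
  map_one' := by ext; simp
  map_mul' _ _ := by ext; simp

lemma ker_ordS (S : Finset (Pl K)) :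
    LinearMap.ker (ordS S).toIntLinearMap =
      LinearMap.range (MonoidHom.toAdditive (unitsSU S)).toIntLinearMap := by
  ext x
  constructor
  · intro hx
    have hx1 : ∀ v : Pl K, vl v ((Additive.toMul x : SU S) : Kˣ) = 1 := by
      intro v
      by_cases hv : v ∈ S
      · have := congrFun hx ⟨v, hv⟩
        change log (vl v ((Additive.toMul x : SU S) : Kˣ)) = 0 at this
        rw [← exp_log (vpos (w := vl v) (Units.ne_zero _)).ne', this, exp_zero]
      · exact (Additive.toMul x).2 v hv
    obtain ⟨r, hr⟩ := mem_int_of_val hx1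
    obtain ⟨t, ht⟩ := mem_int_of_val (x := (((Additive.toMul x : SU S) : Kˣ) : K)⁻¹) (fun v => by
      rw [map_inv₀, hx1, inv_one])
    have hrt : r * t = 1 := by
      apply FaithfulSMul.algebraMap_injective (𝓞 K) K
      rw [map_mul, map_one]
      change (r : K) * (t : K) = 1
      rw [hr, ht]; simp
    refine ⟨Additive.ofMul ⟨r, t, hrt, by rw [mul_comm]; exact hrt⟩, ?_⟩
    change Additive.ofMul (unitsSU S _) = _
    rw [← ofMul_toMul x]
    congr 1
    apply Subtype.ext
    apply Units.ext
    exact hr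
  · rintro ⟨u, rfl⟩
    rw [LinearMap.mem_ker]
    ext v
    change log (vl (v : Pl K) (((Additive.toMul u : (𝓞 K)ˣ) : 𝓞 K) : K)) = 0
    have : vl (v : Pl K) (((Additive.toMul u : (𝓞 K)ˣ) : 𝓞 K) : K) = 1 :=
      (unitsSU (∅ : Finset (Pl K)) (Additive.toMul u)).2 v (by simp)
    rw [this, log_one]

instance SU_finite (S : Finset (Pl K)) : Module.Finite ℤ (Additive (SU S)) := by
  rw [Module.finite_def]
  refine Submodule.fg_of_fg_map_of_fg_inf_ker (ordS S).toIntLinearMap ?_ ?_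
  · exact IsNoetherian.noetherian _
  · rw [top_inf_eq, ker_ordS]
    exact Module.Finite.iff_fg.mp (Module.Finite.range _)

lemma exists_pow_gen (v : Pl K) : ∃ (p : Kˣ) (n : ℤ), n ≠ 0 ∧ vl v (p : K) = exp n ∧
    ∀ w : Pl K, w ≠ v → vl w (p : K) = 1 := by
  classical
  have h1 : (ClassGroup.mk0 (⟨v.asIdeal, mem_nonZeroDivisors_of_ne_zero v.ne_bot⟩ :
    nonZeroDivisors (Ideal (𝓞 K)))) ^ (Fintype.card (ClassGroup (𝓞 K))) = 1 := pow_card_eq_one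
  set h := Fintype.card (ClassGroup (𝓞 K)) with hh
  have hpos : 0 < h := Fintype.card_pos
  rw [← map_pow] at h1
  obtain ⟨r, hr⟩ := (ClassGroup.mk0_eq_one_iff _).mp h1
  have hr' : v.asIdeal ^ h = Ideal.span {r} := hr
  have hr0 : r ≠ 0 := by
    rintro rfl
    simp at hr'
    exact v.ne_bot (pow_eq_zero_iff hpos.ne' |>.mp hr')
  have hrK : (r : K) ≠ 0 := by simpa using hr0
  obtain ⟨m, hm⟩ := even_val (w := vl v) hrK
  refine ⟨Units.mk0 (r : K) hrK, m, ?_, hm, fun w hwv => ?_⟩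
  · rintro rfl
    have : vl v (r : K) < 1 := by
      rw [vl_int_lt, ← Ideal.dvd_span_singleton, ← hr']
      exact dvd_pow_self _ hpos.ne'
    rw [hm, exp_zero] at this
    exact lt_irrefl _ this
  · refine le_antisymm (vl_int_le w r) (not_lt.mp fun hlt => ?_)
    have hlt' : vl w (r : K) < 1 := hlt
    rw [vl_int_lt, ← Ideal.dvd_span_singleton, ← hr'] at hlt'
    have h := w.prime.dvd_of_dvd_pow hlt'
    apply hwv
    apply HeightOneSpectrum.ext
    exact (v.isMaximal.eq_of_le w.isPrime.ne_top (Ideal.dvd_iff_le.mp h)).symm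

lemma finrank_SU (S : Finset (Pl K)) :
    Module.finrank ℤ (Additive (SU S)) + 1 = Fintype.card (InfinitePlace K) + S.card := by
  classical
  rw [← rank_nullity (ordS S).toIntLinearMap, ker_ordS]
  have h1 : Module.finrank ℤ (LinearMap.range (MonoidHom.toAdditive (unitsSU S)).toIntLinearMap) =
      Units.rank K := by
    rw [← Units.finrank_eq]
    refine (LinearEquiv.ofInjective _ ?_).symm.finrank_eq
    intro x y hxy
    have h2 : unitsSU S (Additive.toMul x) = unitsSU S (Additive.toMul y) := hxy
    have h3 := congrArg (fun z : SU S => ((z : Kˣ) : K)) h2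
    apply Additive.toMul.injective
    apply Units.ext
    apply RingOfIntegers.ext
    exact h3
  have h2 : Module.finrank ℤ (LinearMap.range (ordS S).toIntLinearMap) = S.card := by
    apply le_antisymm
    · refine (Submodule.finrank_le _).trans ?_
      simp
    · choose p n hn hp hp' using fun v : Pl K => exists_pow_gen v
      have hpS : ∀ v : S, p v ∈ SU S := fun v w hw => hp' v w fun h => hw (h ▸ v.2)
      let b : S → LinearMap.range (ordS S).toIntLinearMap := fun v =>
        ⟨ordS S (Additive.ofMul ⟨p v, hpS v⟩), ⟨_, rfl⟩⟩
      have hb : ∀ v w : S, (b v : S → ℤ) w = if w = v then n v else 0 := by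
        intro v w
        change log (vl (w : Pl K) (p v : K)) = _
        split_ifs with h
        · rw [h, hp, log_exp]
        · rw [hp' v w (fun h' => h (Subtype.ext h')), log_one]
      have hli : LinearIndependent ℤ b := by
        rw [Fintype.linearIndependent_iff]
        intro g hg v
        have := congrArg (fun z : LinearMap.range (ordS S).toIntLinearMap => (z : S → ℤ) v) hg
        simp only [Submodule.coe_sum, Submodule.coe_smul, Finset.sum_apply, Pi.smul_apply, hb] at this
        simp at this
        exact this.resolve_right (hn v)
      simpa using hli.fintype_card_le_finrank
  rw [h1, h2, Units.rank]
  have : 0 < Fintype.card (InfinitePlace K) := Fintype.card_pos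
  lia

lemma neg_one_mem_SU (S : Finset (Pl K)) : (-1 : Kˣ) ∈ SU S := fun v _ => by simp

lemma SU_sq_index (S : Finset (Pl K)) :
    (powMonoidHom 2 : SU S →* SU S).range.index = 2 ^ (Fintype.card (InfinitePlace K) + S.card) := by
  rw [index_two_mul (card_two_tors _ (neg_one_mem_SU S)), finrank_SU]

end Loc


set_option linter.unusedSectionVars false
set_option linter.deprecated false
set_option linter.style.haveILetI false

open WithZero IsDedekindDomain NumberField

namespace Loc

section down
variable {K : Type*} [Field K] [NumberField K] {L : Type*} [Field L] [NumberField L]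

/-- restriction of a place -/
noncomputable def dn (K : Type*) [Field K] [NumberField K] {L : Type*} [Field L] [NumberField L] [Algebra K L]
    (w : Pl L) : Pl K := w.under (𝓞 K)

lemma dn_spec [Algebra K L] (w : Pl L) : ∃ e : ℕ, e ≠ 0 ∧ ∀ x : K, vl w (algebraMap K L x) = vl (dn K w) x ^ e := by
  haveI : w.asIdeal.LiesOver (dn K w).asIdeal := Ideal.over_under ..
  refine ⟨(dn K w).asIdeal.ramificationIdx' w.asIdeal, ?_, fun x => ?_⟩
  · exact Ideal.IsDedekindDomain.ramificationIdx'_ne_zero_of_liesOver w.asIdeal (dn K w).ne_bot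
  · exact (IsDedekindDomain.HeightOneSpectrum.valuation_liesOver L (dn K w) w x).symm

lemma dn_eq_one [Algebra K L] (w : Pl L) (x : K) : vl w (algebraMap K L x) = 1 ↔ vl (dn K w) x = 1 := by
  obtain ⟨e, he, h⟩ := dn_spec (K := K) w
  rw [h, pow_eq_one_iff]; simp [he]

lemma dn_lt_one [Algebra K L] (w : Pl L) (x : K) : vl w (algebraMap K L x) < 1 ↔ vl (dn K w) x < 1 := by
  obtain ⟨e, he, h⟩ := dn_spec (K := K) w
  rw [h, pow_lt_one_iff he]

lemma dn_surj [Algebra K L] (v : Pl K) : ∃ w : Pl L, dn K w = v := by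
  haveI := v.isMaximal
  obtain ⟨Q, hQ, hQ'⟩ := Ideal.exists_maximal_ideal_liesOver_of_isIntegral (S := 𝓞 L) v.asIdeal
  refine ⟨⟨Q, hQ.isPrime, ?_⟩, ?_⟩
  · rintro rfl
    exact v.ne_bot (by rw [hQ'.over]; simp)
  · ext1
    exact hQ'.over.symm

lemma pl_ext {v v' : Pl K} (h : ∀ x : K, vl v x < 1 → vl v' x < 1) : v = v' := by
  have : v.asIdeal ≤ v'.asIdeal := fun r hr => (vl_int_lt v' r).1 (h _ ((vl_int_lt v r).2 hr))
  ext1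
  exact v.isMaximal.eq_of_le v'.isPrime.ne_top this

lemma upS_finite [Algebra K L] (v : Pl K) : {w : Pl L | dn K w = v}.Finite := by
  obtain ⟨s, hs⟩ := exists_val (good v) (-1)
  refine (supp_finite (Units.map (algebraMap K L).toMonoidHom s)).subset ?_
  rintro w rfl
  simp only [Set.mem_setOf_eq]
  intro h
  have := (dn_eq_one w (s : K)).1 h
  rw [hs] at this
  exact absurd this (by decide)

/-- places above S -/
noncomputable def upS [Algebra K L] (S : Finset (Pl K)) : Finset (Pl L) :=
  (Set.Finite.preimage' (f := fun w : Pl L => dn K w) S.finite_toSet (fun v _ => upS_finite v)).toFinset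

lemma mem_upS [Algebra K L] {S : Finset (Pl K)} {w : Pl L} : w ∈ upS S ↔ dn K w ∈ S := by
  simp [upS]

lemma SU_upS [Algebra K L] {S : Finset (Pl K)} {x : Kˣ} :
    Units.map (algebraMap K L).toMonoidHom x ∈ SU (upS (L := L) S) ↔ x ∈ SU S := by
  rw [mem_SU, mem_SU]
  constructor
  · intro h v hv
    obtain ⟨w, rfl⟩ := dn_surj (L := L) v
    exact (dn_eq_one w (x : K)).1 (h w (by rwa [mem_upS]))
  · intro h w hw
    rw [mem_upS] at hw
    exact (dn_eq_one w (x : K)).2 (h _ hw)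

/-- conjugate place -/
lemma conj_place [Algebra K L] (σ : L ≃ₐ[K] L) (w : Pl L) :
    ∃ w' : Pl L, dn K w' = dn K w ∧ ∀ x, (vl w (σ x) = 1 ↔ vl w' x = 1) ∧ (vl w (σ x) < 1 ↔ vl w' x < 1) := by
  obtain ⟨w', hw'⟩ : ∃ w' : Pl L, ∀ x, (vl w (σ x) = 1 ↔ vl w' x = 1) ∧ (vl w (σ x) < 1 ↔ vl w' x < 1) := by
    letI := σ.toRingEquiv.toRingHom.toAlgebra
    exact ⟨dn L w, fun x => ⟨dn_eq_one w x, dn_lt_one w x⟩⟩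
  refine ⟨w', ?_, hw'⟩
  apply pl_ext
  intro x hx
  have := (dn_lt_one w' x).2 hx
  rw [← (hw' _).2, AlgEquiv.commutes] at this
  exact (dn_lt_one w x).1 this

end down

end Loc


set_option linter.unusedSectionVars false
set_option linter.deprecated false
set_option linter.style.haveILetI false

open WithZero IsDedekindDomain NumberField

namespace Loc

universe u

/-- quadratic extension data -/
structure Quad (K L : Type*) [Field K] [Field L] [Algebra K L] (a : K) where
  α : L
  σ : L ≃ₐ[K] L
  sq : α ^ 2 = algebraMap K L a
  conj : σ α = -α
  rep : ∀ z : L, ∃ x y : K, z = algebraMap K L x + algebraMap K L y * α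
  ns : ∀ r : K, r ^ 2 ≠ a

lemma count_fib {X Y : Type*} [DecidableEq Y] (f : X → Y) (A : Finset X) (S B : Finset Y)
    (hA : ∀ x ∈ A, f x ∈ S)
    (h1 : ∀ v ∈ S, ∃ x ∈ A, f x = v)
    (h2 : ∀ v ∈ S, v ∉ B → ∃ x ∈ A, ∃ y ∈ A, x ≠ y ∧ f x = v ∧ f y = v) :
    2 * S.card ≤ A.card + B.card := by
  classical
  have e : A.card = ∑ v ∈ S, (A.filter fun x => f x = v).card := Finset.card_eq_sum_card_fiberwise hA
  have e2 : (B ∩ S).card = ∑ v ∈ S, if v ∈ B then 1 else 0 := by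
    rw [Finset.sum_ite_mem, Finset.inter_comm]; simp
  have e3 : (B ∩ S).card ≤ B.card := Finset.card_le_card Finset.inter_subset_left
  have : 2 * S.card ≤ A.card + (B ∩ S).card := by
    rw [e, e2, ← Finset.sum_add_distrib, mul_comm, ← smul_eq_mul, ← Finset.sum_const]
    refine Finset.sum_le_sum fun v hv => ?_
    split_ifs with hB
    · obtain ⟨x, hx, hxv⟩ := h1 v hv
      have : 0 < (A.filter fun x => f x = v).card := Finset.card_pos.2 ⟨x, by simp [hx, hxv]⟩
      omega
    · obtain ⟨x, hx, y, hy, hxy, h3, h4⟩ := h2 v hv hB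
      have : 1 < (A.filter fun x => f x = v).card :=
        Finset.one_lt_card.2 ⟨x, by simp [hx, h3], y, by simp [hy, h4], hxy⟩
      omega
  omega

variable {K : Type*} [Field K] [NumberField K] {L : Type*} [Field L] [NumberField L] [Algebra K L]

namespace Quad

lemma ne_zero {a : K} (Q : Quad K L a) : Q.α ≠ 0 := by
  intro h
  have := Q.sq
  rw [h, zero_pow two_ne_zero, eq_comm, map_eq_zero] at this
  exact Q.ns 0 (by simp [this])

lemma σσ {a : K} (Q : Quad K L a) (z : L) : Q.σ (Q.σ z) = z := by
  obtain ⟨x, y, rfl⟩ := Q.rep z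
  simp [Q.conj]

lemma fixed {a : K} (Q : Quad K L a) {z : L} (h : Q.σ z = z) : ∃ x, algebraMap K L x = z := by
  obtain ⟨x, y, rfl⟩ := Q.rep z
  simp only [map_add, map_mul, AlgEquiv.commutes, Q.conj] at h
  have h0 : 2 * (algebraMap K L y * Q.α) = 0 := by linear_combination -h
  simp only [mul_eq_zero, OfNat.ofNat_ne_zero, false_or, Q.ne_zero, or_false] at h0
  exact ⟨x, by simp [h0]⟩

lemma nm_ex {a : K} (Q : Quad K L a) (z : L) : ∃ x, algebraMap K L x = z * Q.σ z :=
  Q.fixed (by rw [map_mul, Q.σσ, mul_comm])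

/-- the norm -/
noncomputable def nm {a : K} (Q : Quad K L a) : L →* K where
  toFun z := (Q.nm_ex z).choose
  map_one' := by
    apply (algebraMap K L).injective
    rw [(Q.nm_ex 1).choose_spec]; simp
  map_mul' x y := by
    apply (algebraMap K L).injective
    refine (Q.nm_ex (x * y)).choose_spec.trans ?_
    rw [map_mul (algebraMap K L)]
    refine Eq.trans ?_ (congrArg₂ (· * ·) (Q.nm_ex x).choose_spec (Q.nm_ex y).choose_spec).symm
    simp only [map_mul]
    ring

lemma nm_spec {a : K} (Q : Quad K L a) (z : L) : algebraMap K L (Q.nm z) = z * Q.σ z :=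
  (Q.nm_ex z).choose_spec

lemma nm_rep {a : K} (Q : Quad K L a) (x y : K) :
    Q.nm (algebraMap K L x + algebraMap K L y * Q.α) = x ^ 2 - a * y ^ 2 := by
  apply (algebraMap K L).injective
  rw [nm_spec]
  simp only [map_add, map_mul, AlgEquiv.commutes, Q.conj, map_sub, map_pow]
  linear_combination - (algebraMap K L y) ^ 2 * Q.sq

lemma two_places {a : Kˣ} (Q : Quad K L (a : K)) {v : Pl K} (h : a ∈ H (vl v)) :
    ∃ w w' : Pl L, w ≠ w' ∧ dn K w = v ∧ dn K w' = v := by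
  obtain ⟨w, rfl⟩ := dn_surj (L := L) v
  obtain ⟨w', hw', h'⟩ := conj_place Q.σ w
  refine ⟨w, w', ?_, rfl, hw'⟩
  rintro rfl
  obtain ⟨y, hy0, hy⟩ := mem_H.1 h
  set η : L := (1 + algebraMap K L y * Q.α) / 2 with hη
  have e1 : Q.σ η = (1 - algebraMap K L y * Q.α) / 2 := by
    rw [hη, map_div₀, map_add, map_mul, Q.conj, AlgEquiv.commutes, map_one, map_ofNat]; ring
  have e2 : η + Q.σ η = 1 := by rw [e1, hη]; ring
  have e3 : η * Q.σ η = algebraMap K L (- (a * y ^ 2 - 1) / 4) := by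
    rw [e1, hη]; simp only [map_div₀, map_neg, map_sub, map_mul, map_pow, map_one, map_ofNat]
    linear_combination (- algebraMap K L y ^ 2 / 4) * Q.sq
  have e4 : vl w (η * Q.σ η) < 1 := by
    rw [e3, dn_lt_one, map_div₀, Valuation.map_neg]
    exact (div_lt_one₀ (four_pos _)).2 hy
  have e5 : vl w η < 1 := by
    by_contra h1
    have h2 : ¬ vl w (Q.σ η) < 1 := fun h3 => h1 ((h' _).2.1 h3)
    push Not at h1 h2
    rw [map_mul] at e4
    exact absurd e4 (not_lt.2 (one_le_mul h1 h2))
  have e6 := (h' η).2.2 e5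
  have := (vl w).map_add_lt e5 e6
  rw [e2, map_one] at this
  exact lt_irrefl _ this

lemma two_inf {a : Kˣ} (Q : Quad K L (a : K)) {p : InfinitePlace K} (h : a ∈ HI p) :
    ∃ w w' : InfinitePlace L, w ≠ w' ∧ w.comap (algebraMap K L) = p ∧ w'.comap (algebraMap K L) = p := by
  obtain ⟨w, rfl⟩ := InfinitePlace.comap_surjective (k := K) (K := L) p
  set φ := w.embedding with hφ
  have hw : InfinitePlace.mk φ = w := InfinitePlace.mk_embedding w
  set φ' : L →+* ℂ := φ.comp (Q.σ : L →+* L) with hφ'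
  have hc : φ'.comp (algebraMap K L) = φ.comp (algebraMap K L) := by
    ext x; simp [hφ']
  refine ⟨w, InfinitePlace.mk φ', ?_, rfl, ?_⟩
  · intro heq
    have h1 : φ' Q.α = - φ Q.α := by simp [hφ', Q.conj]
    have h0 : φ Q.α ≠ 0 := by simpa using Q.ne_zero
    rw [← hw, InfinitePlace.mk_eq_iff] at heq
    rcases heq with heq | heq
    · rw [← heq] at h1
      exact h0 (self_eq_neg.1 h1)
    · have hreal : ComplexEmbedding.IsReal (φ.comp (algebraMap K L)) := by
        rw [ComplexEmbedding.isReal_iff]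
        conv_rhs => rw [← hc, ← heq]
        ext x; simp [ComplexEmbedding.conjugate_coe_eq]
      have hp : (w.comap (algebraMap K L)).IsReal := by
        rw [← hw, InfinitePlace.comap_mk, InfinitePlace.isReal_mk_iff]; exact hreal
      have h2 := mem_HI.1 h hp
      have h3 : (w.comap (algebraMap K L)).embedding = φ.comp (algebraMap K L) := by
        rw [← hw, InfinitePlace.comap_mk]
        exact InfinitePlace.embedding_mk_eq_of_isReal hreal
      have h4 : (InfinitePlace.embedding_of_isReal hp a : ℂ) = (φ Q.α) ^ 2 := by
        rw [InfinitePlace.embedding_of_isReal_apply, h3, ← map_pow, Q.sq]; rfl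
      rw [← heq] at h1
      rw [ComplexEmbedding.conjugate_coe_eq] at h1
      have h5 : (φ Q.α).re = 0 := by
        have := congrArg Complex.re h1
        simp at this; linarith
      have h6 := congrArg Complex.re h4
      rw [pow_two, Complex.mul_re, h5, Complex.ofReal_re] at h6
      nlinarith [mul_self_nonneg (φ Q.α).im]
  · rw [InfinitePlace.comap_mk, hc, ← InfinitePlace.comap_mk, hw]

open Classical in
lemma count {a : Kˣ} (Q : Quad K L (a : K)) (S : Finset (Pl K)) :
    2 * (Fintype.card (InfinitePlace K) + S.card) ≤
      (Fintype.card (InfinitePlace L) + (upS (L := L) S).card) +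
       ((S.filter fun v => a ∉ H (vl v)).card + (Finset.univ.filter fun p : InfinitePlace K => a ∉ HI p).card) := by
  have h1 := count_fib (fun w : Pl L => dn K w) (upS S) S (S.filter fun v => a ∉ H (vl v))
    (fun w hw => mem_upS.1 hw)
    (fun v hv => by obtain ⟨w, rfl⟩ := dn_surj (L := L) v; exact ⟨w, mem_upS.2 hv, rfl⟩)
    (fun v hv hB => by
      simp [hv] at hB
      obtain ⟨w, w', h, rfl, h'⟩ := Q.two_places hB
      exact ⟨w, mem_upS.2 hv, w', mem_upS.2 (h' ▸ hv), h, rfl, h'⟩)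
  have h2 := count_fib (fun w : InfinitePlace L => w.comap (algebraMap K L)) Finset.univ Finset.univ
    (Finset.univ.filter fun p : InfinitePlace K => a ∉ HI p) (by simp)
    (fun v hv => by
      obtain ⟨w, rfl⟩ := InfinitePlace.comap_surjective (k := K) (K := L) v; exact ⟨w, by simp, rfl⟩)
    (fun v hv hB => by
      simp at hB
      obtain ⟨w, w', h, rfl, h'⟩ := Q.two_inf hB
      exact ⟨w, by simp, w', by simp, h, rfl, h'⟩)
  rw [Finset.card_univ, Finset.card_univ] at h2
  omega

end Quad

/-- existence of the quadratic extension -/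
theorem exists_quad {K : Type u} [Field K] [NumberField K] (a : K) (h : ∀ r : K, r ^ 2 ≠ a) : ∃ (L : Type u) (_ : Field L) (_ : NumberField L)
    (_ : Algebra K L), Nonempty (Quad K L a) := by
  haveI : Fact (∀ r, r ^ 2 ≠ a + 0 * r) := ⟨by simpa using h⟩
  haveI : NumberField (QuadraticAlgebra K a 0) := NumberField.of_module_finite K _
  refine ⟨QuadraticAlgebra K a 0, inferInstance, inferInstance, inferInstance, ⟨⟨QuadraticAlgebra.omega, ?_, ?_, ?_, ?_, h⟩⟩⟩
  · exact
    { toFun := star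
      invFun := star
      left_inv := star_star
      right_inv := star_star
      map_mul' := fun x y => by rw [star_mul, mul_comm]
      map_add' := star_add
      commutes' := fun x => by ext <;> simp [QuadraticAlgebra.algebraMap_eq] }
  · ext <;> simp [QuadraticAlgebra.algebraMap_eq, pow_two, QuadraticAlgebra.omega]
  · ext <;> simp [QuadraticAlgebra.omega]
  · intro z
    refine ⟨z.re, z.im, ?_⟩
    ext <;> simp [QuadraticAlgebra.algebraMap_eq, QuadraticAlgebra.omega]

end Loc


set_option linter.unusedSectionVars false
set_option linter.deprecated false
set_option linter.style.haveILetI false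

open WithZero IsDedekindDomain NumberField

namespace Loc

lemma card_two_tors' {L A : Type*} [Field L] [CharZero L] [CommGroup A] (j : A →* Lˣ)
    (hj : Function.Injective j) (e : A) (h : j e = -1) :
    Nat.card (powMonoidHom 2 : A →* A).ker = 2 := by
  rw [Nat.card_eq_two_iff]
  have he : e ^ 2 = 1 := hj (by rw [map_pow, h]; simp)
  refine ⟨1, ⟨e, ?_⟩, ?_, ?_⟩
  · rw [MonoidHom.mem_ker]; exact he
  · intro heq
    have h1 : (1 : A) = e := congrArg Subtype.val heq
    have h2 : ((j e : Lˣ) : L) = 1 := by rw [← h1]; simp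
    rw [h] at h2
    norm_num at h2
  · rw [Set.eq_univ_iff_forall]
    rintro ⟨x, hx⟩
    have h1 : x ^ 2 = 1 := hx
    have h2 : ((j x : Lˣ) : L) ^ 2 = 1 := by
      rw [← Units.val_pow_eq_pow_val, ← map_pow, h1]; simp
    rcases sq_eq_one_iff.1 h2 with h3 | h3
    · left
      apply Subtype.ext
      apply hj
      apply Units.ext
      simpa using h3
    · right
      apply Subtype.ext
      apply hj
      apply Units.ext
      simp [h3, h]

lemma finrank_mul_ker {A B : Type*} [CommGroup A] [CommGroup B] [Module.Finite ℤ (Additive A)]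
    [Module.Finite ℤ (Additive B)] (f : A →* B) : Module.Finite ℤ (Additive f.ker) ∧
    Module.finrank ℤ (Additive A) ≤ Module.finrank ℤ (Additive f.ker) + Module.finrank ℤ (Additive B) := by
  let F := (MonoidHom.toAdditive f).toIntLinearMap
  let i := (MonoidHom.toAdditive f.ker.subtype).toIntLinearMap
  have hi : Function.Injective i := by
    intro x y hxy
    exact Subtype.ext hxy
  have h1 : LinearMap.range i = LinearMap.ker F := by
    ext x
    constructor
    · rintro ⟨y, rfl⟩
      exact y.2
    · intro hx
      exact ⟨(⟨x, hx⟩ : f.ker), rfl⟩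
  have h2 := rank_nullity F
  have h3 := (LinearEquiv.ofInjective i hi).finrank_eq
  rw [h1] at h3
  have h4 := Submodule.finrank_le (LinearMap.range F)
  refine ⟨Module.Finite.of_injective i hi, ?_⟩
  omega

namespace Quad
variable {K : Type*} [Field K] [NumberField K] {L : Type*} [Field L] [NumberField L] [Algebra K L]

lemma nm_σ {a : K} (Q : Quad K L a) (z : L) : Q.nm (Q.σ z) = Q.nm z := by
  apply (algebraMap K L).injective
  rw [nm_spec, nm_spec, Q.σσ, mul_comm]

lemma σ_mem {a : K} (Q : Quad K L a) (S : Finset (Pl K)) {z : Lˣ} (hz : z ∈ SU (upS S)) :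
    Units.map (Q.σ : L →* L) z ∈ SU (upS S) := by
  intro w hw
  obtain ⟨w', h1, h2⟩ := conj_place Q.σ w
  refine ((h2 z).1).2 (hz w' ?_)
  rwa [mem_upS, h1, ← mem_upS]

lemma nm_mem {a : K} (Q : Quad K L a) (S : Finset (Pl K)) {z : Lˣ} (hz : z ∈ SU (upS S)) :
    Units.map Q.nm z ∈ SU S := by
  rw [← SU_upS (L := L)]
  have : Units.map (algebraMap K L).toMonoidHom (Units.map Q.nm z) = z * Units.map (Q.σ : L →* L) z := by
    ext; simp [nm_spec]
  rw [this]
  exact mul_mem hz (Q.σ_mem S hz)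

/-- Hilbert 90 for S-units -/
lemma h90 {a : Kˣ} (Q : Quad K L (a : K)) {S : Finset (Pl K)} (hS : GoodS S) (ha : a ∈ SU S)
    {u : Lˣ} (hu : u ∈ SU (upS S)) (h : (u : L) * Q.σ u = 1) :
    ∃ w ∈ SU (upS (L := L) S), (u : L) * Q.σ w = w := by
  have σu : ∀ w ∉ upS S, vl w (Q.σ (u : L)) = 1 := Q.σ_mem S hu
  by_cases h1 : (u : L) = -1
  · refine ⟨Units.mk0 Q.α Q.ne_zero, ?_, by simp [h1, Q.conj]⟩
    intro w hw
    have : vl w (Q.α ^ 2) = 1 := by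
      rw [Q.sq, dn_eq_one]; exact ha _ (by rwa [← mem_upS])
    rw [map_pow, pow_eq_one_iff] at this
    simpa using this
  · obtain ⟨p, q, hpq⟩ := Q.rep u
    have hσ : Q.σ u = algebraMap K L p - algebraMap K L q * Q.α := by
      rw [hpq]; simp [Q.conj]; ring
    have hn : p ^ 2 - a * q ^ 2 = 1 := by
      rw [← Q.nm_rep, ← hpq]
      apply (algebraMap K L).injective
      rw [nm_spec, h, map_one]
    have hx0 : 1 + (u : L) ≠ 0 := fun h0 => h1 (by linear_combination h0)
    have hx2 : (1 + (u : L)) ^ 2 = u * algebraMap K L (2 + 2 * p) := by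
      simp only [map_add, map_mul, map_ofNat]
      have : (u : L) + Q.σ u = 2 * algebraMap K L p := by rw [hσ, hpq]; ring
      linear_combination u * this - h
    have hm0 : 2 + 2 * p ≠ 0 := by
      intro h0
      rw [h0, map_zero, mul_zero] at hx2
      exact hx0 (pow_eq_zero_iff two_ne_zero |>.1 hx2)
    set m : Kˣ := Units.mk0 _ hm0 with hm
    obtain ⟨k, hk⟩ := even_ord hS m (fun v hv => by
      have h2 := hS.dy v hv
      have h4 : vl v (4 : K) = 1 := by
        rw [show (4 : K) = 2 * 2 by norm_num, map_mul, h2, one_mul]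
      have hle : vl v (m : K) ≤ 1 := by
        obtain ⟨w, rfl⟩ := dn_surj (L := L) v
        have hw : w ∉ upS S := by rwa [mem_upS]
        obtain ⟨e, he, hd⟩ := dn_spec (K := K) w
        rw [← pow_le_one_iff he, ← hd]
        have : algebraMap K L (m : K) = 2 + u + Q.σ u := by
          simp only [hm, Units.val_mk0, map_add, map_mul, map_ofNat]; rw [hσ, hpq]; ring
        rw [this]
        have h2' : vl w (2 : L) = 1 := by
          rw [← map_ofNat (algebraMap K L) 2, dn_eq_one]; exact h2
        refine ((vl w).map_add _ _).trans (max_le (((vl w).map_add _ _).trans (max_le h2'.le (hu w hw).le)) (σu w hw).le)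
      rcases hle.eq_or_lt with heq | hlt
      · exact ⟨0, by rw [heq]; simp⟩
      · have h5 : vl v ((m : K) - 4) = 1 := by
          rw [Valuation.map_sub_eq_of_lt_right _ (by rw [h4]; exact hlt), h4]
        have h6 : (m : K) * (m - 4) = a * (2 * q) ^ 2 := by
          simp [hm]; linear_combination 4 * hn
        have hq : q ≠ 0 := by
          rintro rfl
          have h7 : (m : K) - 4 = 0 := by
            have : (m : K) * (m - 4) = 0 := by rw [h6]; simp
            simpa using this
          rw [h7] at h5; simp at h5
        have h8 := congrArg (vl v) h6
        rw [map_mul, map_mul, h5, mul_one, ha v hv, one_mul, map_pow] at h8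
        obtain ⟨n, hn⟩ := even_val (w := vl v) (x := 2 * q) (by simpa using hq)
        refine ⟨n, ?_⟩
        rw [h8, hn, ← exp_nsmul]; simp)
    set kk : Lˣ := Units.map (algebraMap K L).toMonoidHom k with hkk
    set x : Lˣ := Units.mk0 _ hx0 with hx
    refine ⟨x / kk, ?_, ?_⟩
    · intro w hw
      have e : (x / kk) ^ 2 = u * Units.map (algebraMap K L).toMonoidHom (m / k ^ 2) := by
        rw [div_pow, map_div, map_pow, ← hkk, ← mul_div_assoc]
        congr 1
        ext
        simpa [hx, hm] using hx2
      have : (x / kk) ^ 2 ∈ SU (upS (L := L) S) := by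
        rw [e]; exact mul_mem hu (SU_upS.2 hk)
      have := this w hw
      rw [Units.val_pow_eq_pow_val, map_pow, pow_eq_one_iff] at this
      simpa using this
    · simp only [hx, hkk, Units.val_div_eq_div_val, Units.val_mk0, map_div₀, map_add, map_one, Units.coe_map]
      simp only [RingHom.toMonoidHom_eq_coe, MonoidHom.coe_coe, AlgEquiv.commutes]
      have : (algebraMap K L) k ≠ 0 := by simp
      field_simp
      linear_combination h

open Classical in
theorem fi_aux {a : Kˣ} (Q : Quad K L (a : K)) {S : Finset (Pl K)} (hS : GoodS S) (ha : a ∈ SU S) :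
    (norms (a : K)).relIndex (SU S) ≠ 0 ∧ (norms (a : K)).relIndex (SU S) * 2 ≤
      2 ^ ((S.filter fun v => a ∉ H (vl v)).card + (Finset.univ.filter fun p : InfinitePlace K => a ∉ HI p).card) := by
  let N : SU (upS (L := L) S) →* SU S := ((Units.map Q.nm).comp (SU (upS S)).subtype).codRestrict (SU S)
    (fun z => Q.nm_mem S z.2)
  let i : SU S →* SU (upS (L := L) S) := ((Units.map (algebraMap K L).toMonoidHom).comp (SU S).subtype).codRestrict _
    (fun z => SU_upS.2 z.2)
  let σ : SU (upS (L := L) S) →* SU (upS (L := L) S) :=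
    ((Units.map (Q.σ : L →* L)).comp (SU (upS S)).subtype).codRestrict _ (fun z => Q.σ_mem S z.2)
  have hN : ∀ u, (((N u : SU S) : Kˣ) : K) = Q.nm (u : Lˣ) := fun u => rfl
  have hi : ∀ u, (((i u : SU (upS (L := L) S)) : Lˣ) : L) = algebraMap K L (u : Kˣ) := fun u => rfl
  have hσ : ∀ u, (((σ u : SU (upS (L := L) S)) : Lˣ) : L) = Q.σ (u : Lˣ) := fun u => rfl
  have H := herbrand N i σ
    (fun x => by
      apply Subtype.ext; apply Units.ext
      apply (algebraMap K L).injective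
      rw [hN, hi, nm_spec]; simp [pow_two])
    (fun x => by
      apply Subtype.ext; apply Units.ext
      rw [hi, hN, nm_spec]; simp [hσ])
    (fun w hw => by
      have : Q.σ (w : Lˣ) = (w : Lˣ) := by rw [← hσ, hw]
      obtain ⟨x, hx⟩ := Q.fixed this
      have hx0 : x ≠ 0 := by
        rintro rfl
        exact (w : Lˣ).ne_zero (by rw [← hx, map_zero])
      have e : Units.map (algebraMap K L).toMonoidHom (Units.mk0 x hx0) = w := by
        ext; simpa using hx
      refine ⟨⟨Units.mk0 x hx0, SU_upS.1 (by rw [e]; exact w.2)⟩, ?_⟩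
      apply Subtype.ext; apply Units.ext
      rw [hi]; exact hx)
    (fun u hu => by
      obtain ⟨w, hw, hw'⟩ := Q.h90 hS ha u.2 (by rw [← nm_spec, ← hN, hu]; simp)
      refine ⟨⟨w, hw⟩, ?_⟩
      rw [eq_div_iff_mul_eq']
      apply Subtype.ext; apply Units.ext
      simpa [hσ] using hw')
    (fun u => by
      apply Subtype.ext; apply Units.ext
      rw [hN, hN, hσ, nm_σ])
  obtain ⟨hfin, hrk⟩ := finrank_mul_ker N
  have hn1 : (⟨-1, neg_one_mem_SU _⟩ : SU (upS (L := L) S)) ∈ N.ker := by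
    rw [MonoidHom.mem_ker]
    apply Subtype.ext; apply Units.ext
    apply (algebraMap K L).injective
    rw [hN, nm_spec]; simp
  have hV := index_two_mul (A := N.ker) (card_two_tors' ((SU (upS (L := L) S)).subtype.comp N.ker.subtype)
    (fun x y hxy => Subtype.ext (Subtype.ext hxy)) ⟨_, hn1⟩ rfl)
  rw [SU_sq_index, hV] at H
  have hc := Q.count S
  set n := (S.filter fun v => a ∉ Loc.H (vl v)).card + (Finset.univ.filter fun p : InfinitePlace K => a ∉ HI p).card
  have r1 := finrank_SU S
  have r2 := finrank_SU (upS (L := L) S)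
  have hle : N.range ≤ (norms (a : K)).subgroupOf (SU S) := by
    rintro _ ⟨u, rfl⟩
    rw [Subgroup.mem_subgroupOf, mem_norms]
    obtain ⟨x, y, hxy⟩ := Q.rep (u : Lˣ)
    refine ⟨x, y, ?_⟩
    rw [hN, hxy, nm_rep]
  have hpos : N.range.index ≠ 0 := by
    intro h0; rw [h0, zero_mul] at H
    exact absurd H (by positivity)
  refine ⟨?_, ?_⟩
  · intro h0
    have : (norms (a : K)).relIndex (SU S) ∣ N.range.index := Subgroup.index_dvd_of_le hle
    rw [h0, zero_dvd_iff] at this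
    exact hpos this
  have hle2 : (norms (a : K)).relIndex (SU S) ≤ N.range.index :=
    Nat.le_of_dvd (Nat.pos_of_ne_zero hpos) (Subgroup.index_dvd_of_le hle)
  set rV := Module.finrank ℤ (Additive N.ker)
  have h1 : 2 ^ (Fintype.card (InfinitePlace K) + S.card) ≤ 2 ^ n * 2 ^ rV := by
    rw [← pow_add]
    exact Nat.pow_le_pow_right (by norm_num) (by omega)
  rw [H, pow_succ'] at h1
  refine (Nat.mul_le_mul_right 2 hle2).trans ?_
  refine Nat.le_of_mul_le_mul_right (c := 2 ^ rV) ?_ (by positivity)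
  rw [mul_assoc]; exact h1

end Quad

variable {K : Type*} [Field K] [NumberField K]

open Classical in
/-- number of nonsplit places in S and at infinity -/
noncomputable def nsp (S : Finset (Pl K)) (a : Kˣ) : Finset (Place K) :=
  (S.disjSum Finset.univ).filter fun p => a ∉ HP p

lemma mem_nsp {S : Finset (Pl K)} {a : Kˣ} {p : Place K} : p ∈ nsp S a ↔ p ∈ S.disjSum Finset.univ ∧ a ∉ HP p := by
  simp [nsp]

open Classical in
lemma card_nsp (S : Finset (Pl K)) (a : Kˣ) : (nsp S a).card =
   (S.filter fun v => a ∉ H (vl v)).card + (Finset.univ.filter fun p : InfinitePlace K => a ∉ HI p).card := by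
  rw [← Finset.card_disjSum]
  congr 1
  ext p
  rw [mem_nsp]
  rcases p with p | p <;> simp [HP]

/-- first inequality -/
theorem fi {a : Kˣ} (h : ∀ r : K, r ^ 2 ≠ a) {S : Finset (Pl K)} (hS : GoodS S) (ha : a ∈ SU S) :
    (norms (a : K)).relIndex (SU S) ≠ 0 ∧ (norms (a : K)).relIndex (SU S) * 2 ≤ 2 ^ (nsp S a).card := by
  obtain ⟨L, _, _, _, ⟨Q⟩⟩ := exists_quad (a : K) h
  rw [card_nsp]
  exact Q.fi_aux hS ha

end Loc


set_option linter.unusedSectionVars false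
set_option linter.deprecated false
set_option linter.style.haveILetI false

open WithZero IsDedekindDomain NumberField

namespace Loc

variable {K : Type*} [Field K] [NumberField K]

open Classical in
/-- lower bound for the norm index -/
lemma lb (W : Subgroup Kˣ) (x : Kˣ) (ns : Finset (Place K)) (b : Place K → Kˣ)
    (hb : ∀ p ∈ ns, b p ∉ NP p (x : K))
    (h : ∀ J ⊆ ns, ∃ u ∈ W, ∀ p ∈ ns, u / (if p ∈ J then b p else 1) ∈ HP p)
    (h0 : (norms (x : K)).relIndex W ≠ 0) : 2 ^ ns.card ≤ (norms (x : K)).relIndex W := by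
  choose! u hu hu' using h
  let Q := W ⧸ (norms (x : K)).subgroupOf W
  haveI : ((norms (x : K)).subgroupOf W).FiniteIndex := ⟨h0⟩
  haveI : Finite Q := Subgroup.finite_quotient_of_finiteIndex
  let f : ns.powerset → Q := fun J => QuotientGroup.mk ⟨u J.1, hu J.1 (Finset.mem_powerset.1 J.2)⟩
  have key : ∀ J ⊆ ns, ∀ J' ⊆ ns, u J / u J' ∈ norms (x : K) → J ⊆ J' := by
    intro J hJ J' hJ' hn p hp
    by_contra hp'
    apply hb p (hJ hp)
    have h1 := HP_le_NP p (x : K) (hu' J hJ p (hJ hp))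
    have h2 := HP_le_NP p (x : K) (hu' J' hJ' p (hJ hp))
    rw [if_pos hp] at h1
    rw [if_neg hp', div_one] at h2
    have h3 := norms_le_NP p (x : K) hn
    have e : b p = (u J / u J') * u J' / (u J / b p) := by
      rw [div_mul_cancel, div_div_cancel]
    rw [e]
    exact div_mem (mul_mem h3 h2) h1
  have hf : Function.Injective f := by
    rintro ⟨J, hJ⟩ ⟨J', hJ'⟩ hJJ
    rw [Finset.mem_powerset] at hJ hJ'
    have h1 := QuotientGroup.eq.1 hJJ
    rw [Subgroup.mem_subgroupOf] at h1
    have h1 : (u J)⁻¹ * u J' ∈ norms (x : K) := h1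
    apply Subtype.ext
    apply Finset.Subset.antisymm
    · apply key J hJ J' hJ'
      rw [← inv_mem_iff, inv_div, div_eq_inv_mul]; exact h1
    · apply key J' hJ' J hJ
      rw [div_eq_inv_mul, mul_comm, mul_comm] ; rw [mul_comm] at h1; rwa [mul_comm]
  have := Nat.card_le_card_of_injective f hf
  rw [Nat.card_eq_fintype_card, Fintype.card_coe, Finset.card_powerset] at this
  exact this

lemma weak_approx' (S : Finset (Pl K)) (t : Place K → Kˣ) :
    ∃ x : Kˣ, ∀ p ∈ S.disjSum (Finset.univ : Finset (InfinitePlace K)), x / t p ∈ HP p := by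
  obtain ⟨x, h1, h2⟩ := weak_approx S (fun v => t (Sum.inl v)) (fun p => t (Sum.inr p))
  refine ⟨x, ?_⟩
  rintro (v | p) hp
  · exact h1 v (by simpa using hp)
  · exact h2 p

/-- support of an element -/
noncomputable def supp (x : Kˣ) : Finset (Pl K) := (supp_finite x).toFinset

lemma mem_SU_of_supp {x : Kˣ} {S : Finset (Pl K)} (h : supp x ⊆ S) : x ∈ SU S := by
  intro v hv
  by_contra h'
  exact hv (h (by simpa [supp] using h'))

/-- a nonsquare is locally nonsquare at some place outside a finite set -/
theorem exists_nonsplit {x : Kˣ} (hx : ∀ r : K, r ^ 2 ≠ x) (B : Finset (Pl K)) : ∃ v ∉ B, x ∉ H (vl v) := by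
  classical
  by_contra hcon
  push Not at hcon
  obtain ⟨S0, hS0, hgood⟩ := exists_good (B ∪ supp x)
  have hb : ∀ p : Place K, ∃ b : Kˣ, x ∉ HP p → b ∉ NP p (x : K) := by
    intro p
    by_cases h : x ∈ HP p
    · exact ⟨1, fun h' => absurd h h'⟩
    · obtain ⟨b, hb⟩ := exists_notMem_NP h
      exact ⟨b, fun _ => hb⟩
  choose b hb using hb
  choose u hu using fun J : Finset (Place K) => weak_approx' S0 (fun p => if p ∈ J then b p else 1)
  obtain ⟨S, hS, hSg⟩ := exists_good (S0 ∪ (nsp S0 x).powerset.biUnion fun J => supp (u J))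
  have hS0S : S0 ⊆ S := Finset.subset_union_left.trans hS
  have hns : nsp S x = nsp S0 x := by
    ext p
    rw [mem_nsp, mem_nsp]
    refine ⟨fun h => ⟨?_, h.2⟩, fun h => ⟨?_, h.2⟩⟩
    · rcases p with v | p
      · simp only [Finset.inl_mem_disjSum]
        by_contra hv
        exact h.2 (hcon v fun hvB => hv (hS0 (Finset.mem_union_left _ hvB)))
      · simp
    · rcases p with v | p
      · simp only [Finset.inl_mem_disjSum] at h ⊢
        exact hS0S h.1
      · simp
  have hxS : x ∈ SU S := mem_SU_of_supp ((Finset.subset_union_right.trans hS0).trans hS0S)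
  obtain ⟨h1, h2⟩ := fi hx hSg hxS
  have h3 := lb (SU S) x (nsp S x) b (fun p hp => hb p (mem_nsp.1 hp).2) (fun J hJ => by
    refine ⟨u J, mem_SU_of_supp ?_, fun p hp => ?_⟩
    · refine (Finset.Subset.trans ?_ Finset.subset_union_right).trans hS
      exact Finset.subset_biUnion_of_mem (fun J => supp (u J)) (Finset.mem_powerset.2 (hns ▸ hJ))
    · rw [hns] at hp
      exact hu J p (mem_nsp.1 hp).1) h1
  have : 0 < 2 ^ (nsp S x).card := by positivity
  omega

lemma H_map {L : Type*} [Field L] [NumberField L] [Algebra K L] (w : Pl L) {x : Kˣ} (h : x ∈ H (vl (dn K w))) :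
    Units.map (algebraMap K L).toMonoidHom x ∈ H (vl w) := by
  obtain ⟨y, hy0, hy⟩ := mem_H.1 h
  obtain ⟨e, he, hd⟩ := dn_spec (K := K) w
  refine mem_H.2 ⟨algebraMap K L y, by simpa using hy0, ?_⟩
  have e1 : ((Units.map (algebraMap K L).toMonoidHom x : Lˣ) : L) * algebraMap K L y ^ 2 - 1 =
    algebraMap K L (x * y ^ 2 - 1) := by simp
  rw [e1, ← map_ofNat (algebraMap K L) 4, hd, hd]
  exact pow_lt_pow_left₀ hy (zero_le) he

theorem exists_split_nonsplit {a x : Kˣ} (ha : ∀ r : K, r ^ 2 ≠ a) (hx : ∀ r : K, r ^ 2 ≠ x)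
    (hax : ∀ r : K, r ^ 2 ≠ a * x) (B : Finset (Pl K)) : ∃ v ∉ B, a ∈ H (vl v) ∧ x ∉ H (vl v) := by
  classical
  obtain ⟨L, _, _, _, ⟨Q⟩⟩ := exists_quad (a : K) ha
  set B' := B ∪ supp a ∪ supp x ∪ supp (Units.mk0 (2 : K) two_ne_zero) with hB'
  set ι := Units.map (algebraMap K L).toMonoidHom with hι
  obtain ⟨w, hw, hwx⟩ := exists_nonsplit (x := ι x) (fun r hr => by
    obtain ⟨p, q, rfl⟩ := Q.rep r
    have h1 : (p : K) ^ 2 + q ^ 2 * a - x = 0 ∧ 2 * p * q = 0 := by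
      have h2 : algebraMap K L (p ^ 2 + q ^ 2 * a - x) + algebraMap K L (2 * p * q) * Q.α = 0 := by
        have h3 : ((ι x : Lˣ) : L) = algebraMap K L x := rfl
        rw [h3] at hr
        simp only [map_add, map_sub, map_mul, map_pow, map_ofNat]
        linear_combination hr - algebraMap K L q ^ 2 * Q.sq
      have h4 := congrArg Q.nm h2
      rw [Q.nm_rep] at h4
      have h5 : Q.nm 0 = 0 := by
        have := Q.nm_rep 0 0
        simpa using this
      rw [h5] at h4
      have h6 : (2 * p * q) = 0 := by
        by_contra h7
        refine ha ((p ^ 2 + q ^ 2 * a - x) / (2 * p * q)) ?_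
        rw [div_pow, div_eq_iff (pow_ne_zero 2 h7)]
        linear_combination h4
      rw [h6] at h4
      refine ⟨?_, h6⟩
      simpa using h4
    obtain ⟨h1, h2⟩ := h1
    simp only [mul_eq_zero, OfNat.ofNat_ne_zero, false_or] at h2
    rcases h2 with rfl | rfl
    · exact hax (q * a) (by linear_combination (a : K) * h1)
    · exact hx p (by linear_combination h1)) (upS B')
  rw [mem_upS] at hw
  set v := dn K w with hv
  have hBv : v ∉ B := fun h => hw (by simp [hB', h])
  have hav : vl v (a : K) = 1 := mem_SU_of_supp (S := B') (by intro y hy; simp [hB', hy]) v hw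
  have hxv : vl v (x : K) = 1 := mem_SU_of_supp (S := B') (by intro y hy; simp [hB', hy]) v hw
  have h2v : vl v (2 : K) = 1 := mem_SU_of_supp (x := Units.mk0 (2 : K) two_ne_zero) (S := B')
    (by intro y hy; simp [hB', hy]) v hw
  have hxH : x ∉ H (vl v) := fun h => hwx (H_map w h)
  refine ⟨v, hBv, ?_, hxH⟩
  by_contra haH
  have h1 := H_map w (odd_mul_mem v h2v hav hxv haH hxH)
  rw [map_mul] at h1
  have h2 : Units.map (algebraMap K L).toMonoidHom a ∈ H (vl w) := by
    have : Units.map (algebraMap K L).toMonoidHom a = (Units.mk0 Q.α Q.ne_zero) ^ 2 := by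
      ext; simp [Q.sq]
    rw [this]; exact sq_mem_H _
  exact hwx ((Subgroup.mul_mem_cancel_left _ h2).1 h1)

end Loc


set_option linter.unusedSectionVars false
set_option linter.deprecated false
set_option linter.style.haveILetI false

open WithZero IsDedekindDomain NumberField

namespace Loc

variable {K : Type*} [Field K] [NumberField K]

/-- squares in the S-units -/
abbrev sqS (S : Finset (Pl K)) : Subgroup (SU S) := (powMonoidHom 2 : SU S →* SU S).range

lemma mem_sqS {S : Finset (Pl K)} {x : SU S} {r : K} (h : r ^ 2 = ((x : Kˣ) : K)) : x ∈ sqS S := by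
  have hr : r ≠ 0 := by
    rintro rfl
    exact (x : Kˣ).ne_zero (by rw [← h]; simp)
  refine ⟨⟨Units.mk0 r hr, fun v hv => ?_⟩, ?_⟩
  · have h1 := x.2 v hv
    rw [← h, map_pow, pow_eq_one_iff] at h1
    simpa using h1
  · apply Subtype.ext; apply Units.ext
    simpa using h

/-- unit interpolation property -/
def PT (S T : Finset (Pl K)) : Prop :=
  ∀ z : Pl K → Kˣ, (∀ v ∈ T, vl v (z v : K) = 1) → ∃ u ∈ SU S, ∀ v ∈ T, u / z v ∈ H (vl v)

lemma odd_div_mem (v : Pl K) (h2 : vl v 2 = 1) {a x : Kˣ} (ha : vl v (a : K) = 1) (hx : vl v (x : K) = 1)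
    (ha' : a ∉ H (vl v)) (hx' : x ∉ H (vl v)) : a / x ∈ H (vl v) := by
  rw [div_eq_mul_inv]
  exact odd_mul_mem v h2 ha (by simp [hx]) ha' (by rwa [inv_mem_iff])

theorem greedy {S : Finset (Pl K)} (hS : GoodS S) {a : Kˣ} (ha : a ∈ SU S) (hns : ∀ r : K, r ^ 2 ≠ a) (t : ℕ)
    (ht : t + 1 ≤ Fintype.card (InfinitePlace K) + S.card) :
    ∃ T : Finset (Pl K), T.card = t ∧ Disjoint S T ∧ (∀ v ∈ T, a ∈ H (vl v)) ∧ PT S T := by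
  classical
  induction t with
  | zero => exact ⟨∅, rfl, by simp, by simp, fun z _ => ⟨1, one_mem _, by simp⟩⟩
  | succ t ih =>
    obtain ⟨T, hTc, hd, haT, hP⟩ := ih (by omega)
    have hTS : ∀ v ∈ T, v ∉ S := fun v hv hv' => Finset.disjoint_left.1 hd hv' hv
    let X : Subgroup (SU S) := (⨅ v ∈ T, H (vl v)).subgroupOf (SU S)
    have hX : ∀ x : SU S, x ∈ X ↔ ∀ v ∈ T, (x : Kˣ) ∈ H (vl v) := by
      intro x
      rw [Subgroup.mem_subgroupOf]
      simp [Subgroup.mem_iInf]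
    have hXi := index_le_of_fun X (α := T → Bool) (fun x v => decide ((x : Kˣ) ∈ H (vl v.1))) (by
      intro x y hxy
      rw [hX]
      intro v hv
      have h1 := congrFun hxy ⟨v, hv⟩
      simp only [decide_eq_decide] at h1
      rw [Subgroup.coe_div]
      by_cases hx : (x : Kˣ) ∈ H (vl v)
      · exact div_mem hx (h1.1 hx)
      · exact odd_div_mem v (hS.dy v (hTS v hv)) (x.2 v (hTS v hv)) (y.2 v (hTS v hv)) hx (fun h => hx (h1.2 h)))
    have hsqX : sqS S ≤ X := by
      rintro _ ⟨x, rfl⟩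
      rw [hX]
      intro v _
      exact sq_mem_H (x : Kˣ)
    obtain ⟨x, hxX, hx1, hx2⟩ : ∃ x ∈ X, (∀ r : K, r ^ 2 ≠ ((x : Kˣ) : K)) ∧ ∀ r : K, r ^ 2 ≠ a * ((x : Kˣ) : K) := by
      by_contra hcon
      push Not at hcon
      have h1 := index_le_of_fun ((sqS S).subgroupOf X) (α := Bool) (fun x => decide ((x : SU S) ∈ sqS S)) (by
        intro x y hxy
        simp only [decide_eq_decide] at hxy
        rw [Subgroup.mem_subgroupOf, Subgroup.coe_div]
        by_cases hx : (x : SU S) ∈ sqS S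
        · exact div_mem hx (hxy.1 hx)
        · obtain ⟨r, hr⟩ := hcon x x.2 (fun r hr => hx (mem_sqS hr))
          obtain ⟨r', hr'⟩ := hcon y y.2 (fun r hr => hx (hxy.2 (mem_sqS hr)))
          apply mem_sqS (r := r / r')
          rw [div_pow, hr, hr', mul_div_mul_left _ _ a.ne_zero]
          simp)
      have h2 := Subgroup.relIndex_mul_index hsqX
      rw [SU_sq_index] at h2
      have h3 : (sqS S).relIndex X ≤ 2 := by
        have h0 := h1.2
        rw [Nat.card_eq_fintype_card, Fintype.card_bool] at h0
        exact h0
      have h4 : X.index ≤ 2 ^ t := by simpa [hTc] using hXi.2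
      have h5 := Nat.mul_le_mul h3 h4
      rw [h2, ← pow_succ'] at h5
      have := (Nat.pow_le_pow_iff_right (by norm_num)).1 h5
      omega
    obtain ⟨v, hv, hva, hvx⟩ := exists_split_nonsplit (x := (x : Kˣ)) hns hx1 hx2 (S ∪ T)
    have hvS : v ∉ S := fun h => hv (Finset.mem_union_left _ h)
    have hvT : v ∉ T := fun h => hv (Finset.mem_union_right _ h)
    refine ⟨insert v T, by rw [Finset.card_insert_of_notMem hvT, hTc], ?_, ?_, ?_⟩
    · rw [Finset.disjoint_insert_right]; exact ⟨hvS, hd⟩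
    · intro w hw
      rcases Finset.mem_insert.1 hw with rfl | hw
      · exact hva
      · exact haT w hw
    · intro z hz
      obtain ⟨u, hu, hu'⟩ := hP z (fun w hw => hz w (Finset.mem_insert_of_mem hw))
      by_cases huv : u / z v ∈ H (vl v)
      · refine ⟨u, hu, fun w hw => ?_⟩
        rcases Finset.mem_insert.1 hw with rfl | hw
        · exact huv
        · exact hu' w hw
      · refine ⟨u * x, mul_mem hu x.2, fun w hw => ?_⟩
        rw [mul_div_right_comm]
        rcases Finset.mem_insert.1 hw with rfl | hw
        · exact odd_mul_mem w (hS.dy w hvS) (by simp [hu w hvS, hz w (Finset.mem_insert_self _ _)]) (x.2 w hvS) huv hvx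
        · exact mul_mem (hu' w hw) ((hX x).1 hxX w hw)

/-- interpolation with arbitrary targets -/
lemma PT.full {S T : Finset (Pl K)} (hS : GoodS S) (hd : Disjoint S T) [DecidableEq (Pl K)] (h : PT S T) (t : Pl K → Kˣ) :
    ∃ u ∈ SU (S ∪ T), ∀ v ∈ T, u / t v ∈ H (vl v) := by
  have hTS : ∀ v ∈ T, v ∉ S := fun v hv hv' => Finset.disjoint_left.1 hd hv' hv
  choose! p hp1 hp2 using hS.pi
  choose n hn using fun v => even_val (w := vl v) (t v).ne_zero
  set π : Kˣ := ∏ v ∈ T, (p v) ^ (- n v) with hπ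
  have hππ : ∀ v ∈ T, vl v (π : K) = exp (n v) := by
    intro v hv
    rw [hπ, Units.coe_prod, map_prod, Finset.prod_eq_single_of_mem v hv]
    · simp [hp1 v (hTS v hv), ← exp_neg, ← exp_zsmul]
    · intro w hw hwv
      simp [hp2 w (hTS w hw) v (hTS v hv) hwv.symm]
  have hπS : π ∈ SU (S ∪ T) := by
    intro w hw
    rw [hπ, Units.coe_prod, map_prod]
    apply Finset.prod_eq_one
    intro v hv
    simp only [Finset.mem_union, not_or] at hw
    have : w ≠ v := by rintro rfl; exact hw.2 hv
    simp [hp2 v (hTS v hv) w hw.1 this]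
  obtain ⟨u, hu, hu'⟩ := h (fun v => t v / π) (fun v hv => by
    rw [Units.val_div_eq_div_val, map_div₀, hππ v hv, hn, div_self]; simp)
  refine ⟨u * π, mul_mem (SU_mono Finset.subset_union_left hu) hπS, fun v hv => ?_⟩
  have := hu' v hv
  rwa [div_div_eq_mul_div] at this

/-- second step: elements of W that are local squares on S and at infinity are squares -/
theorem ker_sq {S T : Finset (Pl K)} [DecidableEq (Pl K)] (hS : GoodS S) (hd : Disjoint S T) (hP : PT S T) {x : Kˣ}
    (hx : x ∈ SU (S ∪ T)) (hloc : ∀ p ∈ S.disjSum (Finset.univ : Finset (InfinitePlace K)), x ∈ HP p) :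
    ∃ r : K, r ^ 2 = x := by
  classical
  by_contra hcon
  push Not at hcon
  obtain ⟨h1, h2⟩ := fi hcon (hS.mono Finset.subset_union_left) hx
  have hb : ∀ p : Place K, ∃ b : Kˣ, x ∉ HP p → b ∉ NP p (x : K) := by
    intro p
    by_cases h : x ∈ HP p
    · exact ⟨1, fun h' => absurd h h'⟩
    · obtain ⟨b, hb⟩ := exists_notMem_NP h
      exact ⟨b, fun _ => hb⟩
  choose b hb using hb
  have h3 := lb (SU (S ∪ T)) x (nsp (S ∪ T) x) b (fun p hp => hb p (mem_nsp.1 hp).2) (fun J hJ => by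
    obtain ⟨u, hu, hu'⟩ := hP.full hS hd (fun v => if (Sum.inl v : Place K) ∈ J then b (Sum.inl v) else 1)
    refine ⟨u, hu, fun p hp => ?_⟩
    obtain ⟨hp1, hp2⟩ := mem_nsp.1 hp
    rcases p with v | p
    · suffices hvT : v ∈ T by convert! hu' v hvT
      simp only [Finset.inl_mem_disjSum, Finset.mem_union] at hp1
      rcases hp1 with hp1 | hp1
      · exact absurd (hloc (Sum.inl v) (by simpa using hp1)) hp2
      · exact hp1
    · exact absurd (hloc (Sum.inr p) (by simp)) hp2) h1
  have : 0 < 2 ^ (nsp (S ∪ T) x).card := by positivity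
  omega

end Loc


set_option linter.unusedSectionVars false
set_option linter.deprecated false
set_option linter.style.haveILetI false

open WithZero IsDedekindDomain NumberField

namespace Loc

variable {K : Type*} [Field K] [NumberField K]

lemma exists_e (v : Pl K) : ∃ e : ℕ, vl v (2 : K) = exp (-(e : ℤ)) := by
  obtain ⟨m, hm⟩ := even_val (w := vl v) (two_ne_zero (α := K))
  have h1 : vl v (2 : K) ≤ 1 := two_le _
  rw [hm, ← exp_zero, exp_le_exp] at h1
  exact ⟨m.natAbs, by rw [hm]; congr 1; lia⟩

lemma prod_norm_le (S : Finset (Pl K)) (e : Pl K → ℕ) (he : ∀ v, vl v (2 : K) = exp (-(e v : ℤ))) :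
    ∏ v ∈ S, (Ideal.absNorm v.asIdeal) ^ e v ≤ 2 ^ (Module.finrank ℚ K) := by
  have h1 : ∏ v ∈ S, v.asIdeal ^ e v ∣ Ideal.span {(2 : 𝓞 K)} := by
    apply Finset.prod_dvd_of_coprime
    · intro v _ w _ hvw
      apply IsCoprime.pow
      rw [Ideal.isCoprime_iff_sup_eq]
      haveI := v.isMaximal
      haveI := w.isMaximal
      exact Ideal.IsMaximal.coprime_of_ne v.isMaximal w.isMaximal (fun h => hvw (HeightOneSpectrum.ext h))
    · intro v _
      rw [← HeightOneSpectrum.intValuation_le_pow_iff_dvd]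
      have := he v
      have h2 : vl v (algebraMap (𝓞 K) K 2) = v.intValuation 2 := v.valuation_of_algebraMap 2
      rw [map_ofNat] at h2
      rw [← h2, this]
  have h2 := map_dvd (Ideal.absNorm) h1
  rw [map_prod] at h2
  simp only [map_pow] at h2
  have h3 : Ideal.absNorm (Ideal.span {(2 : 𝓞 K)}) = 2 ^ Module.finrank ℚ K := by
    rw [Ideal.absNorm_span_singleton]
    have : Algebra.norm ℤ (2 : 𝓞 K) = 2 ^ Module.finrank ℚ K := by
      rw [← map_ofNat (algebraMap ℤ (𝓞 K)) 2, Algebra.norm_algebraMap, RingOfIntegers.rank]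
    rw [this, Int.natAbs_pow]; rfl
  rw [h3] at h2
  exact Nat.le_of_dvd (by positivity) h2

/-- product of local square class groups -/
def PiH (S : Finset (Pl K)) := (p : (S.disjSum (Finset.univ : Finset (InfinitePlace K)))) → Kˣ ⧸ HP p.1

noncomputable instance (S : Finset (Pl K)) : Group (PiH S) :=
  inferInstanceAs (Group ((p : (S.disjSum (Finset.univ : Finset (InfinitePlace K)))) → Kˣ ⧸ HP p.1))

/-- product of local norm class groups -/
def PiN (S : Finset (Pl K)) (a : Kˣ) := (p : nsp S a) → Kˣ ⧸ NP p.1 (a : K)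

noncomputable instance (S : Finset (Pl K)) (a : Kˣ) : Group (PiN S a) :=
  inferInstanceAs (Group ((p : nsp S a) → Kˣ ⧸ NP p.1 (a : K)))

lemma HP_index_ne (p : Place K) : (HP p).index ≠ 0 := by
  rcases p with v | p
  · obtain ⟨e, he⟩ := exists_e v
    exact (H_index v e he).1
  · exact (HI_index_real p).1

instance (p : Place K) : Finite (Kˣ ⧸ HP p) :=
  haveI : (HP p).FiniteIndex := ⟨HP_index_ne p⟩
  Subgroup.finite_quotient_of_finiteIndex

lemma card_PiH (S : Finset (Pl K)) : Nat.card (PiH S) ≤ 4 ^ (Fintype.card (InfinitePlace K) + S.card) := by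
  classical
  have h1 : Nat.card (PiH S) = ∏ p ∈ S.disjSum (Finset.univ : Finset (InfinitePlace K)), (HP p).index := by
    rw [PiH, Nat.card_pi]
    exact Finset.prod_coe_sort _ (fun p => (HP p).index)
  choose e he using exists_e (K := K)
  rw [h1, Finset.prod_disjSum]
  have h2 : ∏ v ∈ S, (HP (Sum.inl v)).index ≤ 4 ^ S.card * 2 ^ Module.finrank ℚ K := by
    calc _ ≤ ∏ v ∈ S, (4 * (Ideal.absNorm v.asIdeal) ^ e v) :=
          Finset.prod_le_prod' fun v _ => (H_index v (e v) (he v)).2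
      _ = 4 ^ S.card * ∏ v ∈ S, (Ideal.absNorm v.asIdeal) ^ e v := by
          rw [Finset.prod_mul_distrib, Finset.prod_const]
      _ ≤ _ := Nat.mul_le_mul_left _ (prod_norm_le S e he)
  have h3 : ∏ p : InfinitePlace K, (HP (Sum.inr p)).index ≤ 2 ^ InfinitePlace.nrRealPlaces K := by
    calc _ ≤ ∏ p : InfinitePlace K, (if p.IsReal then 2 else 1) := by
          refine Finset.prod_le_prod' fun p _ => ?_
          split_ifs with hp
          · exact (HI_index_real p).2
          · have : HP (Sum.inr p) = ⊤ := HI_complex (InfinitePlace.not_isReal_iff_isComplex.1 hp)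
            rw [this]; simp
      _ = _ := by
          rw [Finset.prod_ite]
          simp [InfinitePlace.nrRealPlaces, Fintype.card_subtype]
  have h4 := InfinitePlace.card_add_two_mul_card_eq_rank K
  have h5 := InfinitePlace.card_eq_nrRealPlaces_add_nrComplexPlaces K
  refine (Nat.mul_le_mul h2 h3).trans (le_of_eq ?_)
  rw [← h4, h5, show (4 : ℕ) = 2 ^ 2 by norm_num, ← pow_mul, ← pow_mul, ← pow_add, ← pow_add]
  congr 1
  ring

lemma NP_index_ne (p : Place K) (a : K) : (NP p a).index ≠ 0 := fun h => HP_index_ne p (by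
  have := Subgroup.index_dvd_of_le (HP_le_NP p a)
  rwa [h, zero_dvd_iff] at this)

instance (p : Place K) (a : K) : Finite (Kˣ ⧸ NP p a) :=
  haveI : (NP p a).FiniteIndex := ⟨NP_index_ne p a⟩
  Subgroup.finite_quotient_of_finiteIndex

instance (S : Finset (Pl K)) : Finite (PiH S) :=
  inferInstanceAs (Finite ((p : (S.disjSum (Finset.univ : Finset (InfinitePlace K)))) → Kˣ ⧸ HP p.1))

instance (S : Finset (Pl K)) (a : Kˣ) : Finite (PiN S a) :=
  inferInstanceAs (Finite ((p : nsp S a) → Kˣ ⧸ NP p.1 (a : K)))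

theorem main_aux {S : Finset (Pl K)} (hS : GoodS S) {a : Kˣ} (ha : a ∈ SU S) (hns : ∀ r : K, r ^ 2 ≠ a) :
    (∀ p ∈ nsp S a, (NP p (a : K)).index = 2) ∧
    ∀ b ∈ SU S, (∀ p ∈ nsp S a, b ∈ NP p (a : K)) → b ∈ norms (a : K) := by
  classical
  set s := Fintype.card (InfinitePlace K) + S.card with hs
  have hs1 : 1 ≤ s := by
    have : 0 < Fintype.card (InfinitePlace K) := Fintype.card_pos
    omega
  obtain ⟨T, hTc, hd, haT, hP⟩ := greedy hS ha hns (s - 1) (by omega)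
  set W := SU (S ∪ T) with hW
  have haW : a ∈ W := SU_mono Finset.subset_union_left ha
  let f : W →* PiH S := MonoidHom.mk' (fun x p => QuotientGroup.mk' (HP p.1) (x : Kˣ)) (fun x y => by
    funext p; exact map_mul (QuotientGroup.mk' (HP p.1)) (x : Kˣ) (y : Kˣ))
  have hker : f.ker = sqS (S ∪ T) := by
    ext x
    constructor
    · intro hx
      obtain ⟨r, hr⟩ := ker_sq hS hd hP x.2 (fun p hp => by
        have h1 := congrFun (MonoidHom.mem_ker.1 hx) ⟨p, hp⟩
        exact (QuotientGroup.eq_one_iff _).1 h1)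
      exact mem_sqS hr
    · rintro ⟨y, rfl⟩
      rw [MonoidHom.mem_ker]
      funext p
      exact (QuotientGroup.eq_one_iff _).2 (sq_mem_HP p.1 (y : Kˣ))
  have hfr : Nat.card f.range = 2 ^ (2 * s - 1) := by
    rw [← Subgroup.index_ker, hker, SU_sq_index, Finset.card_union_of_disjoint hd, hTc]
    congr 1; omega
  have hidx : f.range.index ≤ 2 := by
    have h1 := Subgroup.card_mul_index f.range
    have h2 := card_PiH S
    rw [← h1, hfr, ← hs, show (4 : ℕ) = 2 ^ 2 by norm_num, ← pow_mul, show 2 * s = 2 * s - 1 + 1 by omega, pow_succ] at h2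
    simp only [Nat.add_sub_cancel] at h2
    exact Nat.le_of_mul_le_mul_left h2 (by positivity)
  let Q := PiN S a
  let g : PiH S →* Q := MonoidHom.mk' (fun x p =>
    QuotientGroup.map (HP p.1) (NP p.1 (a : K)) (MonoidHom.id _) (HP_le_NP p.1 _) (x ⟨p.1, (mem_nsp.1 p.2).1⟩))
    (fun x y => by
      funext p
      exact map_mul (QuotientGroup.map (HP p.1) (NP p.1 (a : K)) (MonoidHom.id _) (HP_le_NP p.1 _)) _ _)
  have hg : Function.Surjective g := by
    intro q
    choose k hk using fun p => QuotientGroup.mk_surjective (q p)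
    refine ⟨fun p => if h : p.1 ∈ nsp S a then QuotientGroup.mk (k ⟨p.1, h⟩) else 1, ?_⟩
    funext p
    rw [← hk p]
    have : (QuotientGroup.map (HP p.1) (NP p.1 (a : K)) (MonoidHom.id _) (HP_le_NP p.1 _))
       (if h : p.1 ∈ nsp S a then QuotientGroup.mk (k ⟨p.1, h⟩) else 1) = QuotientGroup.mk (k p) := by
      rw [dif_pos p.2]; rfl
    exact this
  have h1 : (g.comp f).range.index ≤ 2 := by
    rw [MonoidHom.range_comp]
    refine (Nat.le_of_dvd ?_ (Subgroup.index_map_dvd _ hg)).trans hidx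
    exact Nat.pos_of_ne_zero Subgroup.index_ne_zero_of_finite
  have hQ : Nat.card Q = ∏ p ∈ nsp S a, (NP p (a : K)).index := by
    change Nat.card ((p : nsp S a) → Kˣ ⧸ NP p.1 (a : K)) = _
    rw [Nat.card_pi]
    exact Finset.prod_coe_sort _ (fun p => (NP p (a : K)).index)
  have hle : (norms (a : K)).subgroupOf W ≤ (g.comp f).ker := by
    intro x hx
    rw [MonoidHom.mem_ker]
    funext p
    exact (QuotientGroup.eq_one_iff _).2 (norms_le_NP p.1 _ (Subgroup.mem_subgroupOf.1 hx))
  obtain ⟨hfi0, hfi⟩ := fi hns (hS.mono (Finset.subset_union_left (s₂ := T))) haW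
  have hnsp : nsp (S ∪ T) a = nsp S a := by
    ext p
    rw [mem_nsp, mem_nsp]
    rcases p with v | p
    · simp only [Finset.inl_mem_disjSum, Finset.mem_union]
      constructor
      · rintro ⟨h | h, h'⟩
        · exact ⟨h, h'⟩
        · exact absurd (haT v h) h'
      · rintro ⟨h, h'⟩
        exact ⟨Or.inl h, h'⟩
    · simp
  rw [hnsp, ← hW] at hfi
  have h2 : Nat.card Q ≤ (g.comp f).ker.index * 2 := by
    rw [Subgroup.index_ker, ← Subgroup.card_mul_index (g.comp f).range]
    exact Nat.mul_le_mul_left _ h1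
  have h3 : (g.comp f).ker.index ≤ (norms (a : K)).relIndex W :=
    Nat.le_of_dvd (Nat.pos_of_ne_zero hfi0) (Subgroup.index_dvd_of_le hle)
  have hge : ∀ p ∈ nsp S a, 2 ≤ (NP p (a : K)).index := by
    intro p hp
    have h4 := NP_index_ne p (a : K)
    have h5 : (NP p (a : K)).index ≠ 1 := by
      rw [Ne, Subgroup.index_eq_one]
      obtain ⟨b, hb⟩ := exists_notMem_NP (mem_nsp.1 hp).2
      intro h; rw [h] at hb; exact hb trivial
    omega
  have h4 : 2 ^ (nsp S a).card ≤ Nat.card Q := by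
    rw [hQ, ← Finset.prod_const]
    exact Finset.prod_le_prod' hge
  constructor
  · intro p hp
    by_contra hne
    have h5 : ∏ p ∈ nsp S a, 2 < ∏ p ∈ nsp S a, (NP p (a : K)).index :=
      Finset.prod_lt_prod (fun _ _ => by norm_num) hge ⟨p, hp, lt_of_le_of_ne (hge p hp) (Ne.symm hne)⟩
    rw [← hQ, Finset.prod_const] at h5
    omega
  · intro b hb hbl
    have hbW : b ∈ W := SU_mono Finset.subset_union_left hb
    have h5 : (g.comp f).ker.index = ((norms (a : K)).subgroupOf W).index :=
      le_antisymm h3 (by change (norms (a : K)).relIndex W ≤ _; omega)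
    have h6 : (norms (a : K)).subgroupOf W = (g.comp f).ker := by
      have h7 := Subgroup.relIndex_mul_index hle
      rw [← h5] at h7
      have h8 : (g.comp f).ker.index ≠ 0 := by rw [h5]; exact hfi0
      have h9 : ((norms (a : K)).subgroupOf W).relIndex (g.comp f).ker = 1 := by
        apply Nat.eq_of_mul_eq_mul_right (Nat.pos_of_ne_zero h8)
        rw [h7, one_mul]
      exact le_antisymm hle (Subgroup.relIndex_eq_one.1 h9)
    have h7 : (⟨b, hbW⟩ : W) ∈ (g.comp f).ker := by
      rw [MonoidHom.mem_ker]
      funext p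
      exact (QuotientGroup.eq_one_iff _).2 (hbl p.1 p.2)
    rw [← h6] at h7
    exact Subgroup.mem_subgroupOf.1 h7

lemma sq_norms {a b : Kˣ} {r : K} (h : r ^ 2 = a) : b ∈ norms (a : K) := by
  have hr : r ≠ 0 := by
    rintro rfl
    exact a.ne_zero (by rw [← h]; simp)
  rw [mem_norms]
  refine ⟨(b + 1) / 2, (b - 1) / (2 * r), ?_⟩
  rw [← h]
  field_simp
  ring

/-- local index two -/
theorem local_index {a x y : Kˣ} (p : Place K) (hx : x ∉ NP p (a : K)) (hy : y ∉ NP p (a : K)) : x * y ∈ NP p (a : K) := by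
  classical
  have hap : a ∉ HP p := fun h => hx (by rw [NP_eq_top h]; trivial)
  have hns : ∀ r : K, r ^ 2 ≠ a := fun r hr => hx (norms_le_NP p _ (sq_norms hr))
  obtain ⟨S, hS, hSg⟩ := exists_good (supp a ∪ (match p with | .inl v => {v} | .inr _ => ∅))
  have h1 := (main_aux hSg (mem_SU_of_supp (Finset.subset_union_left.trans hS)) hns).1 p (by
    rw [mem_nsp]
    refine ⟨?_, hap⟩
    rcases p with v | p
    · simp only [Finset.inl_mem_disjSum]
      exact hS (by simp)
    · simp)
  rw [Subgroup.mul_mem_iff_of_index_two h1]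
  simp [hx, hy]

/-- Hasse norm theorem for quadratic extensions -/
theorem hasse {a b : Kˣ} (h : ∀ p : Place K, b ∈ NP p (a : K)) : b ∈ norms (a : K) := by
  classical
  by_cases hns : ∀ r : K, r ^ 2 ≠ a
  · obtain ⟨S, hS, hSg⟩ := exists_good (supp a ∪ supp b)
    exact (main_aux hSg (mem_SU_of_supp (Finset.subset_union_left.trans hS)) hns).2 b
      (mem_SU_of_supp (Finset.subset_union_right.trans hS)) fun p _ => h p
  · push Not at hns
    obtain ⟨r, hr⟩ := hns
    exact sq_norms hr

end Loc


set_option linter.unusedSectionVars false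
set_option linter.deprecated false
set_option linter.style.haveILetI false

open WithZero IsDedekindDomain NumberField

namespace Loc

variable {K : Type*} [Field K] [NumberField K]

section map
variable {L : Type*} [Field L] [NumberField L] [Algebra K L]

/-- restriction of places -/
noncomputable def dnP (K : Type*) [Field K] [NumberField K] {L : Type*} [Field L] [NumberField L] [Algebra K L] :
    Place L → Place K
  | .inl w => .inl (dn K w)
  | .inr p => .inr (p.comap (algebraMap K L))

lemma HP_map (P : Place L) {x : Kˣ} (h : x ∈ HP (dnP K P)) :
    Units.map (algebraMap K L).toMonoidHom x ∈ HP P := by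
  rcases P with w | p
  · exact H_map w h
  · intro hp
    have hp' : (p.comap (algebraMap K L)).IsReal := hp.comap _
    have h1 : 0 < InfinitePlace.embedding_of_isReal hp' x := h hp'
    have h2 : (InfinitePlace.embedding_of_isReal hp' x : ℂ) =
        (InfinitePlace.embedding_of_isReal hp (algebraMap K L x) : ℂ) := by
      rw [InfinitePlace.embedding_of_isReal_apply, InfinitePlace.embedding_of_isReal_apply]
      have h3 : ComplexEmbedding.IsReal (p.embedding.comp (algebraMap K L)) := by
        rw [InfinitePlace.isReal_iff] at hp
        exact hp.comp _
      have h4 : (p.comap (algebraMap K L)).embedding = p.embedding.comp (algebraMap K L) := by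
        conv_lhs => rw [← InfinitePlace.mk_embedding p, InfinitePlace.comap_mk]
        exact InfinitePlace.embedding_mk_eq_of_isReal h3
      rw [h4]; rfl
    rw [Complex.ofReal_inj] at h2
    rw [h2] at h1
    exact h1

lemma NP_map (P : Place L) {x a : Kˣ} (h : x ∈ NP (dnP K P) (a : K)) :
    Units.map (algebraMap K L).toMonoidHom x ∈ NP P (algebraMap K L a) := by
  obtain ⟨y, hy, z, hz, rfl⟩ := Subgroup.mem_sup.1 h
  rw [map_mul]
  refine mul_mem (norms_le_NP P _ ?_) (HP_le_NP P _ (HP_map P hz))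
  rw [mem_norms] at hy ⊢
  obtain ⟨r, s, hrs⟩ := hy
  refine ⟨algebraMap K L r, algebraMap K L s, ?_⟩
  simp [hrs]

end map

/-- ternary form isotropic or representing e -/
def Rep (a b e : K) : Prop :=
  ∃ x y z : K, (x ≠ 0 ∨ y ≠ 0 ∨ z ≠ 0) ∧
    (a * x ^ 2 + b * y ^ 2 - a * b * z ^ 2 = 0 ∨ a * x ^ 2 + b * y ^ 2 - a * b * z ^ 2 = e)

lemma rep_of_norm {a b : Kˣ} {e : K} (h : b ∈ norms (a : K)) : Rep (a : K) b e := by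
  obtain ⟨y, z, h⟩ := mem_norms.1 h
  refine ⟨b, a * z, y, Or.inl b.ne_zero, Or.inl ?_⟩
  linear_combination (a * b : K) * h

lemma rep_of_quad {L : Type*} [Field L] [NumberField L] [Algebra K L] {a b : Kˣ} {e : K} (Q : Quad K L e)
    (h : Units.map (algebraMap K L).toMonoidHom b ∈ norms (algebraMap K L a)) : Rep (a : K) b e := by
  obtain ⟨Y, Z, hYZ⟩ := mem_norms.1 h
  obtain ⟨y0, y1, rfl⟩ := Q.rep Y
  obtain ⟨z0, z1, rfl⟩ := Q.rep Z
  have hb : ((Units.map (algebraMap K L).toMonoidHom b : Lˣ) : L) = algebraMap K L b := rfl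
  rw [hb] at hYZ
  have h2 : algebraMap K L (y0 ^ 2 + e * y1 ^ 2 - a * z0 ^ 2 - a * e * z1 ^ 2 - b) +
      algebraMap K L (2 * (y0 * y1 - a * z0 * z1)) * Q.α = 0 := by
    simp only [map_add, map_sub, map_mul, map_pow, map_ofNat]
    linear_combination -hYZ + (algebraMap K L a * algebraMap K L z1 ^ 2 - algebraMap K L y1 ^ 2) * Q.sq
  have h4 := congrArg Q.nm h2
  rw [Q.nm_rep] at h4
  have h5 : Q.nm 0 = 0 := by
    have := Q.nm_rep 0 0
    simpa using this
  rw [h5] at h4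
  have h6 : 2 * (y0 * y1 - a * z0 * z1) = 0 := by
    by_contra h7
    refine Q.ns ((y0 ^ 2 + e * y1 ^ 2 - a * z0 ^ 2 - a * e * z1 ^ 2 - b) / (2 * (y0 * y1 - a * z0 * z1))) ?_
    rw [div_pow, div_eq_iff (pow_ne_zero 2 h7)]
    linear_combination h4
  rw [h6] at h4
  have h7 : y0 ^ 2 + e * y1 ^ 2 - a * z0 ^ 2 - a * e * z1 ^ 2 - b = 0 := by simpa using h4
  have h8 : y0 * y1 - a * z0 * z1 = 0 := by simpa using h6
  by_cases hu : y1 ^ 2 - a * z1 ^ 2 = 0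
  · by_cases hz : z1 = 0
    · have hy : y1 = 0 := by rw [hz] at hu; simpa using hu
      subst hz hy
      apply rep_of_norm
      rw [mem_norms]
      exact ⟨y0, z0, by linear_combination -h7⟩
    · refine ⟨0, y1 / z1, 1, by simp, Or.inl ?_⟩
      field_simp
      linear_combination (b : K) * hu
  · refine ⟨(y1 * z0 - z1 * y0) / (y1 ^ 2 - a * z1 ^ 2), y1 / (y1 ^ 2 - a * z1 ^ 2), z1 / (y1 ^ 2 - a * z1 ^ 2), ?_, Or.inr ?_⟩
    · by_contra hcon
      push Not at hcon
      apply hu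
      have e1 : y1 = 0 := by simpa [hu] using hcon.2.1
      have e2 : z1 = 0 := by simpa [hu] using hcon.2.2
      rw [e1, e2]; simp
    · field_simp
      linear_combination (-(y1 ^ 2 - a * z1 ^ 2)) * h7 + (y0 * y1 - a * z0 * z1) * h8

lemma exists_notMem_two {G : Type*} [Group G] (A B : Subgroup G) :
    ∃ x, (A ≠ ⊤ → x ∉ A) ∧ (B ≠ ⊤ → x ∉ B) := by
  by_cases hA : A = ⊤
  · by_cases hB : B = ⊤
    · exact ⟨1, by simp [hA], by simp [hB]⟩
    · obtain ⟨x, -, hx⟩ := SetLike.exists_of_lt (lt_top_iff_ne_top.2 hB)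
      exact ⟨x, by simp [hA], fun _ => hx⟩
  · obtain ⟨x, -, hx⟩ := SetLike.exists_of_lt (lt_top_iff_ne_top.2 hA)
    by_cases hB : B = ⊤
    · exact ⟨x, fun _ => hx, by simp [hB]⟩
    · obtain ⟨y, -, hy⟩ := SetLike.exists_of_lt (lt_top_iff_ne_top.2 hB)
      by_cases hxB : x ∈ B
      · by_cases hyA : y ∈ A
        · refine ⟨x * y, fun _ h => hx ?_, fun _ h => hy ?_⟩
          · exact (Subgroup.mul_mem_cancel_right _ hyA).1 h
          · exact (Subgroup.mul_mem_cancel_left _ hxB).1 h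
        · exact ⟨y, fun _ => hyA, fun _ => hy⟩
      · exact ⟨x, fun _ => hx, fun _ => hxB⟩

/-- key: one slot -/
lemma rep_of_local {a b e : Kˣ} (S : Finset (Pl K)) (h2 : ∀ v ∉ S, vl v (2 : K) = 1) (ha : a ∈ SU S) (hb : b ∈ SU S)
    (he : ∀ p ∈ S.disjSum (Finset.univ : Finset (InfinitePlace K)), NP p (a : K) ≠ ⊤ → e ∉ NP p (a : K)) :
    Rep (a : K) b e := by
  by_cases hns : ∀ r : K, r ^ 2 ≠ e
  · obtain ⟨L, _, _, _, ⟨Q⟩⟩ := exists_quad (e : K) hns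
    apply rep_of_quad Q
    have key := hasse (K := L) (a := Units.map (algebraMap K L).toMonoidHom a)
      (b := Units.map (algebraMap K L).toMonoidHom b) (fun P => ?_)
    · exact key
    change _ ∈ NP P (algebraMap K L a)
    by_cases hP : dnP K P ∈ S.disjSum (Finset.univ : Finset (InfinitePlace K))
    · by_cases hbN : b ∈ NP (dnP K P) (a : K)
      · exact NP_map P hbN
      · have h1 : e ∉ NP (dnP K P) (a : K) := he _ hP (fun h => hbN (by rw [h]; trivial))
        have h3 := NP_map P (local_index _ hbN h1)
        rw [map_mul] at h3
        refine (Subgroup.mul_mem_cancel_right _ (HP_le_NP P _ ?_)).1 h3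
        have : Units.map (algebraMap K L).toMonoidHom e = (Units.mk0 Q.α Q.ne_zero) ^ 2 := by
          ext; simp [Q.sq]
        rw [this]; exact sq_mem_HP _ _
    · rcases P with w | p
      · have hw : dn K w ∉ S := by simpa [dnP] using hP
        refine mem_N_of_even (a := Units.map (algebraMap K L).toMonoidHom a) (good w) ?_ ⟨0, ?_⟩ ⟨0, ?_⟩
        · rw [← map_ofNat (algebraMap K L) 2, dn_eq_one]; exact h2 _ hw
        · simpa using (dn_eq_one w (a : K)).2 (ha _ hw)
        · simpa using (dn_eq_one w (b : K)).2 (hb _ hw)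
      · exact absurd (by simp [dnP]) hP
  · push Not at hns
    obtain ⟨r, hr⟩ := hns
    apply rep_of_norm
    apply hasse
    intro p
    by_cases hp : p ∈ S.disjSum (Finset.univ : Finset (InfinitePlace K))
    · by_contra hbN
      apply he p hp (fun h => hbN (by rw [h]; trivial))
      apply HP_le_NP
      have hr0 : r ≠ 0 := by
        rintro rfl
        exact e.ne_zero (by rw [← hr]; simp)
      have : e = (Units.mk0 r hr0) ^ 2 := by ext; simp [hr]
      rw [this]; exact sq_mem_HP _ _
    · rcases p with v | p
      · have hv : v ∉ S := by simpa using hp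
        exact mem_N_of_even (good v) (h2 v hv) ⟨0, by simpa using ha v hv⟩ ⟨0, by simpa using hb v hv⟩
      · exact absurd (by simp) hp

/-- isotropy of Albert forms -/
theorem albert (a b c d : K) (ha : a ≠ 0) (hb : b ≠ 0) (hc : c ≠ 0) (hd : d ≠ 0) :
    ∃ x y z x' y' z' : K, (x ≠ 0 ∨ y ≠ 0 ∨ z ≠ 0 ∨ x' ≠ 0 ∨ y' ≠ 0 ∨ z' ≠ 0) ∧
      a * x ^ 2 + b * y ^ 2 - a * b * z ^ 2 = c * x' ^ 2 + d * y' ^ 2 - c * d * z' ^ 2 := by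
  classical
  lift a to Kˣ using ha.isUnit
  lift b to Kˣ using hb.isUnit
  lift c to Kˣ using hc.isUnit
  lift d to Kˣ using hd.isUnit
  set S := supp a ∪ supp b ∪ supp c ∪ supp d ∪ supp (Units.mk0 (2 : K) two_ne_zero) with hS
  choose x hx1 hx2 using fun p : Place K => exists_notMem_two (NP p (a : K)) (NP p (c : K))
  obtain ⟨e, he⟩ := weak_approx' S x
  have h2 : ∀ v ∉ S, vl v (2 : K) = 1 := mem_SU_of_supp (x := Units.mk0 (2 : K) two_ne_zero) (S := S)
    (by intro y hy; simp [hS, hy])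
  have hstab : ∀ (f : Kˣ) (p : Place K), e / x p ∈ HP p → x p ∉ NP p (f : K) → e ∉ NP p (f : K) := by
    intro f p h1 h3 h4
    apply h3
    have : x p = e / (e / x p) := by rw [div_div_cancel]
    rw [this]
    exact div_mem h4 (HP_le_NP _ _ h1)
  obtain ⟨x1, y1, z1, hn, h⟩ : Rep (a : K) b e := rep_of_local S h2
    (mem_SU_of_supp (by intro y hy; simp [hS, hy])) (mem_SU_of_supp (by intro y hy; simp [hS, hy]))
    (fun p hp ht => hstab a p (he p hp) (hx1 p ht))
  obtain ⟨x2, y2, z2, hn', h'⟩ : Rep (c : K) d e := rep_of_local S h2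
    (mem_SU_of_supp (by intro y hy; simp [hS, hy])) (mem_SU_of_supp (by intro y hy; simp [hS, hy]))
    (fun p hp ht => hstab c p (he p hp) (hx2 p ht))
  rcases h with h | h
  · exact ⟨x1, y1, z1, 0, 0, 0, by tauto, by rw [h]; simp⟩
  rcases h' with h' | h'
  · exact ⟨0, 0, 0, x2, y2, z2, by tauto, by rw [h']; simp⟩
  · exact ⟨x1, y1, z1, x2, y2, z2, by tauto, by rw [h, h']⟩

end Loc

set_option linter.unusedSectionVars false
set_option linter.deprecated false
set_option linter.style.haveILetI false
namespace Alg
open TensorProduct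

def Cen (K D : Type*) [Field K] [Ring D] [Algebra K D] : Prop :=
  ∀ z : D, (∀ y, z * y = y * z) → ∃ k : K, z = algebraMap K D k

section
variable {K D : Type*} [Field K] [DivisionRing D] [Algebra K D]

open Classical in
lemma inj_aux (hc : Cen K D) {ι : Type*} [Fintype ι] [DecidableEq ι] (b : ι → D)
    (hb : LinearIndependent K b) :
    ∀ n : ℕ, ∀ q : ι → D, (Finset.univ.filter fun i => q i ≠ 0).card ≤ n →
      (∀ x, ∑ i, b i * x * q i = 0) → q = 0 := by
  classical
  intro n
  induction n with
  | zero =>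
    intro q hq _
    funext i
    by_contra h
    have := Finset.card_eq_zero.mp (Nat.le_zero.mp hq)
    have h2 : i ∈ (Finset.univ.filter fun i => q i ≠ 0) := by simpa using h
    rw [this] at h2
    simp at h2
  | succ n ih =>
    intro q hq h
    by_contra hne
    obtain ⟨i0, hi0⟩ : ∃ i, q i ≠ 0 := by
      by_contra hcon
      push Not at hcon
      exact hne (funext hcon)
    set p : ι → D := fun i => q i * (q i0)⁻¹ with hp
    have hp0 : p i0 = 1 := by simp [hp, hi0]
    have hpz : ∀ x, ∑ i, b i * x * p i = 0 := by
      intro x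
      have := congrArg (· * (q i0)⁻¹) (h x)
      simpa [Finset.sum_mul, hp, mul_assoc] using this
    have hcom : ∀ y, (fun i => y * p i - p i * y) = 0 := by
      intro y
      apply ih
      · have hlt : (Finset.univ.filter fun i => y * p i - p i * y ≠ 0) ⊂
            (Finset.univ.filter fun i => q i ≠ 0) := by
          rw [Finset.ssubset_iff_of_subset]
          · exact ⟨i0, by simpa using hi0, by simp [hp0]⟩
          · intro i
            simp only [Finset.mem_filter, Finset.mem_univ, true_and]
            intro hi hqi
            apply hi
            simp [hp, hqi]
        have := Finset.card_lt_card hlt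
        omega
      · intro x
        have h1 := hpz (x * y)
        have h2 := congrArg (· * y) (hpz x)
        simp only [Finset.sum_mul, zero_mul] at h2
        calc ∑ i, b i * x * (y * p i - p i * y) = ∑ i, b i * (x * y) * p i - ∑ i, b i * x * p i * y := by
              rw [← Finset.sum_sub_distrib]
              refine Finset.sum_congr rfl fun i _ => ?_
              noncomm_ring
          _ = 0 := by rw [h1, h2, sub_zero]
    have hk : ∀ i, ∃ k : K, p i = algebraMap K D k := by
      intro i
      apply hc
      intro y
      have := congrFun (hcom y) i
      simp only [Pi.zero_apply] at this
      exact (sub_eq_zero.mp this).symm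
    choose k hk using hk
    have h1 := hpz 1
    have h2 : ∑ i, k i • b i = 0 := by
      rw [← h1]
      refine Finset.sum_congr rfl fun i _ => ?_
      rw [hk i, mul_one, Algebra.smul_def, Algebra.commutes]
    have h3 := Fintype.linearIndependent_iff.mp hb k h2 i0
    have := hk i0
    rw [hp0, h3, map_zero] at this
    exact one_ne_zero this

/-- `(q_i) ↦ (x ↦ ∑ b_i x q_i)` -/
noncomputable def lr {ι : Type*} [Fintype ι] (b : ι → D) : (ι → D) →ₗ[K] Module.End K D :=
  ∑ i, (LinearMap.llcomp K D D D).flip (LinearMap.mulLeft K (b i)) ∘ₗ (LinearMap.mul K D).flip ∘ₗ LinearMap.proj i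

lemma lr_apply {ι : Type*} [Fintype ι] (b : ι → D) (q : ι → D) (x : D) :
    lr (K := K) b q x = ∑ i, b i * x * q i := by
  simp [lr, LinearMap.sum_apply]

lemma lr_bij [FiniteDimensional K D] (hc : Cen K D) {ι : Type*} [Fintype ι] (b : Module.Basis ι K D) :
    Function.Bijective (lr (K := K) (b : ι → D)) := by
  classical
  have hinj : Function.Injective (lr (K := K) (b : ι → D)) := by
    rw [injective_iff_map_eq_zero]
    intro q hq
    refine inj_aux hc (b : ι → D) b.linearIndependent _ q le_rfl fun x => ?_
    rw [← lr_apply (K := K), hq]; rfl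
  refine ⟨hinj, ?_⟩
  rw [← LinearMap.injective_iff_surjective_of_finrank_eq_finrank]
  · exact hinj
  · rw [Module.finrank_pi_fintype, Module.finrank_linearMap, Finset.sum_const, Finset.card_univ,
      ← Module.finrank_eq_card_basis b, smul_eq_mul]

lemma span_lr [FiniteDimensional K D] (hc : Cen K D) (f : D →ₗ[K] D) :
    ∃ (n : ℕ) (p q : Fin n → D), ∀ x, f x = ∑ i, p i * x * q i := by
  obtain ⟨q, hq⟩ := (lr_bij hc (Module.finBasis K D)).2 f
  exact ⟨_, Module.finBasis K D, q, fun x => by rw [← hq, lr_apply]⟩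

/-- Skolem--Noether for automorphisms -/
lemma skolem [FiniteDimensional K D] (hc : Cen K D) (φ : D →ₐ[K] D) :
    ∃ w : D, w ≠ 0 ∧ ∀ b, b * w = w * φ b := by
  set B := Module.finBasis K D
  obtain ⟨q, hq⟩ := (lr_bij hc B).2 φ.toLinearMap
  have hq' : ∀ x, φ x = ∑ i, B i * x * q i := fun x => by
    rw [← lr_apply (K := K), hq]; rfl
  obtain ⟨i, hi⟩ : ∃ i, q i ≠ 0 := by
    by_contra hcon
    push Not at hcon
    have := hq' 1
    simp [hcon] at this
  refine ⟨q i, hi, fun b => ?_⟩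
  have : (fun i => b * q i) = fun i => q i * φ b := by
    apply (lr_bij hc B).1
    ext x
    rw [lr_apply, lr_apply]
    have h1 := hq' (x * b)
    rw [map_mul, hq' x, Finset.sum_mul] at h1
    simp only [mul_assoc] at h1 ⊢
    exact h1.symm
  exact congrFun this i

end

section
variable {K D : Type*} [Field K] [DivisionRing D] [Algebra K D] [FiniteDimensional K D]
variable (L : Type*) [Field L] [Algebra K L]

lemma exists_basis_one : ∃ (B : Module.Basis (Fin (Module.finrank K D)) K D) (i : Fin (Module.finrank K D)), B i = 1 := by
  have h1 : LinearIndepOn K id ({1} : Set D) := by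
    rw [linearIndepOn_singleton_iff]; exact one_ne_zero
  let B0 := Module.Basis.extend h1
  have hm : (1 : D) ∈ h1.extend (Set.subset_univ _) := h1.subset_extend _ rfl
  have : Finite (h1.extend (Set.subset_univ _)) := Module.Finite.finite_basis B0
  have := Fintype.ofFinite (h1.extend (Set.subset_univ _))
  let e := Fintype.equivFinOfCardEq (Module.finrank_eq_card_basis B0).symm
  refine ⟨B0.reindex e, e ⟨1, hm⟩, ?_⟩
  simp [B0, Module.Basis.reindex_apply]

lemma exists_functional (z : L ⊗[K] D) (hz : z ≠ 0) :
    ∃ (f : D →ₗ[K] D) (l : L), l ≠ 0 ∧ LinearMap.lTensor L f z = l ⊗ₜ 1 := by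
  let B := Module.finBasis K D
  let B' := Algebra.TensorProduct.basis L B
  obtain ⟨i, hi⟩ : ∃ i, B'.repr z i ≠ 0 := by
    by_contra hcon
    push Not at hcon
    apply hz
    apply B'.repr.injective
    ext i
    simp [hcon i]
  refine ⟨(LinearMap.toSpanSingleton K D 1).comp (B.coord i), B'.repr z i, hi, ?_⟩
  clear hi hz
  induction z using TensorProduct.induction_on with
  | zero => simp
  | add x y hx hy => rw [map_add, hx, hy, map_add, Finsupp.add_apply, TensorProduct.add_tmul]
  | tmul a d =>
    simp only [LinearMap.lTensor_tmul, B', Algebra.TensorProduct.basis_repr_tmul]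
    simp [Algebra.smul_def]
    rw [mul_comm, ← Algebra.smul_def, TensorProduct.smul_tmul, Algebra.smul_def, mul_one]

lemma lTensor_eq (f : D →ₗ[K] D) {n : ℕ} {p q : Fin n → D} (h : ∀ x, f x = ∑ i, p i * x * q i)
    (z : L ⊗[K] D) : LinearMap.lTensor L f z = ∑ i, (1 ⊗ₜ p i) * z * (1 ⊗ₜ q i) := by
  induction z using TensorProduct.induction_on with
  | zero => simp
  | add x y hx hy => rw [map_add, hx, hy, ← Finset.sum_add_distrib]; simp [mul_add, add_mul]
  | tmul a d => simp [h, TensorProduct.tmul_sum]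

lemma simple_tensor (hc : Cen K D) : IsSimpleRing (L ⊗[K] D) := by
  apply IsSimpleRing.of_eq_bot_or_eq_top
  intro I
  by_cases hI : I = ⊥
  · exact Or.inl hI
  · right
    obtain ⟨z, hzI, hz⟩ : ∃ z ∈ I, z ≠ 0 := by
      by_contra hcon
      push Not at hcon
      apply hI
      rw [eq_bot_iff]
      intro z hz
      rw [TwoSidedIdeal.mem_bot]
      exact hcon z hz
    obtain ⟨f, l, hl, hf⟩ := exists_functional L z hz
    obtain ⟨n, p, q, hpq⟩ := span_lr hc f
    rw [lTensor_eq L f hpq] at hf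
    have h1 : (l ⊗ₜ 1 : L ⊗[K] D) ∈ I := by
      rw [← hf]
      exact sum_mem fun i _ => I.mul_mem_right _ _ (I.mul_mem_left _ _ hzI)
    have h2 := I.mul_mem_left (l⁻¹ ⊗ₜ 1) _ h1
    rw [Algebra.TensorProduct.tmul_mul_tmul, inv_mul_cancel₀ hl, one_mul] at h2
    rw [eq_top_iff]
    intro x _
    have := I.mul_mem_left x _ h2
    rwa [← Algebra.TensorProduct.one_def, mul_one] at this

lemma cen_tensor (hc : Cen K D) : Cen L (L ⊗[K] D) := by
  intro z hz
  obtain ⟨B, i, hi⟩ := exists_basis_one (K := K) (D := D)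
  set f : D →ₗ[K] D := (LinearMap.toSpanSingleton K D 1).comp (B.coord i) with hf
  have hf1 : f 1 = 1 := by simp [hf, ← hi]
  obtain ⟨n, p, q, hpq⟩ := span_lr hc f
  have h1 := lTensor_eq L f hpq z
  have h2 : ∑ i, ((1 : L) ⊗ₜ[K] p i) * z * (1 ⊗ₜ q i) = z := by
    calc _ = z * ∑ i, ((1 : L) ⊗ₜ[K] (p i * q i)) := by
          rw [Finset.mul_sum]
          refine Finset.sum_congr rfl fun i _ => ?_
          rw [← hz, mul_assoc, Algebra.TensorProduct.tmul_mul_tmul, one_mul]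
      _ = z := by
          rw [← TensorProduct.tmul_sum]
          have := hpq 1
          simp only [mul_one, hf1] at this
          rw [← this, ← Algebra.TensorProduct.one_def, mul_one]
  rw [h2] at h1
  have h3 : ∀ z : L ⊗[K] D, ∃ l : L, LinearMap.lTensor L f z = algebraMap L _ l := by
    intro z
    induction z using TensorProduct.induction_on with
    | zero => exact ⟨0, by simp⟩
    | add x y hx hy =>
      obtain ⟨a, ha⟩ := hx
      obtain ⟨b, hb⟩ := hy
      exact ⟨a + b, by rw [map_add, ha, hb, map_add]⟩
    | tmul a d =>
      refine ⟨B.coord i d • a, ?_⟩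
      simp [hf, Algebra.TensorProduct.algebraMap_apply, TensorProduct.smul_tmul]
  obtain ⟨l, hl⟩ := h3 z
  exact ⟨l, by rw [← hl, h1]⟩

end

/-- dimension divisibility -/
lemma divdim {K D V : Type*} [Field K] [DivisionRing D] [Algebra K D] [FiniteDimensional K D]
    [AddCommGroup V] [Module K V] (φ : D →ₐ[K] Module.End K V) :
    Module.finrank K D ∣ Module.finrank K V := by
  letI : Module D V := Module.compHom V φ.toRingHom
  have hs : ∀ (d : D) (v : V), d • v = φ d v := fun _ _ => rfl
  haveI : IsScalarTower K D V := ⟨fun k d v => by rw [hs, hs, map_smul]; rfl⟩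
  exact ⟨_, (Module.finrank_mul_finrank K D V).symm⟩

end Alg

set_option linter.unusedSectionVars false
set_option linter.deprecated false
set_option linter.style.haveILetI false
namespace Alg
open TensorProduct

/-- existence of an anti-automorphism -/
def Anti (K D : Type*) [Field K] [Ring D] [Algebra K D] : Prop :=
  ∃ τ : D →ₗ[K] D, τ 1 = 1 ∧ ∀ x y, τ (x * y) = τ y * τ x

/-- existence of an involution -/
def Inv (K D : Type*) [Field K] [Ring D] [Algebra K D] : Prop :=
  ∃ τ : D →ₗ[K] D, τ 1 = 1 ∧ (∀ x y, τ (x * y) = τ y * τ x) ∧ ∀ x, τ (τ x) = x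

lemma sq_of_trace {K V : Type*} [Field K] [CharZero K] [AddCommGroup V] [Module K V]
    [FiniteDimensional K V] (γ : V →ₗ[K] V) (l : K) (h : ∀ x, γ (γ x) = l • x)
    (ht : LinearMap.trace K V γ ≠ 0) : ∃ m : K, m ^ 2 = l := by
  let A := AlgebraicClosure K
  obtain ⟨s, hs⟩ := IsAlgClosed.exists_pow_nat_eq (algebraMap K A l) (n := 2) (by norm_num)
  let g := γ.baseChange A
  have hg : ∀ x, g (g x) = (algebraMap K A l) • x := by
    intro x
    induction x using TensorProduct.induction_on with
    | zero => simp
    | add x y hx hy => rw [map_add, map_add, hx, hy, smul_add]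
    | tmul a d => simp [g, h, TensorProduct.smul_tmul']
  have hroots : ∀ μ ∈ g.charpoly.roots, μ = s ∨ μ = -s := by
    intro μ hμ
    have h1 := Polynomial.isRoot_of_mem_roots hμ
    rw [← Module.End.hasEigenvalue_iff_isRoot_charpoly] at h1
    obtain ⟨v, hv⟩ := h1.exists_hasEigenvector
    have h2 := hv.apply_eq_smul
    have h3 := hg v
    rw [h2, map_smul, h2, smul_smul] at h3
    have h4 := smul_left_injective A hv.2 h3
    rw [← hs] at h4
    exact sq_eq_sq_iff_eq_or_eq_neg.mp (by rw [pow_two]; exact h4)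
  have hsum : ∀ m : Multiset A, (∀ μ ∈ m, μ = s ∨ μ = -s) → ∃ k : ℤ, m.sum = k * s := by
    intro m
    induction m using Multiset.induction with
    | empty => intro _; exact ⟨0, by simp⟩
    | cons a m ih =>
      intro hm
      obtain ⟨k, hk⟩ := ih fun μ hμ => hm μ (Multiset.mem_cons_of_mem hμ)
      rcases hm a (Multiset.mem_cons_self a m) with h | h
      · exact ⟨k + 1, by rw [Multiset.sum_cons, hk, h]; push_cast; ring⟩
      · exact ⟨k - 1, by rw [Multiset.sum_cons, hk, h]; push_cast; ring⟩
  obtain ⟨k, hk⟩ := hsum _ hroots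
  have htr : LinearMap.trace A _ g = algebraMap K A (LinearMap.trace K V γ) := LinearMap.trace_baseChange ..
  rw [Module.End.trace_eq_sum_roots_charpoly_of_splits (IsAlgClosed.splits _), hk] at htr
  have hk0 : (k : K) ≠ 0 := by
    intro h0
    have : k = 0 := by exact_mod_cast h0
    rw [this] at htr
    simp only [Int.cast_zero, zero_mul] at htr
    exact ht ((map_eq_zero _).mp htr.symm)
  refine ⟨LinearMap.trace K V γ / k, ?_⟩
  apply (algebraMap K A).injective
  rw [map_pow, map_div₀, ← htr, map_intCast, ← hs, mul_div_cancel_left₀]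
  intro h0
  apply hk0
  apply (algebraMap K A).injective
  rw [map_intCast, h0, map_zero]

section
variable {K D : Type*} [Field K] [CharZero K] [DivisionRing D] [Algebra K D] [FiniteDimensional K D]

lemma anti_inj {τ : D →ₗ[K] D} (h1 : τ 1 = 1) (hm : ∀ x y, τ (x * y) = τ y * τ x) :
    Function.Injective τ := by
  rw [injective_iff_map_eq_zero]
  intro x hx
  by_contra h0
  have := hm x x⁻¹
  rw [mul_inv_cancel₀ h0, h1, hx, mul_zero] at this
  exact one_ne_zero this

lemma trace_ne_zero (hc : Cen K D) (T : D →ₗ[K] K) (hT : T ≠ 0) (hT2 : ∀ x y, T (x * y) = T (y * x)) :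
    T 1 ≠ 0 := by
  intro h0
  let ℓ : D →ₗ[K] K := T
  obtain ⟨n, p, q, hpq⟩ := span_lr hc ((LinearMap.toSpanSingleton K D 1).comp ℓ)
  have key : ∀ S : D →ₗ[K] K, (∀ x y, S (x * y) = S (y * x)) → ∀ x, ℓ x * S 1 = S ((∑ i, q i * p i) * x) := by
    intro S hS x
    have := congrArg S (hpq x)
    rw [map_sum] at this
    rw [Finset.sum_mul, map_sum]
    simp only [LinearMap.coe_comp, Function.comp_apply, LinearMap.toSpanSingleton_apply, map_smul, smul_eq_mul] at this
    rw [this]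
    refine Finset.sum_congr rfl fun i _ => ?_
    rw [hS, mul_assoc]
  have hz : ∑ i, q i * p i = 0 := by
    by_contra hz
    apply hT
    ext y
    have := key T hT2 ((∑ i, q i * p i)⁻¹ * y)
    rw [h0, mul_zero, mul_inv_cancel_left₀ hz] at this
    rw [← this]; rfl
  let t : D →ₗ[K] K := (LinearMap.trace K D).comp (LinearMap.mul K D)
  have ht : ∀ x, t x = LinearMap.trace K D (LinearMap.mulLeft K x) := fun x => rfl
  apply hT
  ext x
  have := key t (by
    intro x y
    rw [ht, ht, LinearMap.mulLeft_mul, LinearMap.mulLeft_mul]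
    exact LinearMap.trace_mul_comm K _ _) x
  rw [hz, zero_mul, map_zero, ht 1, LinearMap.mulLeft_one, LinearMap.trace_id] at this
  have hf : (Module.finrank K D : K) ≠ 0 := by
    exact_mod_cast Module.finrank_pos.ne'
  simpa [hf] using this

theorem inv_of_anti (hc : Cen K D) (h : Anti K D) : Inv K D := by
  obtain ⟨τ, h1, hm⟩ := h
  have hinj := anti_inj h1 hm
  have hsurj : Function.Surjective τ := LinearMap.injective_iff_surjective.mp hinj
  let φ : D →ₐ[K] D := AlgHom.ofLinearMap (τ ∘ₗ τ) (by simp [h1]) (by intro x y; simp [hm])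
  obtain ⟨w, hw0, hw⟩ := skolem hc φ
  have hw' : ∀ b, b * w = w * τ (τ b) := hw
  have hww : τ (τ w) = w := mul_left_cancel₀ hw0 (hw' w).symm
  have hcw : ∀ c, τ w * c = τ (τ c) * τ w := by
    intro c
    obtain ⟨b, rfl⟩ := hsurj c
    rw [← hm, hw' b, hm]
  obtain ⟨l, hl⟩ := hc (w * τ w) (by
    intro y
    rw [mul_assoc, hcw, ← mul_assoc, ← hw', mul_assoc])
  let γ : D →ₗ[K] D := LinearMap.mulLeft K w ∘ₗ τ
  have hγ : ∀ x, γ x = w * τ x := fun x => rfl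
  have hγ2 : ∀ x, γ (γ x) = l • x := by
    intro x
    rw [hγ, hγ, hm, ← mul_assoc, ← hw', mul_assoc, hl, Algebra.smul_def, Algebra.commutes]
  let T : D →ₗ[K] K := (LinearMap.trace K D).comp
    ((LinearMap.llcomp K D D D).flip τ ∘ₗ (LinearMap.mul K D))
  have hT : ∀ p, T p = LinearMap.trace K D (LinearMap.mulLeft K p * τ) := fun p => rfl
  have hT2 : ∀ p q, T (p * τ (τ q)) = T (q * p) := by
    intro p q
    have e1 : LinearMap.mulLeft K (p * τ (τ q)) * τ = (LinearMap.mulLeft K p * τ) * (LinearMap.mulRight K (τ q)) := by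
      ext x; simp [hm, mul_assoc]
    have e2 : (LinearMap.mulRight K (τ q)) * (LinearMap.mulLeft K p * τ) = (LinearMap.mulLeft K p * τ) * (LinearMap.mulLeft K q) := by
      ext x; simp [hm, mul_assoc]
    have e3 : (LinearMap.mulLeft K q) * (LinearMap.mulLeft K p * τ) = LinearMap.mulLeft K (q * p) * τ := by
      ext x; simp [mul_assoc]
    rw [hT, hT, e1, LinearMap.trace_mul_comm, e2, LinearMap.trace_mul_comm, e3]
  let T' : D →ₗ[K] K := T ∘ₗ LinearMap.mulLeft K w
  have hT' : ∀ p, T' p = T (w * p) := fun p => rfl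
  have hT'2 : ∀ x y, T' (x * y) = T' (y * x) := by
    intro x y
    have h3 : τ (τ (w * x * w⁻¹)) = x := by
      apply mul_left_cancel₀ hw0
      rw [← hw', mul_assoc, inv_mul_cancel₀ hw0, mul_one]
    have := hT2 (w * y) (w * x * w⁻¹)
    rw [h3] at this
    rw [hT', hT', ← mul_assoc w y x, this]
    congr 1
    rw [mul_assoc (w * x), inv_mul_cancel_left₀ hw0, mul_assoc]
  have hTne : T ≠ 0 := by
    intro hT0
    let τe : D ≃ₗ[K] D := LinearEquiv.ofBijective τ ⟨hinj, hsurj⟩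
    have hall : ∀ f : D →ₗ[K] D, LinearMap.trace K D (f * τ) = 0 := by
      intro f
      obtain ⟨n, p, q, hpq⟩ := span_lr hc f
      have hf : f * τ = ∑ i, (LinearMap.mulRight K (q i) * (LinearMap.mulLeft K (p i) * τ)) := by
        ext x
        simp [hpq, LinearMap.sum_apply]
      rw [hf, map_sum]
      refine Finset.sum_eq_zero fun i _ => ?_
      have e1 : (LinearMap.mulLeft K (p i) * τ) * LinearMap.mulRight K (q i) = LinearMap.mulLeft K (p i * τ (q i)) * τ := by
        ext x; simp [hm, mul_assoc]
      rw [LinearMap.trace_mul_comm, e1, ← hT, hT0]; rfl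
    have h2 := hall ((τe.symm : D →ₗ[K] D))
    have h3 : (τe.symm : D →ₗ[K] D) * τ = LinearMap.id := by
      ext x
      exact τe.symm_apply_apply x
    rw [h3, LinearMap.trace_id] at h2
    exact Module.finrank_pos.ne' (by exact_mod_cast h2)
  have hT'ne : T' ≠ 0 := by
    intro h0
    apply hTne
    ext x
    have := LinearMap.congr_fun h0 (w⁻¹ * x)
    rw [hT', mul_inv_cancel_left₀ hw0] at this
    exact this
  have htr : LinearMap.trace K D γ ≠ 0 := by
    have := trace_ne_zero hc T' hT'ne hT'2
    rw [hT', mul_one] at this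
    exact this
  obtain ⟨μ, hμ⟩ := sq_of_trace γ l hγ2 htr
  have hl0 : l ≠ 0 := by
    rintro rfl
    rw [map_zero] at hl
    rcases mul_eq_zero.mp hl with h | h
    · exact hw0 h
    · exact hw0 (hinj (by rw [h, map_zero]))
  have hμ0 : μ ≠ 0 := by rintro rfl; apply hl0; rw [← hμ]; simp
  -- eigenvector
  obtain ⟨y, ν, hy0, hν0, hy⟩ : ∃ (y : D) (ν : K), y ≠ 0 ∧ ν ≠ 0 ∧ w * τ y = ν • y := by
    by_cases hcase : γ 1 + μ • 1 = 0
    · refine ⟨1, -μ, one_ne_zero, neg_ne_zero.mpr hμ0, ?_⟩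
      rw [← hγ, eq_neg_of_add_eq_zero_left hcase, neg_smul]
    · refine ⟨γ 1 + μ • 1, μ, hcase, hμ0, ?_⟩
      rw [← hγ, map_add, hγ2, map_smul, smul_add, smul_smul, ← pow_two, hμ, add_comm]
  have hτy : τ y ≠ 0 := fun h => hy0 (hinj (by rw [h, map_zero]))
  refine ⟨LinearMap.mulRight K y⁻¹ ∘ₗ LinearMap.mulLeft K y ∘ₗ τ, by simp [h1, hy0], ?_, ?_⟩
  · intro a b
    simp only [LinearMap.coe_comp, Function.comp_apply, LinearMap.mulRight_apply, LinearMap.mulLeft_apply, hm]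
    rw [mul_assoc (y * τ b), ← mul_assoc y⁻¹, ← mul_assoc y⁻¹, inv_mul_cancel₀ hy0, one_mul]
    simp only [mul_assoc]
  · intro x
    simp only [LinearMap.coe_comp, Function.comp_apply, LinearMap.mulRight_apply, LinearMap.mulLeft_apply, hm]
    have hinvτ : τ y⁻¹ = (τ y)⁻¹ := by
      apply eq_inv_of_mul_eq_one_left
      rw [← hm, mul_inv_cancel₀ hy0, h1]
    have e1 : τ y = ν • (w⁻¹ * y) := by
      apply mul_left_cancel₀ hw0
      rw [hy, mul_smul_comm, mul_inv_cancel_left₀ hw0]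
    have e2 : τ (τ x) = w⁻¹ * x * w := by
      apply mul_left_cancel₀ hw0
      rw [← hw', mul_assoc, mul_inv_cancel_left₀ hw0]
    have e3 : y * (τ y)⁻¹ = ν⁻¹ • w := by
      rw [mul_inv_eq_iff_eq_mul₀ hτy, e1, smul_mul_smul_comm, inv_mul_cancel₀ hν0, one_smul,
        mul_inv_cancel_left₀ hw0]
    rw [hinvτ, e2, ← mul_assoc, e3, e1]
    simp only [mul_assoc, smul_mul_assoc, mul_smul_comm, smul_smul]
    rw [mul_inv_cancel₀ hν0, one_smul, mul_inv_cancel₀ hy0, mul_one, mul_inv_cancel_left₀ hw0,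
      mul_inv_cancel₀ hw0, mul_one]

lemma natDegree_dvd (s : D) : (minpoly K s).natDegree ∣ Module.finrank K D := by
  have hintg : IsIntegral K s := IsIntegral.of_finite K s
  have hirr := minpoly.irreducible hintg
  haveI : Fact (Irreducible (minpoly K s)) := ⟨hirr⟩
  let ψ : AdjoinRoot (minpoly K s) →ₐ[K] D := Ideal.Quotient.liftₐ _ (Polynomial.aeval s) (by
    intro a ha
    obtain ⟨c, rfl⟩ := Ideal.mem_span_singleton'.mp ha
    simp)
  have pb := AdjoinRoot.powerBasis hirr.ne_zero
  haveI : FiniteDimensional K (AdjoinRoot (minpoly K s)) := pb.finite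
  have := divdim ((Algebra.lmul K D).comp ψ)
  rwa [(AdjoinRoot.powerBasis hirr.ne_zero).finrank, AdjoinRoot.powerBasis_dim] at this

theorem odd_case (hc : Cen K D) (h : Anti K D) (hodd : Odd (Module.finrank K D)) :
    Module.finrank K D = 1 := by
  obtain ⟨θ, h1, hm, hinv⟩ := inv_of_anti hc h
  by_cases hid : ∀ x, θ x = x
  · have : ∀ x : D, ∃ k : K, k • (1 : D) = x := by
      intro x
      obtain ⟨k, hk⟩ := hc x (fun y => by rw [← hid (x * y), hm, hid, hid])
      exact ⟨k, by rw [hk, Algebra.algebraMap_eq_smul_one]⟩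
    exact finrank_eq_one 1 one_ne_zero this
  · exfalso
    push Not at hid
    obtain ⟨x, hx⟩ := hid
    set s := x - θ x with hs
    have hs0 : s ≠ 0 := fun h => hx (sub_eq_zero.mp h).symm
    have hθs : θ s = -s := by rw [hs, map_sub, hinv]; abel
    have hdeg := hodd.of_dvd_nat (natDegree_dvd (K := K) s)
    have hintg : IsIntegral K s := IsIntegral.of_finite K s
    set p := minpoly K s with hp
    have hpow : ∀ n : ℕ, θ (s ^ n) = (-s) ^ n := by
      intro n
      induction n with
      | zero => simp [h1]
      | succ n ih => rw [pow_succ, hm, ih, hθs, pow_succ']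
    have hae : ∀ f : Polynomial K, Polynomial.aeval (-s) f = θ (Polynomial.aeval s f) := by
      intro f
      induction f using Polynomial.induction_on' with
      | add f g hf hg => simp [hf, hg]
      | monomial n a =>
        simp only [Polynomial.aeval_monomial]
        rw [← Algebra.smul_def, ← Algebra.smul_def, map_smul, hpow]
    have h0 : Polynomial.aeval (-s) p = 0 := by rw [hae, hp, minpoly.aeval, map_zero]
    have h2 : p ∣ p.comp (-Polynomial.X) := by
      apply minpoly.dvd
      rw [Polynomial.aeval_comp]
      simpa using h0
    have hdc : (p.comp (-Polynomial.X)).natDegree = p.natDegree := by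
      rw [Polynomial.natDegree_comp]; simp
    have hirr := minpoly.irreducible hintg
    have hq0 : p.comp (-Polynomial.X) ≠ 0 := by
      intro h
      rw [h, Polynomial.natDegree_zero] at hdc
      rw [← hdc] at hdeg
      simp at hdeg
    have hmon := minpoly.monic hintg
    obtain ⟨c, hcc⟩ : ∃ c : K, p.comp (-Polynomial.X) = Polynomial.C c * p := by
      obtain ⟨g, hg⟩ := h2
      have hg0 : g ≠ 0 := by rintro rfl; exact hq0 (by rw [hg, mul_zero])
      have : g.natDegree = 0 := by
        have := congrArg Polynomial.natDegree hg
        rw [hdc, Polynomial.natDegree_mul hirr.ne_zero hg0, ← hp] at this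
        omega
      refine ⟨g.coeff 0, ?_⟩
      rw [hg, Polynomial.eq_C_of_natDegree_eq_zero this, mul_comm]
      simp
    have hlead : (p.comp (-Polynomial.X)).leadingCoeff = -1 := by
      rw [Polynomial.leadingCoeff_comp (by simp)]
      rw [hmon.leadingCoeff]
      simp [hdeg.neg_one_pow]
    have hc1 : c = -1 := by
      rw [hcc, Polynomial.leadingCoeff_mul, hmon.leadingCoeff] at hlead
      simpa using hlead
    have h3 := congrArg (Polynomial.eval 0) hcc
    rw [hc1] at h3
    simp only [Polynomial.eval_comp, Polynomial.eval_neg, Polynomial.eval_X, neg_zero, map_neg, map_one,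
      neg_mul, one_mul] at h3
    have h4 : p.coeff 0 = 0 := by
      rw [Polynomial.coeff_zero_eq_eval_zero]
      exact self_eq_neg.mp h3
    exact (minpoly.coeff_zero_ne_zero hintg hs0) h4

end
end Alg

set_option linter.unusedSectionVars false
set_option linter.deprecated false
set_option linter.style.haveILetI false
namespace Alg
open TensorProduct

lemma anti_corner {F D : Type*} [Field F] [DivisionRing D] [Algebra F D] {r : ℕ} [NeZero r]
    (τ : Matrix (Fin r) (Fin r) D →ₗ[F] Matrix (Fin r) (Fin r) D)
    (hbij : Function.Bijective τ) (hm : ∀ x y, τ (x * y) = τ y * τ x) : Anti F D := by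
  set E : D → Matrix (Fin r) (Fin r) D := fun d => Matrix.single 0 0 d with hE
  have hEm : ∀ x y, E x * E y = E (x * y) := fun x y => by simp [hE]
  have hcorner : ∀ X, E 1 * X * E 1 = E (X 0 0) := fun X => by
    simp [hE]
  have hEinj : ∀ x y, E x = E y → x = y := fun x y h => by
    have := congrFun (congrFun h 0) 0
    simpa [hE] using this
  obtain ⟨e', he'⟩ : ∃ e', e' = τ (E 1) := ⟨_, rfl⟩
  have he'2 : e' * e' = e' := by rw [he', ← hm, hEm, one_mul]
  have he'0 : e' ≠ 0 := by
    intro h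
    have := hbij.1 ((he'.symm.trans h).trans (map_zero τ).symm)
    have h2 : E 1 = E 0 := by rw [this]; simp [hE]
    exact one_ne_zero (hEinj _ _ h2)
  obtain ⟨i, j, hij⟩ : ∃ i j, e' i j ≠ 0 := by
    by_contra hcon
    push Not at hcon
    exact he'0 (by ext i j; exact hcon i j)
  obtain ⟨a, ha⟩ : ∃ a : Matrix (Fin r) (Fin r) D, a = Matrix.single 0 i 1 * e' := ⟨_, rfl⟩
  have ha0 : a 0 j = e' i j := by simp [ha]
  have hea : E 1 * a = a := by rw [ha, ← mul_assoc]; simp [hE]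
  have hae : a * e' = a := by rw [ha, mul_assoc, he'2]
  obtain ⟨b, hb⟩ : ∃ b : Matrix (Fin r) (Fin r) D, b = e' * Matrix.single j 0 (e' i j)⁻¹ := ⟨_, rfl⟩
  have hbe : b * E 1 = b := by rw [hb, mul_assoc]; simp [hE]
  have heb : e' * b = b := by rw [hb, ← mul_assoc, he'2]
  have hab : a * b = E 1 := by
    have h1 : a * b = E 1 * (a * b) * E 1 := by
      rw [← mul_assoc (E 1), hea, mul_assoc, hbe]
    rw [h1, hcorner]
    congr 1
    rw [hb, ← mul_assoc, hae, Matrix.mul_single_apply_same, ha0, mul_inv_cancel₀ hij]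
  have hba : b * a = e' := by
    obtain ⟨g, hg⟩ := hbij.2 (b * a)
    have h1 : τ (E (g 0 0)) = b * a := by
      rw [← hcorner, hm, hm, hg, ← he', mul_assoc, hae, ← mul_assoc, heb]
    have h2 : g 0 0 * g 0 0 = g 0 0 := by
      apply hEinj
      apply hbij.1
      rw [← hEm, hm, h1, mul_assoc, ← mul_assoc a, hab, hea]
    have h3 : g 0 0 ≠ 0 := by
      intro h0
      rw [h0] at h1
      have h4 : a * (b * a) = 0 := by rw [← h1]; simp [hE]
      rw [← mul_assoc, hab, hea] at h4
      rw [h4] at ha0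
      exact hij (by rw [← ha0]; rfl)
    have h5 : g 0 0 = 1 := mul_left_cancel₀ h3 (by rw [h2, mul_one])
    rw [h5] at h1
    rw [← h1, he']
  have hME : ∀ d, a * τ (E d) * b = E ((a * τ (E d) * b) 0 0) := by
    intro d
    rw [← hcorner]
    conv_lhs => rw [← hea, ← hbe]
    simp only [mul_assoc]
  let Elin : D →ₗ[F] Matrix (Fin r) (Fin r) D := Matrix.singleLinearMap F 0 0
  refine ⟨Matrix.entryLinearMap F D 0 0 ∘ₗ LinearMap.mulRight F b ∘ₗ LinearMap.mulLeft F a ∘ₗ τ ∘ₗ Elin, ?_, ?_⟩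
  · change (a * τ (E 1) * b) 0 0 = 1
    rw [← he', hae, hab]; simp [hE]
  · intro x y
    change (a * τ (E (x * y)) * b) 0 0 = (a * τ (E y) * b) 0 0 * (a * τ (E x) * b) 0 0
    apply hEinj
    rw [← hME, ← hEm, ← hEm, ← hME, ← hME, hm]
    have e1 : τ (E x) = e' * τ (E x) := by rw [he', ← hm, hEm, mul_one]
    have : a * τ (E y) * b * (a * τ (E x) * b) = a * τ (E y) * ((b * a) * τ (E x)) * b := by
      simp only [mul_assoc]
    rw [this, hba, ← e1, mul_assoc a (τ (E y))]

lemma corner_rep {F N D V : Type*} [Field F] [Field N] [Algebra F N] [DivisionRing D] [Algebra F D]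
    [AddCommGroup V] [Module N V] [FiniteDimensional N V] {r : ℕ} [NeZero r]
    (ρ : Matrix (Fin r) (Fin r) D →+* Module.End N V)
    (hρ : ∀ c : F, ρ (algebraMap F _ c) = algebraMap N _ (algebraMap F N c)) :
    ∃ d, Module.finrank N V = r * d ∧ Nonempty (D →ₐ[F] Matrix (Fin d) (Fin d) N) := by
  set E : Fin r → Fin r → D → Matrix (Fin r) (Fin r) D := fun i j d => Matrix.single i j d with hE
  have hEm : ∀ i j k x y, E i j x * E j k y = E i k (x * y) := fun i j k x y => by simp [hE]
  let W := LinearMap.range (ρ (E 0 0 1))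
  have hmem : ∀ i d v, ρ (E 0 i d) v ∈ W := by
    intro i d v
    refine ⟨ρ (E 0 i d) v, ?_⟩
    rw [← Module.End.mul_apply, ← map_mul, hEm, one_mul]
  have hfix : ∀ w : W, ρ (E 0 0 1) w = w := by
    rintro ⟨_, v, rfl⟩
    change ρ (E 0 0 1) (ρ (E 0 0 1) v) = ρ (E 0 0 1) v
    rw [← Module.End.mul_apply, ← map_mul, hEm, one_mul]
  let ev : V ≃ₗ[N] (Fin r → W) :=
    { LinearMap.pi (fun i => (ρ (E 0 i 1)).codRestrict W (hmem i 1)) with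
      invFun := fun w => ∑ i, ρ (E i 0 1) (w i)
      left_inv := by
        intro v
        change ∑ i, ρ (E i 0 1) (ρ (E 0 i 1) v) = v
        simp only [← Module.End.mul_apply, ← map_mul, hEm, one_mul]
        rw [← LinearMap.sum_apply, ← map_sum]
        have : ∑ i, E i i 1 = (1 : Matrix (Fin r) (Fin r) D) := by
          simp [hE, Matrix.sum_single_one]
        rw [this, map_one]; rfl
      right_inv := by
        intro w
        funext j
        apply Subtype.ext
        change ρ (E 0 j 1) (∑ i, ρ (E i 0 1) (w i)) = w j
        rw [map_sum, Finset.sum_eq_single j]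
        · rw [← Module.End.mul_apply, ← map_mul, hEm, one_mul, hfix]
        · intro i _ hij
          rw [← Module.End.mul_apply, ← map_mul]
          have : E 0 j 1 * E i 0 1 = 0 := by
            simp only [hE]
            rw [Matrix.single_mul_single_of_ne]
            exact hij.symm
          rw [this]; simp
        · simp }
  refine ⟨Module.finrank N W, ?_, ?_⟩
  · rw [ev.finrank_eq, Module.finrank_pi_fintype]; simp
  · let σ : D →+* Module.End N W :=
      { toFun := fun d => (ρ (E 0 0 d)).restrict (fun w _ => hmem 0 d w)
        map_one' := by
          ext w
          simpa using hfix w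
        map_mul' := by
          intro x y
          ext w
          change ρ (E 0 0 (x * y)) w = ρ (E 0 0 x) (ρ (E 0 0 y) w)
          rw [← Module.End.mul_apply, ← map_mul, hEm]
        map_zero' := by
          ext w
          change ρ (E 0 0 0) w = 0
          simp [hE]
        map_add' := by
          intro x y
          ext w
          change ρ (E 0 0 (x + y)) w = ρ (E 0 0 x) w + ρ (E 0 0 y) w
          simp [hE, Matrix.single_add] }
    let e := LinearMap.toMatrixAlgEquiv (Module.finBasis N W)
    refine ⟨{ (e.toRingEquiv.toRingHom.comp σ) with commutes' := ?_ }⟩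
    intro c
    change e (σ (algebraMap F D c)) = _
    have : σ (algebraMap F D c) = algebraMap N _ (algebraMap F N c) := by
      ext w
      change ρ (E 0 0 (algebraMap F D c)) w = (algebraMap F N c) • (w : V)
      have h1 : E 0 0 (algebraMap F D c) = algebraMap F _ c * E 0 0 1 := by
        rw [← Algebra.smul_def, hE, Matrix.smul_single, Algebra.algebraMap_eq_smul_one]
      rw [h1, map_mul, Module.End.mul_apply, hfix, hρ]
      rfl
    rw [this, AlgEquiv.commutes]
    rfl

universe u v
theorem reduce {K F N : Type u} {D : Type v} [Field K] [Field F] [Field N] [Algebra K F] [Algebra F N]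
    [Algebra K N] [IsScalarTower K F N] [CharZero K] [FiniteDimensional K F] [FiniteDimensional F N]
    [DivisionRing D] [Algebra K D] [FiniteDimensional K D] (hc : Cen K D) (ha : Anti K D)
    (m : ℕ) (hm : Module.finrank K D = m ^ 2) (φ : D →ₐ[K] Matrix (Fin m) (Fin m) N) :
    ∃ (r d : ℕ) (D' : Type (max u v)) (_ : DivisionRing D') (_ : Algebra F D')
      (_ : FiniteDimensional F D'), Cen F D' ∧ Anti F D' ∧ Module.finrank F D' = d ^ 2 ∧
      Nonempty (D' →ₐ[F] Matrix (Fin d) (Fin d) N) ∧ m = r * d ∧ r ∣ Module.finrank K F ∧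
      d ∣ Module.finrank F N ∧ Nonempty ((F ⊗[K] D) ≃ₐ[F] Matrix (Fin r) (Fin r) D') := by
  haveI : IsSimpleRing (F ⊗[K] D) := simple_tensor F hc
  haveI : IsArtinianRing (F ⊗[K] D) := IsArtinianRing.of_finite F _
  obtain ⟨r, hr, D', _, _, _, ⟨e⟩⟩ := IsSimpleRing.exists_algEquiv_matrix_divisionRing_finite F (F ⊗[K] D)
  have hr0 : 0 < r := Nat.pos_of_ne_zero hr.out
  have hcF := cen_tensor F hc
  -- central
  have hc' : Cen F D' := by
    intro z hz
    obtain ⟨k, hk⟩ := hcF (e.symm (Matrix.scalar (Fin r) z)) (by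
      intro y
      apply e.injective
      rw [map_mul, map_mul, e.apply_symm_apply]
      exact (Matrix.scalar_commute z hz (e y)).eq)
    refine ⟨k, ?_⟩
    have := congrArg e hk
    rw [e.apply_symm_apply, AlgEquiv.commutes] at this
    have := congrFun (congrFun this 0) 0
    simpa [Matrix.algebraMap_matrix_apply] using this
  -- anti
  have ha' : Anti F D' := by
    obtain ⟨τ, h1, hmul⟩ := ha
    have hinj := anti_inj h1 hmul
    have hsurj : Function.Surjective τ := LinearMap.injective_iff_surjective.mp hinj
    let τe : D ≃ₗ[K] D := LinearEquiv.ofBijective τ ⟨hinj, hsurj⟩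
    let T : (F ⊗[K] D) ≃ₗ[F] (F ⊗[K] D) := τe.baseChange K F D D
    have hTt : ∀ a d, T (a ⊗ₜ d) = a ⊗ₜ τ d := fun a d => rfl
    have hT : ∀ x y, T (x * y) = T y * T x := by
      intro x y
      induction x using TensorProduct.induction_on with
      | zero => simp
      | add x1 x2 h1 h2 => rw [add_mul, map_add, h1, h2, map_add, mul_add]
      | tmul a d =>
        induction y using TensorProduct.induction_on with
        | zero => simp
        | add x1 x2 h1 h2 => rw [mul_add, map_add, h1, h2, map_add, add_mul]
        | tmul a' d' =>
          rw [Algebra.TensorProduct.tmul_mul_tmul, hTt, hTt, hTt, hmul,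
            Algebra.TensorProduct.tmul_mul_tmul, mul_comm a]
    let T2 := (e.toLinearEquiv.symm.trans T).trans e.toLinearEquiv
    refine anti_corner T2.toLinearMap T2.bijective ?_
    intro x y
    change e (T (e.symm (x * y))) = e (T (e.symm y)) * e (T (e.symm x))
    rw [map_mul, hT, map_mul]
  -- representation
  let Φ : (F ⊗[K] D) →ₐ[F] Matrix (Fin m) (Fin m) N :=
    Algebra.TensorProduct.lift (Algebra.ofId F _) φ (fun a d => Algebra.commutes _ _)
  let ρ : Matrix (Fin r) (Fin r) D' →+* Module.End N (Fin m → N) :=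
    (Matrix.toLinAlgEquiv' (R := N) (n := Fin m)).toRingEquiv.toRingHom.comp
      ((Φ.comp e.symm.toAlgHom).toRingHom)
  obtain ⟨d, hd, hrep⟩ := corner_rep (F := F) ρ (by
    intro c
    change Matrix.toLinAlgEquiv' (Φ (e.symm (algebraMap F _ c))) = _
    rw [AlgEquiv.commutes, AlgHom.commutes, IsScalarTower.algebraMap_apply F N (Matrix (Fin m) (Fin m) N),
      AlgEquiv.commutes])
  rw [Module.finrank_fin_fun] at hd
  have hdimD' : r * r * Module.finrank F D' = m ^ 2 := by
    rw [← hm, ← Module.finrank_baseChange (R := F) (M' := D), e.toLinearEquiv.finrank_eq, Module.finrank_matrix]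
    simp
  have hfd : Module.finrank F D' = d ^ 2 := by
    rw [hd] at hdimD'
    have : (r * r) * Module.finrank F D' = (r * r) * d ^ 2 := by rw [hdimD']; ring
    exact Nat.eq_of_mul_eq_mul_left (by positivity) this
  have hd0 : 0 < d := by
    have : 0 < Module.finrank F D' := Module.finrank_pos
    rw [hfd] at this
    exact Nat.pos_of_ne_zero (by rintro rfl; simp at this)
  have hm0 : 0 < m := by rw [hd]; positivity
  refine ⟨r, d, D', inferInstance, inferInstance, inferInstance, hc', ha', hfd, hrep, hd, ?_, ?_, ⟨e⟩⟩
  · -- r ∣ [F:K]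
    letI : Module K (Fin r → D') := Module.compHom _ (algebraMap K F)
    haveI : IsScalarTower K F (Fin r → D') := IsScalarTower.of_algebraMap_smul (fun _ _ => rfl)
    let act : Matrix (Fin r) (Fin r) D' →+* Module.End F (Fin r → D') :=
      { toFun := fun M =>
          { toFun := fun v => M.mulVec v
            map_add' := fun x y => Matrix.mulVec_add _ _ _
            map_smul' := fun c x => Matrix.mulVec_smul _ _ _ }
        map_one' := by ext; simp
        map_mul' := by intro x y; apply LinearMap.ext; intro v; exact (Matrix.mulVec_mulVec v x y).symm
        map_zero' := by apply LinearMap.ext; intro v; exact Matrix.zero_mulVec v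
        map_add' := by intro x y; apply LinearMap.ext; intro v; exact Matrix.add_mulVec x y v }
    have hact : ∀ (c : F) v, act (algebraMap F _ c) v = c • v := by
      intro c v
      change (algebraMap F (Matrix (Fin r) (Fin r) D') c).mulVec v = c • v
      rw [Algebra.algebraMap_eq_smul_one, Matrix.smul_mulVec, Matrix.one_mulVec]
    let ψ0 : D →+* Module.End F (Fin r → D') :=
      act.comp (e.toAlgHom.toRingHom.comp (Algebra.TensorProduct.includeRight (R := K) (A := F) (B := D)).toRingHom)
    have hψ0 : ∀ (k : K) v, ψ0 (algebraMap K D k) v = (algebraMap K F k) • v := by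
      intro k v
      change act (e ((1 : F) ⊗ₜ[K] (algebraMap K D k))) v = _
      have : ((1 : F) ⊗ₜ[K] (algebraMap K D k)) = algebraMap F (F ⊗[K] D) (algebraMap K F k) := by
        rw [Algebra.TensorProduct.algebraMap_apply, Algebra.algebraMap_eq_smul_one, ← TensorProduct.smul_tmul,
          Algebra.smul_def, mul_one]
        rfl
      rw [this, AlgEquiv.commutes, hact]
    let ψ : D →ₐ[K] Module.End K (Fin r → D') :=
      { toFun := fun d =>
          { toFun := fun v => (ψ0 d v : Fin r → D')
            map_add' := fun x y => map_add (ψ0 d) x y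
            map_smul' := fun c x => map_smul (ψ0 d) (algebraMap K F c) x }
        map_one' := by apply LinearMap.ext; intro v; change ψ0 1 v = v; rw [map_one]; rfl
        map_mul' := by intro x y; apply LinearMap.ext; intro v; change ψ0 (x * y) v = ψ0 x (ψ0 y v); rw [map_mul]; rfl
        map_zero' := by apply LinearMap.ext; intro v; change ψ0 0 v = 0; rw [map_zero]; rfl
        map_add' := by intro x y; apply LinearMap.ext; intro v; change ψ0 (x + y) v = ψ0 x v + ψ0 y v; rw [map_add]; rfl
        commutes' := by
          intro k
          apply LinearMap.ext
          intro v
          exact hψ0 k v }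
    have h1 := divdim ψ
    have h2 : Module.finrank K (Fin r → D') = Module.finrank K F * (r * d ^ 2) := by
      rw [← Module.finrank_mul_finrank K F (Fin r → D')]
      congr 1
      change Module.finrank F (Fin r → D') = _
      rw [Module.finrank_pi_fintype]
      simp [hfd]
    rw [h2, hm, hd] at h1
    have h3 : r * (r * d ^ 2) ∣ Module.finrank K F * (r * d ^ 2) := by
      convert h1 using 1; ring
    exact Nat.dvd_of_mul_dvd_mul_right (by positivity) h3
  · obtain ⟨σ⟩ := hrep
    let ψ : D' →ₐ[F] Module.End F (Fin d → N) :=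
      { toFun := fun x => (Matrix.toLin' (σ x)).restrictScalars F
        map_one' := by ext; simp
        map_mul' := by intro x y; rw [map_mul, Matrix.toLin'_mul]; rfl
        map_zero' := by ext; simp
        map_add' := by intro x y; rw [map_add, map_add]; rfl
        commutes' := by
          intro c
          apply LinearMap.ext
          intro v
          rw [AlgHom.commutes, Algebra.algebraMap_eq_smul_one]
          change (c • (1 : Matrix (Fin d) (Fin d) N)).mulVec v = c • v
          rw [Matrix.smul_mulVec, Matrix.one_mulVec] }
    have h1 := divdim ψ
    rw [hfd, Module.finrank_pi_fintype] at h1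
    simp only [Finset.sum_const, Finset.card_univ, Fintype.card_fin, smul_eq_mul] at h1
    rw [pow_two] at h1
    exact Nat.dvd_of_mul_dvd_mul_left hd0 h1

end Alg

set_option linter.unusedSectionVars false
set_option linter.deprecated false
set_option linter.style.haveILetI false
namespace Alg
open TensorProduct

lemma anti3 {D : Type*} {K : Type*} [Field K] [CharZero K] [DivisionRing D] [Algebra K D] (b c : K)
    (i j : D) (hi : i * i = algebraMap K D b) (hj : j * j = algebraMap K D c)
    (hb : b ≠ 0) (hc : c ≠ 0) (hij : i * j = -(j * i)) (x y z : K)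
    (h1 : i * (x • i + y • j + z • (i * j)) = (x • i + y • j + z • (i * j)) * i)
    (h2 : j * (x • i + y • j + z • (i * j)) = (x • i + y • j + z • (i * j)) * j) :
    x = 0 ∧ y = 0 ∧ z = 0 := by
  haveI : CharZero D := charZero_of_injective_algebraMap (algebraMap K D).injective
  have hi0 : i ≠ 0 := by rintro rfl; apply hb; rw [mul_zero] at hi; exact (map_eq_zero _).mp hi.symm
  have hj0 : j ≠ 0 := by rintro rfl; apply hc; rw [mul_zero] at hj; exact (map_eq_zero _).mp hj.symm
  have hji : j * i = -(i * j) := by rw [hij, neg_neg]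
  have e1 : i * (y • j + z • (i * j)) = 0 := by
    have h3 : i * (y • j + z • (i * j)) = (y • j + z • (i * j)) * i := by
      simp only [mul_add, add_mul, mul_smul_comm, smul_mul_assoc] at h1 ⊢
      linear_combination (norm := noncomm_ring) h1
    have h4 : (y • j + z • (i * j)) * i = - (i * (y • j + z • (i * j))) := by
      simp only [mul_add, add_mul, mul_smul_comm, smul_mul_assoc, mul_assoc, hji, smul_neg, mul_neg,
        neg_add]
    rw [h4] at h3
    exact self_eq_neg.mp h3
  have e2 : j * (x • i + z • (i * j)) = 0 := by
    have h3 : j * (x • i + z • (i * j)) = (x • i + z • (i * j)) * j := by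
      simp only [mul_add, add_mul, mul_smul_comm, smul_mul_assoc] at h2 ⊢
      linear_combination (norm := noncomm_ring) h2
    have h4 : (x • i + z • (i * j)) * j = - (j * (x • i + z • (i * j))) := by
      simp only [mul_add, add_mul, mul_smul_comm, smul_mul_assoc, ← mul_assoc, hji, smul_neg, neg_mul,
        neg_add, neg_neg]
    rw [h4] at h3
    exact self_eq_neg.mp h3
  have e1' := (mul_eq_zero.mp e1).resolve_left hi0
  have e2' := (mul_eq_zero.mp e2).resolve_left hj0
  have f1 : (algebraMap K D y + algebraMap K D z * i) * j = 0 := by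
    rw [← e1']; simp [Algebra.smul_def, add_mul, mul_assoc]
  have f1' := (mul_eq_zero.mp f1).resolve_right hj0
  have hz : z = 0 := by
    have h5 : j * (algebraMap K D y + algebraMap K D z * i) * i = 0 := by rw [f1']; simp
    have h6 : (algebraMap K D y + algebraMap K D z * i) * j * i = 0 := by rw [f1']; simp
    by_contra hz
    have h7 : j * (algebraMap K D z * i) - (algebraMap K D z * i) * j = 0 := by
      have h8 : j * (algebraMap K D y + algebraMap K D z * i) -
        (algebraMap K D y + algebraMap K D z * i) * j = 0 := by rw [f1']; simp
      rw [← h8, mul_add, add_mul, Algebra.commutes y j]; abel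
    rw [← mul_assoc, ← Algebra.commutes z j, mul_assoc, mul_assoc, ← mul_sub, hji] at h7
    have h9 := (mul_eq_zero.mp h7).resolve_left (by simpa using hz)
    have h10 : i * j = 0 := by
      have : (2 : D) * (i * j) = 0 := by linear_combination (norm := noncomm_ring) -h9
      exact (mul_eq_zero.mp this).resolve_left two_ne_zero
    exact mul_ne_zero hi0 hj0 h10
  subst hz
  refine ⟨?_, ?_, rfl⟩
  · simp at e2'; exact e2'.resolve_right hi0
  · simp at e1'; exact e1'.resolve_right hj0

theorem no_biquat {K D : Type*} [Field K] [NumberField K] [DivisionRing D] [Algebra K D]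
    (b c e f : K) (i j k l : D) (hb : b ≠ 0) (hc : c ≠ 0) (he : e ≠ 0) (hf : f ≠ 0)
    (hi : i * i = algebraMap K D b) (hj : j * j = algebraMap K D c) (hij : i * j = -(j * i))
    (hk : k * k = algebraMap K D e) (hl : l * l = algebraMap K D f) (hkl : k * l = -(l * k))
    (hik : i * k = k * i) (hil : i * l = l * i) (hjk : j * k = k * j) (hjl : j * l = l * j) : False := by
  obtain ⟨x, y, z, x', y', z', hne, heq⟩ := Loc.albert b c e f hb hc he hf
  obtain ⟨α, hα⟩ : ∃ α, α = x • i + y • j + z • (i * j) := ⟨_, rfl⟩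
  obtain ⟨β, hβ⟩ : ∃ β, β = x' • k + y' • l + z' • (k * l) := ⟨_, rfl⟩
  have sq : ∀ (b c : K) (i j : D) (x y z : K), i * i = algebraMap K D b → j * j = algebraMap K D c →
      i * j = -(j * i) → (x • i + y • j + z • (i * j)) * (x • i + y • j + z • (i * j)) =
        algebraMap K D (b * x ^ 2 + c * y ^ 2 - b * c * z ^ 2) := by
    intro b c i j x y z hi hj hij
    have hji : j * i = -(i * j) := by rw [hij, neg_neg]
    have m1 : i * (i * j) = b • j := by rw [← mul_assoc, hi, Algebra.smul_def]
    have m2 : (i * j) * i = -(b • j) := by rw [mul_assoc, hji, mul_neg, m1]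
    have m3 : (i * j) * j = c • i := by rw [mul_assoc, hj, Algebra.smul_def, Algebra.commutes]
    have m4 : j * (i * j) = -(c • i) := by rw [← mul_assoc, hji, neg_mul, m3]
    have m5 : (i * j) * (i * j) = algebraMap K D (-(b * c)) := by
      rw [← mul_assoc, m2, neg_mul, smul_mul_assoc, hj, Algebra.smul_def, map_neg, map_mul]
    simp only [mul_add, add_mul, mul_smul_comm, smul_mul_assoc, m1, m2, m3, m4, m5, hi, hj, hji]
    simp only [Algebra.algebraMap_eq_smul_one]
    module
  have hαβ : α * β = β * α := by
    have c1 : Commute i k := hik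
    have c2 : Commute i l := hil
    have c3 : Commute j k := hjk
    have c4 : Commute j l := hjl
    have hA : ∀ w, Commute i w → Commute j w → Commute α w := by
      intro w h1 h2
      rw [hα]
      exact ((h1.smul_left x).add_left (h2.smul_left y)).add_left ((h1.mul_left h2).smul_left z)
    rw [hβ]
    exact (((hA k c1 c3).smul_right x').add_right ((hA l c2 c4).smul_right y')).add_right
      (((hA k c1 c3).mul_right (hA l c2 c4)).smul_right z')
  have hsq : (α - β) * (α + β) = 0 := by
    have : α * α = β * β := by
      rw [hα, hβ, sq b c i j x y z hi hj hij, sq e f k l x' y' z' hk hl hkl, heq]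
    rw [mul_add, sub_mul, sub_mul, this, hαβ]; abel
  have hβi : i * β = β * i := by
    rw [hβ]
    have c1 : Commute i k := hik
    have c2 : Commute i l := hil
    exact ((c1.smul_right x').add_right (c2.smul_right y')).add_right ((c1.mul_right c2).smul_right z')
  have hβj : j * β = β * j := by
    rw [hβ]
    have c1 : Commute j k := hjk
    have c2 : Commute j l := hjl
    exact ((c1.smul_right x').add_right (c2.smul_right y')).add_right ((c1.mul_right c2).smul_right z')
  have hαk : k * α = α * k := by
    rw [hα]
    have c1 : Commute k i := hik.symm
    have c2 : Commute k j := hjk.symm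
    exact ((c1.smul_right x).add_right (c2.smul_right y)).add_right ((c1.mul_right c2).smul_right z)
  have hαl : l * α = α * l := by
    rw [hα]
    have c1 : Commute l i := hil.symm
    have c2 : Commute l j := hjl.symm
    exact ((c1.smul_right x).add_right (c2.smul_right y)).add_right ((c1.mul_right c2).smul_right z)
  have hor : α = β ∨ α = -β := by
    rcases mul_eq_zero.mp hsq with h | h
    · exact Or.inl (sub_eq_zero.mp h)
    · exact Or.inr (eq_neg_of_add_eq_zero_left h)
  have A1 : i * α = α * i := by rcases hor with h | h <;> rw [h] <;> simp [hβi]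
  have A2 : j * α = α * j := by rcases hor with h | h <;> rw [h] <;> simp [hβj]
  have hor' : β = α ∨ β = -α := by
    rcases hor with h | h
    · exact Or.inl h.symm
    · right; rw [h, neg_neg]
  have A3 : k * β = β * k := by rcases hor' with h | h <;> rw [h] <;> simp [hαk]
  have A4 : l * β = β * l := by rcases hor' with h | h <;> rw [h] <;> simp [hαl]
  rw [hα] at A1 A2
  rw [hβ] at A3 A4
  obtain ⟨h1, h2, h3⟩ := anti3 b c i j hi hj hb hc hij x y z A1 A2
  obtain ⟨h4, h5, h6⟩ := anti3 e f k l hk hl he hf hkl x' y' z' A3 A4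
  simp_all

lemma half {K D : Type*} [Field K] [CharZero K] [DivisionRing D] [Algebra K D] [FiniteDimensional K D]
    (W : Submodule K D) (T : D →ₗ[K] D) (hTW : ∀ w ∈ W, T w ∈ W) (hT2 : ∀ w ∈ W, T (T w) = w)
    (g : D) (hg : g ≠ 0) (hgW : ∀ w ∈ W, g * w ∈ W) (hTg : ∀ w ∈ W, T (g * w) = -(g * T w)) :
    2 * Module.finrank K ↥(W ⊓ LinearMap.ker (T - LinearMap.id)) = Module.finrank K W := by
  obtain ⟨P, hP⟩ : ∃ P, P = W ⊓ LinearMap.ker (T - LinearMap.id) := ⟨_, rfl⟩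
  obtain ⟨M, hM⟩ : ∃ M, M = W ⊓ LinearMap.ker (T + LinearMap.id) := ⟨_, rfl⟩
  have mP : ∀ w, w ∈ P ↔ w ∈ W ∧ T w = w := by intro w; rw [hP]; simp [sub_eq_zero]
  have mM : ∀ w, w ∈ M ↔ w ∈ W ∧ T w = -w := by
    intro w; rw [hM]; simp [add_eq_zero_iff_eq_neg]
  rw [← hP]
  haveI : CharZero D := charZero_of_injective_algebraMap (algebraMap K D).injective
  have hsup : P ⊔ M = W := by
    apply le_antisymm
    · rw [hP, hM]; exact sup_le inf_le_left inf_le_left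
    · intro w hw
      have h2 : w = (2⁻¹ : K) • (w + T w) + (2⁻¹ : K) • (w - T w) := by module
      rw [h2]
      apply Submodule.add_mem_sup
      · apply Submodule.smul_mem
        rw [mP]
        exact ⟨W.add_mem hw (hTW w hw), by rw [map_add, hT2 w hw, add_comm]⟩
      · apply Submodule.smul_mem
        rw [mM]
        exact ⟨W.sub_mem hw (hTW w hw), by rw [map_sub, hT2 w hw, neg_sub]⟩
  have hinf : P ⊓ M = ⊥ := by
    rw [eq_bot_iff]
    intro w hw
    have h1 := ((mP w).mp hw.1).2
    have h2 := ((mM w).mp hw.2).2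
    rw [h1] at h2
    exact self_eq_neg.mp h2
  have hadd := Submodule.finrank_sup_add_finrank_inf_eq P M
  rw [hsup, hinf, finrank_bot, add_zero] at hadd
  have inj : ∀ A B : Submodule K D, (∀ w ∈ A, g * w ∈ B) → Module.finrank K A ≤ Module.finrank K B := by
    intro A B h
    apply LinearMap.finrank_le_finrank_of_injective (f := (LinearMap.mulLeft K g).restrict h)
    intro a b hab
    have := congrArg Subtype.val hab
    exact Subtype.ext (mul_left_cancel₀ hg this)
  have i1 := inj P M (by
    intro w hw
    obtain ⟨h1, h2⟩ := (mP w).mp hw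
    rw [mM]
    exact ⟨hgW w h1, by rw [hTg w h1, h2]⟩)
  have i2 := inj M P (by
    intro w hw
    obtain ⟨h1, h2⟩ := (mM w).mp hw
    rw [mP]
    exact ⟨hgW w h1, by rw [hTg w h1, h2]; simp⟩)
  omega

end Alg

set_option linter.unusedSectionVars false
set_option linter.deprecated false
set_option linter.style.haveILetI false
namespace Alg
open TensorProduct

/-- adjust an involution so that it negates `x` -/
lemma inv_neg {K D : Type*} [Field K] [CharZero K] [DivisionRing D] [Algebra K D]
    (hinv : Inv K D) (x : D) (e : K) (hx : x * x = algebraMap K D e)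
    (hnc : ∃ y, x * y ≠ y * x) :
    ∃ τ : D →ₗ[K] D, (∀ a b, τ (a * b) = τ b * τ a) ∧ (∀ a, τ (τ a) = a) ∧ τ x = -x := by
  haveI : CharZero D := charZero_of_injective_algebraMap (algebraMap K D).injective
  obtain ⟨θ, h1, hm, h2⟩ := hinv
  obtain ⟨y, hy⟩ : ∃ y, y = θ x := ⟨_, rfl⟩
  have hyx : θ y = x := by rw [hy, h2]
  have hyy : y * y = algebraMap K D e := by
    rw [hy, ← hm, hx, Algebra.algebraMap_eq_smul_one, map_smul, h1]
  obtain ⟨u, ε, hε, hu, hg⟩ : ∃ (u : D) (ε : K), ε * ε = 1 ∧ θ u = ε • u ∧ y * u - u * x ≠ 0 := by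
    by_contra hcon
    push Not at hcon
    have key : ∀ u, y * u = u * x := by
      intro u
      have e1 := hcon (u + θ u) 1 (by ring) (by rw [map_add, h2, one_smul, add_comm])
      have e2 := hcon (u - θ u) (-1) (by ring) (by rw [map_sub, h2, neg_one_smul, neg_sub])
      have e3 : (2 : D) * (y * u - u * x) = 0 := by
        have : (2 : D) * (y * u - u * x) = (y * (u + θ u) - (u + θ u) * x) +
          (y * (u - θ u) - (u - θ u) * x) := by noncomm_ring
        rw [this, e1, e2, add_zero]
      exact sub_eq_zero.mp ((mul_eq_zero.mp e3).resolve_left two_ne_zero)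
    obtain ⟨w, hw⟩ := hnc
    have : y = x := by simpa using key 1
    rw [this] at key
    exact hw (key w)
  obtain ⟨g, hgd⟩ : ∃ g, g = y * u - u * x := ⟨_, rfl⟩
  rw [← hgd] at hg
  have hεθ : θ g = -(ε • g) := by
    rw [hgd, map_sub, hm, hm, hyx, ← hy, hu, mul_smul_comm, smul_mul_assoc, ← smul_sub, ← smul_neg,
      neg_sub]
  have hgx : y * g = -(g * x) := by
    rw [hgd]
    have t1 : y * (y * u - u * x) = y * y * u - y * u * x := by noncomm_ring
    have t2 : (y * u - u * x) * x = y * u * x - u * (x * x) := by noncomm_ring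
    rw [t1, t2, hyy, hx, Algebra.commutes]; abel
  have hε0 : ε ≠ 0 := by rintro rfl; simp at hε
  have hθi : θ g⁻¹ = -(ε • g⁻¹) := by
    have : θ g⁻¹ * θ g = 1 := by rw [← hm, mul_inv_cancel₀ hg, h1]
    have h3 : -(ε • g⁻¹) * θ g = 1 := by
      rw [hεθ, neg_mul_neg, smul_mul_smul_comm, hε, inv_mul_cancel₀ hg, one_smul]
    have h4 : θ g ≠ 0 := by intro h; rw [h, mul_zero] at this; exact zero_ne_one this
    exact mul_right_cancel₀ h4 (this.trans h3.symm)
  refine ⟨LinearMap.mulLeft K g⁻¹ ∘ₗ LinearMap.mulRight K g ∘ₗ θ, ?_, ?_, ?_⟩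
  · intro a b
    change g⁻¹ * (θ (a * b) * g) = g⁻¹ * (θ b * g) * (g⁻¹ * (θ a * g))
    rw [hm]
    have : g⁻¹ * (θ b * g) * (g⁻¹ * (θ a * g)) = g⁻¹ * (θ b * (g * g⁻¹) * (θ a * g)) := by
      simp only [mul_assoc]
    rw [this, mul_inv_cancel₀ hg, mul_one, mul_assoc]
  · intro a
    change g⁻¹ * (θ (g⁻¹ * (θ a * g)) * g) = a
    rw [hm, hm, h2, hεθ, hθi]
    have : g⁻¹ * (-(ε • g) * a * -(ε • g⁻¹) * g) = (ε * ε) • ((g⁻¹ * g) * a * (g⁻¹ * g)) := by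
      simp only [neg_mul, mul_neg, smul_neg, neg_neg, smul_mul_assoc, mul_smul_comm, smul_smul, mul_assoc]
    rw [this, hε, inv_mul_cancel₀ hg, one_mul, mul_one, one_smul]
  · change g⁻¹ * (θ x * g) = -x
    rw [← hy, hgx, mul_neg, ← mul_assoc, inv_mul_cancel₀ hg, one_mul]

/-- conjugation -/
noncomputable def cj (K : Type*) {D : Type*} [Field K] [DivisionRing D] [Algebra K D] (a : D) : D →ₗ[K] D :=
  LinearMap.mulLeft K a ∘ₗ LinearMap.mulRight K a⁻¹

lemma cj_apply (K : Type*) {D : Type*} [Field K] [DivisionRing D] [Algebra K D] (a z : D) :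
    cj K a z = a * (z * a⁻¹) := rfl

lemma cj_fix (K : Type*) {D : Type*} [Field K] [DivisionRing D] [Algebra K D] (a z : D) (ha : a ≠ 0) :
    z ∈ LinearMap.ker (cj K a - LinearMap.id) ↔ a * z = z * a := by
  rw [LinearMap.mem_ker, LinearMap.sub_apply, sub_eq_zero, cj_apply, LinearMap.id_apply, ← mul_assoc,
    mul_inv_eq_iff_eq_mul₀ ha]

lemma cj_sq (K : Type*) {D : Type*} [Field K] [DivisionRing D] [Algebra K D] (a z : D) (ha : a ≠ 0)
    (b : K) (h : a * a = algebraMap K D b) : cj K a (cj K a z) = z := by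
  rw [cj_apply, cj_apply]
  have : a * (a * (z * a⁻¹) * a⁻¹) = (a * a) * z * (a * a)⁻¹ := by
    rw [mul_inv_rev]; simp only [mul_assoc]
  rw [this, h, Algebra.commutes, mul_assoc, mul_inv_cancel₀, mul_one]
  rw [← h]; exact mul_ne_zero ha ha

lemma cj_anti (K : Type*) {D : Type*} [Field K] [DivisionRing D] [Algebra K D] (a z g : D)
    (hg : a * g = -(g * a)) : cj K a (g * z) = -(g * cj K a z) := by
  rw [cj_apply, cj_apply, ← mul_assoc, ← mul_assoc, hg]; simp only [mul_assoc, neg_mul]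

lemma sign_split {K D : Type*} [Field K] [CharZero K] [DivisionRing D] [Algebra K D] (i u : D) (b : K)
    (hi : i * i = algebraMap K D b) (hi0 : i ≠ 0) (hu : u ≠ 0) :
    ∃ ε : K, (ε = 1 ∨ ε = -1) ∧ u * i + ε • (i * u) ≠ 0 ∧
      i * (u * i + ε • (i * u)) = ε • ((u * i + ε • (i * u)) * i) := by
  haveI : CharZero D := charZero_of_injective_algebraMap (algebraMap K D).injective
  have key : ∀ ε : K, ε * ε = 1 → i * (u * i + ε • (i * u)) = ε • ((u * i + ε • (i * u)) * i) := by
    intro ε hε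
    rw [mul_add, add_mul, smul_add, mul_smul_comm, smul_mul_assoc, smul_smul, hε, one_smul,
      ← mul_assoc i i u, hi, mul_assoc u i i, hi, Algebra.commutes, add_comm, mul_assoc]
  by_cases h : u * i + (1 : K) • (i * u) = 0
  · refine ⟨-1, Or.inr rfl, ?_, key _ (by ring)⟩
    intro h'
    have : (2 : D) * (u * i) = 0 := by
      have : (2 : D) * (u * i) = (u * i + (1 : K) • (i * u)) + (u * i + (-1 : K) • (i * u)) := by
        rw [two_mul]; module
      rw [this, h, h', add_zero]
    exact mul_ne_zero two_ne_zero (mul_ne_zero hu hi0) this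
  · exact ⟨1, Or.inl rfl, h, key _ (by ring)⟩

lemma quad_of_deg {K D : Type*} [Field K] [DivisionRing D] [Algebra K D] [FiniteDimensional K D]
    (s : D) (h : (minpoly K s).natDegree = 1 ∨ (minpoly K s).natDegree = 2) :
    ∃ t n : K, s * s = t • s + n • (1 : D) := by
  have hintg : IsIntegral K s := Algebra.IsIntegral.isIntegral s
  have hmon := minpoly.monic hintg
  have h0 := minpoly.aeval K s
  have hl := hmon.coeff_natDegree
  rw [Polynomial.aeval_eq_sum_range] at h0
  rcases h with h | h
  · rw [h] at h0 hl
    simp [Finset.sum_range_succ, hl] at h0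
    refine ⟨-(minpoly K s).coeff 0, 0, ?_⟩
    have : s = (-(minpoly K s).coeff 0) • (1 : D) := by
      rw [neg_smul]; exact eq_neg_of_add_eq_zero_right h0
    nth_rw 1 [this]
    simp
  · rw [h] at h0 hl
    simp [Finset.sum_range_succ, hl] at h0
    refine ⟨-(minpoly K s).coeff 1, -(minpoly K s).coeff 0, ?_⟩
    rw [← pow_two, eq_neg_of_add_eq_zero_right h0]
    module

end Alg

set_option linter.unusedSectionVars false
set_option linter.deprecated false
set_option linter.style.haveILetI false
namespace Alg
open TensorProduct

lemma quad_S {K D : Type*} [Field K] [CharZero K] [DivisionRing D] [Algebra K D] [FiniteDimensional K D]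
    (h16 : Module.finrank K D = 16) (S : Submodule K D) (hS : Module.finrank K S = 4) (s s' : D)
    (hp : ∀ n : ℕ, s ^ n ∈ S) (hs' : s' ∈ S) (hne : s * s' ≠ s' * s) :
    ∃ t n : K, s * s = t • s + n • (1 : D) := by
  apply quad_of_deg
  have hli := linearIndependent_pow (K := K) s
  have hd := natDegree_dvd (K := K) s
  rw [h16] at hd
  have hli' : LinearIndependent K (fun i : Fin (minpoly K s).natDegree => (⟨s ^ (i : ℕ), hp i⟩ : S)) := by
    apply LinearIndependent.of_comp S.subtype
    exact hli
  have hle := hli'.fintype_card_le_finrank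
  rw [hS, Fintype.card_fin] at hle
  have h4 : (minpoly K s).natDegree ≠ 4 := by
    intro h4
    have hsp := hli'.span_eq_top_of_card_eq_finrank' (by rw [hS, Fintype.card_fin, h4])
    have : ∀ z : S, s * z = z * s := by
      intro z
      have hz : z ∈ Submodule.span K (Set.range (fun i : Fin (minpoly K s).natDegree => (⟨s ^ (i : ℕ), hp i⟩ : S))) := by
        rw [hsp]; trivial
      induction hz using Submodule.span_induction with
      | mem x hx => obtain ⟨i, rfl⟩ := hx; exact (Commute.self_pow s i).eq
      | zero => simp
      | add x y _ _ hx hy => rw [Submodule.coe_add, mul_add, hx, hy, add_mul]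
      | smul a x _ hx => rw [Submodule.coe_smul, mul_smul_comm, hx, smul_mul_assoc]
    exact hne (this ⟨s', hs'⟩)
  have h0 : (minpoly K s).natDegree ≠ 0 := (minpoly.natDegree_pos (IsIntegral.of_finite K s)).ne'
  have h3 : (minpoly K s).natDegree ≠ 3 := by intro h; rw [h] at hd; norm_num at hd
  omega

lemma anti_inv_comm {D : Type*} [DivisionRing D] (x a : D) (ha : a ≠ 0) (h : x * a = -(a * x)) :
    x * a⁻¹ = -(a⁻¹ * x) := by
  have h1 : a⁻¹ * (x * a) * a⁻¹ = a⁻¹ * (-(a * x)) * a⁻¹ := by rw [h]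
  have h2 : a⁻¹ * (x * a) * a⁻¹ = a⁻¹ * x := by
    rw [mul_assoc, mul_assoc, mul_inv_cancel₀ ha, mul_one]
  have h3 : a⁻¹ * (-(a * x)) * a⁻¹ = -(x * a⁻¹) := by
    rw [mul_neg, ← mul_assoc, inv_mul_cancel₀ ha, one_mul, neg_mul]
  rw [h2, h3] at h1
  rw [h1, neg_neg]

lemma noncomm_S {K D : Type*} [Field K] [CharZero K] [DivisionRing D] [Algebra K D]
    (hc : Cen K D) (x u : D) (e : K) (hx0 : x ≠ 0) (he : e ≠ 0) (hx : x * x = algebraMap K D e)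
    (hu0 : u ≠ 0) (hxu : x * u = -(u * x))
    (τ : D →ₗ[K] D) (hm : ∀ a b, τ (a * b) = τ b * τ a) (h2 : ∀ a, τ (τ a) = a) (hτx : τ x = -x)
    (hcomm : ∀ s s', x * s = s * x → τ s = s → x * s' = s' * x → τ s' = s' → s * s' = s' * s)
    (s : D) (hs : x * s = s * x) (hτs : τ s = s) : ∃ k : K, s = k • (1 : D) := by
  haveI : CharZero D := charZero_of_injective_algebraMap (algebraMap K D).injective
  have hτC : ∀ c, x * c = c * x → x * τ c = τ c * x := by
    intro c hcx
    have := congrArg τ hcx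
    rw [hm, hm, hτx, mul_neg, neg_mul, neg_inj] at this
    exact this.symm
  have hdec : ∀ c, x * c = c * x → ∃ s s', (x * s = s * x ∧ τ s = s) ∧ (x * s' = s' * x ∧ τ s' = s') ∧
      c = s + x * s' := by
    intro c hcx
    have hτc := hτC c hcx
    refine ⟨(2⁻¹ : K) • (c + τ c), ((2 * e)⁻¹ : K) • (x * (c - τ c)), ⟨?_, ?_⟩, ⟨?_, ?_⟩, ?_⟩
    · rw [mul_smul_comm, smul_mul_assoc, mul_add, add_mul, hcx, hτc]
    · rw [map_smul, map_add, h2, add_comm]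
    · rw [mul_smul_comm, smul_mul_assoc, mul_sub, hcx, hτc, ← sub_mul, mul_assoc, ← mul_assoc x, mul_sub,
        hcx, hτc, ← sub_mul, mul_assoc]
    · rw [map_smul, hm, map_sub, h2, hτx, mul_neg, ← neg_mul, neg_sub, mul_sub, sub_mul, hcx, hτc]
    · rw [mul_smul_comm, ← mul_assoc, hx, ← Algebra.smul_def, smul_smul]
      have : (2 * e)⁻¹ * e = 2⁻¹ := by field_simp
      rw [this]; module
  have hCc : ∀ c c', x * c = c * x → x * c' = c' * x → c * c' = c' * c := by
    intro c c' h h'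
    obtain ⟨a, b, ⟨a1, a2⟩, ⟨b1, b2⟩, rfl⟩ := hdec c h
    obtain ⟨a', b', ⟨a1', a2'⟩, ⟨b1', b2'⟩, rfl⟩ := hdec c' h'
    have c1 : Commute a a' := hcomm _ _ a1 a2 a1' a2'
    have c2 : Commute a b' := hcomm _ _ a1 a2 b1' b2'
    have c3 : Commute b a' := hcomm _ _ b1 b2 a1' a2'
    have c4 : Commute b b' := hcomm _ _ b1 b2 b1' b2'
    have xa : Commute x a := a1
    have xb : Commute x b := b1
    have xa' : Commute x a' := a1'
    have xb' : Commute x b' := b1'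
    have : Commute (a + x * b) (a' + x * b') :=
      ((c1.add_right (xa.symm.mul_right c2))).add_left
        ((xa'.mul_left c3).add_right (((Commute.refl x).mul_right xb').mul_left (xb.symm.mul_right c4)))
    exact this
  have hxu' := anti_inv_comm x u hu0 hxu
  -- elements of C commuting with u are in K
  have hK : ∀ p, x * p = p * x → u * p = p * u → ∃ k : K, p = algebraMap K D k := by
    intro p hp hup
    apply hc
    intro z
    have w1 : x * (z * x + x * z) = (z * x + x * z) * x := by
      rw [mul_add, add_mul, ← mul_assoc x x z, mul_assoc z x x, hx, Algebra.commutes, add_comm, mul_assoc]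
    have w2 : x * (z * x - x * z) = -((z * x - x * z) * x) := by
      rw [mul_sub, sub_mul, ← mul_assoc x x z, mul_assoc z x x, hx, Algebra.commutes, neg_sub, mul_assoc]
    have w3 : x * (u * (z * x - x * z)) = (u * (z * x - x * z)) * x := by
      rw [← mul_assoc, hxu, neg_mul, mul_assoc, w2, mul_neg, neg_neg, mul_assoc]
    have v1 := hCc p _ hp w1
    have v2 := hCc p _ hp w3
    have v3 : p * (z * x - x * z) = (z * x - x * z) * p := by
      apply mul_left_cancel₀ hu0
      rw [← mul_assoc, hup, mul_assoc, v2, mul_assoc]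
    have v4 : (2 : D) * (p * (z * x)) = (2 : D) * ((z * x) * p) := by
      have t1 : (2 : D) * (p * (z * x)) = p * (z * x + x * z) + p * (z * x - x * z) := by noncomm_ring
      have t2 : (2 : D) * ((z * x) * p) = (z * x + x * z) * p + (z * x - x * z) * p := by noncomm_ring
      rw [t1, t2, v1, v3]
    have v5 := mul_left_cancel₀ two_ne_zero v4
    apply mul_right_cancel₀ hx0
    rw [mul_assoc, v5, mul_assoc, hp, mul_assoc]
  obtain ⟨σ, hσ⟩ : ∃ σ, σ = u * s * u⁻¹ := ⟨_, rfl⟩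
  have hσu : σ * u = u * s := by rw [hσ, mul_assoc, inv_mul_cancel₀ hu0, mul_one]
  have hσC : x * σ = σ * x := by
    apply mul_right_cancel₀ hu0
    rw [mul_assoc, hσu, ← mul_assoc, hxu, neg_mul, mul_assoc, hs, mul_assoc, hxu, mul_neg, ← mul_assoc σ,
      hσu, mul_assoc]
  have huuC : x * (u * u) = (u * u) * x := by
    rw [← mul_assoc, hxu, neg_mul, mul_assoc, hxu, mul_neg, neg_neg, mul_assoc]
  have huσ : u * σ = s * u := by
    apply mul_right_cancel₀ hu0
    rw [mul_assoc, hσu, ← mul_assoc, mul_assoc s, hCc s _ hs huuC]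
  obtain ⟨k1, hk1⟩ := hK (s + σ) (by rw [mul_add, add_mul, hs, hσC]) (by
    rw [mul_add, add_mul, huσ, hσu, add_comm])
  obtain ⟨k2, hk2⟩ := hK (x * (s - σ)) (by
    rw [mul_assoc]; congr 1; rw [mul_sub, sub_mul, hs, hσC]) (by
    have hux : u * x = -(x * u) := by rw [hxu, neg_neg]
    rw [← mul_assoc, hux, neg_mul, mul_assoc, mul_assoc, mul_sub, sub_mul, huσ, hσu, ← mul_neg, neg_sub])
  have hτ1 : ∀ k : K, τ (algebraMap K D k) = algebraMap K D k := by
    have : τ 1 = 1 := by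
      have a1 : τ (1 * τ 1) = τ (τ 1) * τ 1 := hm _ _
      rw [one_mul, h2, one_mul] at a1
      exact a1.symm
    intro k
    rw [Algebra.algebraMap_eq_smul_one, map_smul, this]
  have f1 : x * (s + s) = algebraMap K D k1 * x + algebraMap K D k2 := by
    rw [← hk2, ← hk1, add_mul, ← hs, ← hσC]; noncomm_ring
  have f2 : -(x * (s + s)) = -(algebraMap K D k1 * x) + algebraMap K D k2 := by
    have := congrArg τ f1
    rw [hm, map_add, map_add, hm, hτ1, hτ1, hτs, hτx, mul_neg, neg_mul, add_mul, ← hs, ← mul_add,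
      ← Algebra.commutes k1 x] at this
    exact this
  have f3 : x * (s + s) = x * algebraMap K D k1 := by
    rw [← Algebra.commutes k1 x]
    have : (2 : D) * (x * (s + s)) = 2 * (algebraMap K D k1 * x) := by
      linear_combination (norm := noncomm_ring) f1 - f2
    exact mul_left_cancel₀ two_ne_zero this
  have f4 := mul_left_cancel₀ hx0 f3
  refine ⟨2⁻¹ * k1, ?_⟩
  rw [mul_smul, ← Algebra.algebraMap_eq_smul_one, ← f4]
  module

end Alg

set_option linter.unusedSectionVars false
set_option linter.deprecated false
set_option linter.style.haveILetI false
namespace Alg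
open TensorProduct

theorem deg_four {K D : Type*} [Field K] [NumberField K] [DivisionRing D] [Algebra K D]
    [FiniteDimensional K D] (hc : Cen K D) (ha : Anti K D) (h16 : Module.finrank K D = 16)
    (x : D) (e : K) (hx : x * x = algebraMap K D e) (hxK : ∀ k : K, x ≠ algebraMap K D k) : False := by
  haveI : CharZero D := charZero_of_injective_algebraMap (algebraMap K D).injective
  have hinjK := (algebraMap K D).injective
  have hx0 : x ≠ 0 := fun h => hxK 0 (by rw [h, map_zero])
  have he : e ≠ 0 := by
    rintro rfl
    rw [map_zero] at hx
    exact mul_ne_zero hx0 hx0 hx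
  have hnc : ∃ y, x * y ≠ y * x := by
    by_contra hcon
    push Not at hcon
    obtain ⟨k, hk⟩ := hc x hcon
    exact hxK k hk
  obtain ⟨τ, hm, h2, hτx⟩ := inv_neg (inv_of_anti hc ha) x e hx hnc
  have hτ1 : τ 1 = 1 := by
    have a1 : τ (1 * τ 1) = τ (τ 1) * τ 1 := hm _ _
    rw [one_mul, h2, one_mul] at a1
    exact a1.symm
  have hτC : ∀ c, x * c = c * x → x * τ c = τ c * x := by
    intro c hcx
    have := congrArg τ hcx
    rw [hm, hm, hτx, mul_neg, neg_mul, neg_inj] at this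
    exact this.symm
  obtain ⟨u, hu0, hxu⟩ : ∃ u, u ≠ 0 ∧ x * u = -(u * x) := by
    obtain ⟨y, hy⟩ := hnc
    refine ⟨x * y - y * x, sub_ne_zero.mpr hy, ?_⟩
    rw [mul_sub, sub_mul, ← mul_assoc x x y, mul_assoc y x x, hx, Algebra.commutes, neg_sub, mul_assoc]
  -- the centralizer of x
  obtain ⟨C, hC⟩ : ∃ C : Submodule K D, C = ⊤ ⊓ LinearMap.ker (cj K x - LinearMap.id) := ⟨_, rfl⟩
  have mC : ∀ z, z ∈ C ↔ x * z = z * x := by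
    intro z; rw [hC, Submodule.mem_inf, cj_fix K x z hx0]; simp
  have dC : Module.finrank K C = 8 := by
    have := half (K := K) (⊤ : Submodule K D) (cj K x) (fun _ _ => trivial) (fun w _ => cj_sq K x w hx0 e hx)
      u hu0 (fun _ _ => trivial) (fun w _ => cj_anti K x w u hxu)
    rw [← hC, finrank_top, h16] at this
    omega
  obtain ⟨S, hS⟩ : ∃ S : Submodule K D, S = C ⊓ LinearMap.ker (τ - LinearMap.id) := ⟨_, rfl⟩
  have mS : ∀ z, z ∈ S ↔ x * z = z * x ∧ τ z = z := by
    intro z; rw [hS, Submodule.mem_inf, mC]; simp [sub_eq_zero]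
  have dS : Module.finrank K S = 4 := by
    have := half (K := K) C τ (fun w hw => (mC _).mpr (hτC w ((mC w).mp hw))) (fun w _ => h2 w)
      x hx0 (fun w hw => (mC _).mpr (by rw [mul_assoc, (mC w).mp hw])) (fun w hw => by
        rw [hm, hτx, mul_neg, hτC w ((mC w).mp hw)])
    rw [← hS, dC] at this
    omega
  obtain ⟨s, s', hsS, hsS', hss⟩ : ∃ s s', s ∈ S ∧ s' ∈ S ∧ s * s' ≠ s' * s := by
    by_contra hcon
    push Not at hcon
    have := noncomm_S hc x u e hx0 he hx hu0 hxu τ hm h2 hτx (fun s s' a b c d =>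
      hcon s s' ((mS s).mpr ⟨a, b⟩) ((mS s').mpr ⟨c, d⟩))
    have hle : S ≤ Submodule.span K {(1 : D)} := by
      intro z hz
      obtain ⟨k, hk⟩ := this z ((mS z).mp hz).1 ((mS z).mp hz).2
      rw [hk]
      exact Submodule.smul_mem _ _ (Submodule.mem_span_singleton_self _)
    have h3 := Submodule.finrank_mono hle
    rw [dS, finrank_span_singleton one_ne_zero] at h3
    omega
  have hpow : ∀ s ∈ S, ∀ n : ℕ, s ^ n ∈ S := by
    intro s hs n
    obtain ⟨a1, a2⟩ := (mS s).mp hs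
    rw [mS]
    refine ⟨(Commute.pow_right a1 n).eq, ?_⟩
    induction n with
    | zero => simpa using hτ1
    | succ n ih => rw [pow_succ, hm, ih, a2, ← pow_succ']; rw [pow_succ]
  obtain ⟨t, n, htn⟩ := quad_S h16 S dS s s' (hpow s hsS) hsS' hss
  have h1S : (1 : D) ∈ S := (mS 1).mpr ⟨by simp, hτ1⟩
  -- the element i
  obtain ⟨i, hi⟩ : ∃ i, i = s - (t / 2) • (1 : D) := ⟨_, rfl⟩
  obtain ⟨b, hbd⟩ : ∃ b, b = n + t ^ 2 / 4 := ⟨_, rfl⟩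
  have hiS : i ∈ S := by rw [hi]; exact S.sub_mem hsS (S.smul_mem _ h1S)
  have hii : i * i = algebraMap K D b := by
    have : i * i = s * s - t • s + (t ^ 2 / 4) • (1 : D) := by
      rw [hi]
      simp only [sub_mul, mul_sub, mul_smul_comm, smul_mul_assoc, mul_one, one_mul, smul_smul]
      module
    rw [this, htn, hbd, Algebra.algebraMap_eq_smul_one]
    module
  have his' : i * s' ≠ s' * i := by
    intro h
    apply hss
    have : s = i + (t / 2) • (1 : D) := by rw [hi]; abel
    rw [this, add_mul, mul_add, h, smul_mul_assoc, mul_smul_comm, one_mul, mul_one]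
  have hi0 : i ≠ 0 := by rintro rfl; simp at his'
  have hb : b ≠ 0 := by
    rintro rfl
    rw [map_zero] at hii
    exact mul_ne_zero hi0 hi0 hii
  obtain ⟨hxi, hτi⟩ := (mS i).mp hiS
  obtain ⟨hxs', hτs'⟩ := (mS s').mp hsS'
  -- the element j
  obtain ⟨j, hj⟩ : ∃ j, j = b • s' - i * s' * i := ⟨_, rfl⟩
  have hjS : j ∈ S := by
    rw [mS, hj]
    constructor
    · have c1 : Commute x i := hxi
      have c2 : Commute x s' := hxs'
      exact ((c2.smul_right b).sub_right ((c1.mul_right c2).mul_right c1)).eq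
    · rw [map_sub, map_smul, hm, hm, hτi, hτs', mul_assoc]
  have hij1 : i * j = b • (i * s' - s' * i) := by
    rw [hj, mul_sub, mul_smul_comm, ← mul_assoc, ← mul_assoc, hii, smul_sub, mul_assoc,
      ← Algebra.smul_def]
  have hji1 : j * i = b • (s' * i - i * s') := by
    rw [hj, sub_mul, smul_mul_assoc, mul_assoc (i * s'), hii, smul_sub, ← Algebra.commutes,
      ← Algebra.smul_def]
  have hij : i * j = -(j * i) := by rw [hij1, hji1, ← smul_neg, neg_sub]
  have hij0 : i * j ≠ 0 := by
    rw [hij1]; exact smul_ne_zero hb (sub_ne_zero.mpr his')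
  have hj0 : j ≠ 0 := by rintro rfl; simp at hij0
  have hji : j * i = -(i * j) := by rw [hij, neg_neg]
  have hjine : j * i ≠ i * j := by
    intro h
    rw [hji] at h
    exact hij0 (neg_eq_self.mp h)
  obtain ⟨t', c, htc⟩ := quad_S h16 S dS j i (hpow j hjS) hiS hjine
  have ht' : t' = 0 := by
    have e1 : i * (j * j) = (j * j) * i := by
      rw [← mul_assoc, hij, neg_mul, mul_assoc, hij, mul_neg, neg_neg, mul_assoc]
    rw [htc, mul_add, add_mul, mul_smul_comm, mul_smul_comm, smul_mul_assoc, smul_mul_assoc, mul_one,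
      one_mul, add_left_inj, hji, smul_neg] at e1
    have e2 := self_eq_neg.mp e1
    exact (smul_eq_zero.mp e2).resolve_right hij0
  have hjj : j * j = algebraMap K D c := by
    rw [htc, ht', zero_smul, zero_add, Algebra.algebraMap_eq_smul_one]
  have hcc : c ≠ 0 := by
    rintro rfl
    rw [map_zero] at hjj
    exact mul_ne_zero hj0 hj0 hjj
  obtain ⟨hxj, hτj⟩ := (mS j).mp hjS
  -- the element l
  obtain ⟨l, hl0, hxl, hil, hjl⟩ : ∃ l, l ≠ 0 ∧ x * l = -(l * x) ∧ i * l = l * i ∧ j * l = l * j := by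
    obtain ⟨ε, hε, hv0, hv⟩ := sign_split i u b hii hi0 hu0
    obtain ⟨v, hvd⟩ : ∃ v, v = u * i + ε • (i * u) := ⟨_, rfl⟩
    rw [← hvd] at hv0 hv
    have hxv : x * v = -(v * x) := by
      rw [hvd, mul_add, add_mul, mul_smul_comm, smul_mul_assoc, ← mul_assoc, hxu, ← mul_assoc, hxi,
        mul_assoc i x u, hxu, neg_mul, mul_assoc u x i, hxi, mul_neg, smul_neg, neg_add]
      simp only [mul_assoc]
    obtain ⟨δ, hδ, hw0, hw⟩ := sign_split j v c hjj hj0 hv0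
    obtain ⟨w, hwd⟩ : ∃ w, w = v * j + δ • (j * v) := ⟨_, rfl⟩
    rw [← hwd] at hw0 hw
    have hxw : x * w = -(w * x) := by
      rw [hwd, mul_add, add_mul, mul_smul_comm, smul_mul_assoc, ← mul_assoc, hxv, ← mul_assoc, hxj,
        mul_assoc j x v, hxv, neg_mul, mul_assoc v x j, hxj, mul_neg, smul_neg, neg_add]
      simp only [mul_assoc]
    have hiw : i * w = (-ε) • (w * i) := by
      have p1 : i * (v * j) = (-ε) • (v * j * i) := by
        rw [← mul_assoc, hv, smul_mul_assoc, mul_assoc v i j, hij, mul_neg, smul_neg, neg_smul, mul_assoc]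
      have p2 : i * (j * v) = (-ε) • (j * v * i) := by
        rw [← mul_assoc, hij, neg_mul, mul_assoc, hv, mul_smul_comm, neg_smul, mul_assoc]
      rw [hwd, mul_add, add_mul, mul_smul_comm, smul_mul_assoc, p1, p2, smul_add, smul_comm]
    have hxi' : ∀ z, x * z = -(z * x) → x * (i * z) = -(i * z * x) := by
      intro z hz
      rw [← mul_assoc, hxi, mul_assoc, hz, mul_neg, mul_assoc]
    have hxj' : ∀ z, x * z = -(z * x) → x * (j * z) = -(j * z * x) := by
      intro z hz
      rw [← mul_assoc, hxj, mul_assoc, hz, mul_neg, mul_assoc]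
    rcases hε with rfl | rfl
    · rw [neg_smul, one_smul] at hiw
      rcases hδ with rfl | rfl
      · rw [one_smul] at hw
        refine ⟨j * w, mul_ne_zero hj0 hw0, hxj' w hxw, ?_, ?_⟩
        · rw [← mul_assoc, hij, neg_mul, mul_assoc, hiw, mul_neg, neg_neg, mul_assoc]
        · rw [mul_assoc, hw]
      · rw [neg_smul, one_smul] at hw
        refine ⟨j * (i * w), mul_ne_zero hj0 (mul_ne_zero hi0 hw0), hxj' _ (hxi' w hxw), ?_, ?_⟩
        · rw [← mul_assoc, hij, neg_mul, mul_assoc j i (i * w), mul_assoc j (i * w) i, mul_assoc i w i, hiw]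
          simp [hiw]
        · rw [mul_assoc j (i * w) j, mul_assoc i w j, ← neg_eq_iff_eq_neg.mpr hw, ← mul_assoc j i w, hji]
          simp [mul_assoc]
    · rw [neg_neg, one_smul] at hiw
      rcases hδ with rfl | rfl
      · rw [one_smul] at hw
        exact ⟨w, hw0, hxw, hiw, hw⟩
      · rw [neg_smul, one_smul] at hw
        refine ⟨i * w, mul_ne_zero hi0 hw0, hxi' w hxw, ?_, ?_⟩
        · rw [mul_assoc, hiw]
        · rw [← mul_assoc, hji, neg_mul, mul_assoc, hw, mul_neg, neg_neg, mul_assoc]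
  -- commutants
  obtain ⟨W2, hW2⟩ : ∃ W : Submodule K D, W = C ⊓ LinearMap.ker (cj K i - LinearMap.id) := ⟨_, rfl⟩
  have m2 : ∀ z, z ∈ W2 ↔ x * z = z * x ∧ i * z = z * i := by
    intro z; rw [hW2, Submodule.mem_inf, mC, cj_fix K i z hi0]
  have cjC : ∀ a z p : D, a * p = p * a → p * z = z * p → p * cj K a z = cj K a z * p := by
    intro a z p h1 h2
    have c1 : Commute p a := h1.symm
    have c2 : Commute p z := h2
    rw [cj_apply]
    exact (c1.mul_right (c2.mul_right c1.inv_right₀)).eq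
  have d2 : Module.finrank K W2 = 4 := by
    have := half (K := K) C (cj K i) (fun w hw => (mC _).mpr (cjC i w x hxi.symm ((mC w).mp hw)))
      (fun w _ => cj_sq K i w hi0 b hii) j hj0 (fun w hw => (mC _).mpr (by
        rw [← mul_assoc, hxj, mul_assoc, (mC w).mp hw, mul_assoc])) (fun w _ => cj_anti K i w j hij)
    rw [← hW2, dC] at this
    omega
  obtain ⟨W3, hW3⟩ : ∃ W : Submodule K D, W = W2 ⊓ LinearMap.ker (cj K j - LinearMap.id) := ⟨_, rfl⟩
  have m3 : ∀ z, z ∈ W3 ↔ (x * z = z * x ∧ i * z = z * i) ∧ j * z = z * j := by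
    intro z; rw [hW3, Submodule.mem_inf, m2, cj_fix K j z hj0]
  have cji : ∀ z, i * z = z * i → i * cj K j z = cj K j z * i := by
    intro z hz
    have q := anti_inv_comm i j hj0 hij
    rw [cj_apply, ← mul_assoc, hij, neg_mul, mul_assoc, ← mul_assoc i z, hz, mul_assoc z i, q]
    simp [mul_assoc]
  have d3 : Module.finrank K W3 = 2 := by
    have := half (K := K) W2 (cj K j) (fun w hw => (m2 _).mpr ⟨cjC j w x hxj.symm ((m2 w).mp hw).1,
        cji w ((m2 w).mp hw).2⟩)
      (fun w _ => cj_sq K j w hj0 c hjj) i hi0 (fun w hw => (m2 _).mpr ⟨by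
        rw [← mul_assoc, hxi, mul_assoc, ((m2 w).mp hw).1, mul_assoc], by
        rw [mul_assoc, ((m2 w).mp hw).2]⟩) (fun w _ => cj_anti K j w i hji)
    rw [← hW3, d2] at this
    omega
  have hZ : ∀ z ∈ W3, ∃ p q : K, z = p • (1 : D) + q • x := by
    have hli : LinearIndependent K ![(1 : D), x] := by
      rw [LinearIndependent.pair_iff' one_ne_zero]
      intro k hk
      exact hxK k (by rw [← hk, Algebra.algebraMap_eq_smul_one])
    have hle : Submodule.span K (Set.range ![(1 : D), x]) ≤ W3 := by
      rw [Submodule.span_le]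
      rintro _ ⟨q, rfl⟩
      fin_cases q
      · exact (m3 _).mpr (by simp)
      · exact (m3 _).mpr ⟨⟨rfl, hxi.symm⟩, hxj.symm⟩
    have heq := Submodule.eq_of_le_of_finrank_eq hle (by
      rw [d3, finrank_span_eq_card hli]; simp)
    intro z hz
    rw [← heq, Matrix.range_cons, Matrix.range_cons, Matrix.range_empty, Set.union_empty,
      Set.singleton_union, Submodule.mem_span_pair] at hz
    obtain ⟨p, q, h⟩ := hz
    exact ⟨p, q, h.symm⟩
  obtain ⟨f, q, hfq⟩ := hZ (l * l) ((m3 _).mpr ⟨⟨by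
      rw [← mul_assoc, hxl, neg_mul, mul_assoc, hxl, mul_neg, neg_neg, mul_assoc], by
      rw [← mul_assoc, hil, mul_assoc, hil, mul_assoc]⟩, by
      rw [← mul_assoc, hjl, mul_assoc, hjl, mul_assoc]⟩)
  have hq : q = 0 := by
    have e1 : l * (l * l) = (l * l) * l := by rw [mul_assoc]
    rw [hfq, mul_add, add_mul, mul_smul_comm, mul_smul_comm, smul_mul_assoc, smul_mul_assoc, mul_one,
      one_mul, add_right_inj, hxl, smul_neg] at e1
    exact (smul_eq_zero.mp (self_eq_neg.mp e1)).resolve_right (mul_ne_zero hl0 hx0)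
  have hll : l * l = algebraMap K D f := by
    rw [hfq, hq, zero_smul, add_zero, Algebra.algebraMap_eq_smul_one]
  have hf : f ≠ 0 := by
    rintro rfl
    rw [map_zero] at hll
    exact mul_ne_zero hl0 hl0 hll
  exact no_biquat b c e f i j x l hb hcc he hf hii hjj hij hx hll hxl hxi.symm hil hxj.symm hjl

end Alg

set_option linter.unusedSectionVars false
set_option linter.deprecated false
set_option linter.style.haveILetI false
namespace Alg
open TensorProduct

lemma quad_gen {K F : Type*} [Field K] [CharZero K] [Field F] [Algebra K F] (h2 : Module.finrank K F = 2) :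
    ∃ (z : F) (e : K), z * z = algebraMap K F e ∧ LinearIndependent K ![(1 : F), z] := by
  haveI : FiniteDimensional K F := Module.finite_of_finrank_pos (by omega)
  obtain ⟨w, hw⟩ : ∃ w : F, ∀ k : K, k • (1 : F) ≠ w := by
    by_contra hcon
    push Not at hcon
    have := finrank_eq_one (R := K) (1 : F) one_ne_zero hcon
    omega
  have hli : LinearIndependent K ![(1 : F), w] := by
    rw [LinearIndependent.pair_iff' one_ne_zero]
    exact hw
  have hsp := hli.span_eq_top_of_card_eq_finrank' (by simp [h2])
  have hmem : w * w ∈ Submodule.span K (Set.range ![(1 : F), w]) := by rw [hsp]; trivial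
  rw [Matrix.range_cons, Matrix.range_cons, Matrix.range_empty, Set.union_empty,
      Set.singleton_union, Submodule.mem_span_pair] at hmem
  obtain ⟨p, q, hpq⟩ := hmem
  refine ⟨w - (q / 2) • (1 : F), p + q ^ 2 / 4, ?_, ?_⟩
  · have : (w - (q / 2) • (1 : F)) * (w - (q / 2) • (1 : F)) = w * w - q • w + (q ^ 2 / 4) • (1 : F) := by
      simp only [sub_mul, mul_sub, mul_smul_comm, smul_mul_assoc, mul_one, one_mul]
      module
    rw [this, ← hpq, Algebra.algebraMap_eq_smul_one]
    module
  · rw [LinearIndependent.pair_iff' one_ne_zero]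
    intro k hk
    apply hw (k + q / 2)
    rw [add_smul, hk]; abel

lemma zero_div {K F D : Type*} [Field K] [CharZero K] [Field F] [Algebra K F] [DivisionRing D] [Algebra K D]
    (h2 : Module.finrank K F = 2) (X Y : F ⊗[K] D) (hX : X ≠ 0) (hY : Y ≠ 0) (hXY : X * Y = 0) :
    ∃ (x : D) (e : K), x * x = algebraMap K D e ∧ ∀ k : K, x ≠ algebraMap K D k := by
  obtain ⟨z, e, hz, hli⟩ := quad_gen h2
  let B := basisOfLinearIndependentOfCardEqFinrank hli (by simp [h2])
  have hB0 : B 0 = 1 := by simp [B]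
  have hB1 : B 1 = z := by simp [B]
  have hrep : ∀ X : F ⊗[K] D, ∃ a b : D, X = 1 ⊗ₜ a + z ⊗ₜ b := by
    intro X
    obtain ⟨c, hc⟩ := TensorProduct.eq_repr_basis_left B X
    refine ⟨c 0, c 1, ?_⟩
    rw [← hc, Finsupp.sum_fintype _ _ (by simp), Fin.sum_univ_two, hB0, hB1]
  have huniq : ∀ a b : D, (1 : F) ⊗ₜ[K] a + z ⊗ₜ[K] b = 0 → a = 0 ∧ b = 0 := by
    intro a b h
    have := TensorProduct.sum_tmul_basis_left_eq_zero B (Finsupp.equivFunOnFinite.symm ![a, b]) (by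
      rw [Finsupp.sum_fintype _ _ (by simp), Fin.sum_univ_two, hB0, hB1]
      simpa using h)
    have e0 := DFunLike.congr_fun this 0
    have e1 := DFunLike.congr_fun this 1
    simp at e0 e1
    exact ⟨e0, e1⟩
  obtain ⟨a, b, hab⟩ := hrep X
  obtain ⟨c, d, hcd⟩ := hrep Y
  have hb : b ≠ 0 := by
    rintro rfl
    rw [tmul_zero, add_zero] at hab
    have ha : a ≠ 0 := by rintro rfl; exact hX (by rw [hab, tmul_zero])
    apply hY
    have : ((1 : F) ⊗ₜ[K] a⁻¹) * (X * Y) = Y := by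
      rw [← mul_assoc, hab, Algebra.TensorProduct.tmul_mul_tmul, inv_mul_cancel₀ ha, mul_one,
        ← Algebra.TensorProduct.one_def, one_mul]
    rw [← this, hXY, mul_zero]
  obtain ⟨a', ha'⟩ : ∃ a', a' = b⁻¹ * a := ⟨_, rfl⟩
  have hX' : ((1 : F) ⊗ₜ[K] a' + z ⊗ₜ[K] (1 : D)) * Y = 0 := by
    have : ((1 : F) ⊗ₜ[K] b⁻¹) * X = (1 : F) ⊗ₜ[K] a' + z ⊗ₜ[K] (1 : D) := by
      rw [hab, mul_add, Algebra.TensorProduct.tmul_mul_tmul, Algebra.TensorProduct.tmul_mul_tmul,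
        inv_mul_cancel₀ hb, one_mul, one_mul, ha']
    rw [← this, mul_assoc, hXY, mul_zero]
  have hzz : (z * z) ⊗ₜ[K] d = (1 : F) ⊗ₜ[K] (algebraMap K D e * d) := by
    rw [hz, Algebra.algebraMap_eq_smul_one, TensorProduct.smul_tmul, Algebra.smul_def]
  rw [hcd, mul_add, add_mul, add_mul, Algebra.TensorProduct.tmul_mul_tmul,
    Algebra.TensorProduct.tmul_mul_tmul, Algebra.TensorProduct.tmul_mul_tmul,
    Algebra.TensorProduct.tmul_mul_tmul, one_mul, one_mul, one_mul, one_mul, mul_one, hzz] at hX'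
  have hX2 : (1 : F) ⊗ₜ[K] (a' * c + algebraMap K D e * d) + z ⊗ₜ[K] (c + a' * d) = 0 := by
    rw [← hX', tmul_add, tmul_add]; abel
  obtain ⟨e1, e2⟩ := huniq _ _ hX2
  have hc : c = -(a' * d) := eq_neg_of_add_eq_zero_left e2
  have hd : d ≠ 0 := by
    rintro rfl
    rw [mul_zero, neg_zero] at hc
    apply hY
    rw [hcd, hc, tmul_zero, tmul_zero, add_zero]
  have hsq : a' * a' = algebraMap K D e := by
    rw [hc, mul_neg, ← mul_assoc] at e1
    exact mul_right_cancel₀ hd (neg_add_eq_zero.mp e1)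
  refine ⟨a', e, hsq, ?_⟩
  intro k hk
  rw [hk, ← map_mul] at hsq
  have hk2 := (algebraMap K D).injective hsq
  rw [LinearIndependent.pair_iff' one_ne_zero] at hli
  have : (z - algebraMap K F k) * (z + algebraMap K F k) = 0 := by
    have : (z - algebraMap K F k) * (z + algebraMap K F k) = z * z - algebraMap K F (k * k) := by
      rw [map_mul]; ring
    rw [this, hz, hk2, sub_self]
  rcases mul_eq_zero.mp this with h | h
  · exact hli k (by rw [← Algebra.algebraMap_eq_smul_one, sub_eq_zero.mp h])
  · exact hli (-k) (by rw [← Algebra.algebraMap_eq_smul_one, map_neg, eq_neg_of_add_eq_zero_left h])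

universe u v

theorem tower (a : ℕ) : ∀ (K N : Type u) [Field K] [NumberField K] [Field N] [Algebra K N]
    [FiniteDimensional K N] [IsGalois K N] (D : Type (max u v)) [DivisionRing D] [Algebra K D]
    [FiniteDimensional K D] (m : ℕ), Module.finrank K N = 2 ^ a → Cen K D → Anti K D →
    Module.finrank K D = m ^ 2 → (D →ₐ[K] Matrix (Fin m) (Fin m) N) → m ≤ 2 := by
  induction a with
  | zero =>
    intro K N _ _ _ _ _ _ D _ _ _ m hN hc ha hm φ
    obtain ⟨r, d, D', _, _, _, -, -, -, -, hmr, hr, hd, -⟩ := reduce (F := K) hc ha m hm φ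
    rw [hN, pow_zero, Nat.dvd_one] at hd
    rw [Module.finrank_self, Nat.dvd_one] at hr
    rw [hmr, hd, hr]; norm_num
  | succ a ih =>
    intro K N _ _ _ _ _ _ D _ _ _ m hN hc ha hm φ
    haveI : Fact (Nat.Prime 2) := ⟨Nat.prime_two⟩
    obtain ⟨H, hH⟩ := Sylow.exists_subgroup_card_pow_prime (G := Gal(N/K)) 2 (n := a) (by
      rw [IsGalois.card_aut_eq_finrank, hN, pow_succ]; exact dvd_mul_right _ _)
    have hFN := IntermediateField.finrank_fixedField_eq_card H
    rw [hH] at hFN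
    let F := IntermediateField.fixedField H
    have hKF : Module.finrank K F = 2 := by
      have h1 := Module.finrank_mul_finrank K F N
      rw [hN, pow_succ, hFN, mul_comm] at h1
      exact Nat.eq_of_mul_eq_mul_left (by positivity) h1
    haveI : NumberField F := NumberField.of_module_finite K F
    obtain ⟨r, d, D', _, _, _, hc', ha', hfd, ⟨φ'⟩, hmr, hr, hd, ⟨e⟩⟩ := reduce (F := F) hc ha m hm φ
    have hd2 := ih F N D' d hFN hc' ha' hfd φ'
    rw [hKF] at hr
    rcases (Nat.dvd_prime Nat.prime_two).mp hr with h | h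
    · rw [hmr, h, one_mul]; exact hd2
    · by_contra hm2
      have hd' : d = 2 := by rw [hmr, h] at hm2; omega
      subst h
      rw [hd'] at hmr
      have h16 : Module.finrank K D = 16 := by rw [hm, hmr]; norm_num
      have hz := zero_div (D := D) hKF (e.symm (Matrix.single 0 0 1)) (e.symm (Matrix.single 1 1 1)) (by
          intro h0
          have := congrFun (congrFun ((map_eq_zero_iff e.symm e.symm.injective).mp h0) 0) 0
          simp at this) (by
          intro h0
          have := congrFun (congrFun ((map_eq_zero_iff e.symm e.symm.injective).mp h0) 1) 1
          simp at this) (by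
          rw [← map_mul, Matrix.single_mul_single_of_ne, map_zero]
          exact zero_ne_one)
      obtain ⟨x, e0, hx, hxK⟩ := hz
      exact deg_four hc ha h16 x e0 hx hxK

theorem splitting (K : Type u) (D : Type v) [Field K] [CharZero K] [DivisionRing D] [Algebra K D]
    [FiniteDimensional K D] (hc : Cen K D) :
    ∃ (N : Type u) (_ : Field N) (_ : Algebra K N) (_ : FiniteDimensional K N) (_ : IsGalois K N) (m : ℕ),
      Module.finrank K D = m ^ 2 ∧ Nonempty (D →ₐ[K] Matrix (Fin m) (Fin m) N) := by
  let A := AlgebraicClosure K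
  haveI : IsSimpleRing (A ⊗[K] D) := simple_tensor A hc
  obtain ⟨m, _, ⟨e⟩⟩ := IsSimpleRing.exists_algEquiv_matrix_of_isAlgClosed A (A ⊗[K] D)
  have hm : Module.finrank K D = m ^ 2 := by
    rw [← Module.finrank_baseChange (R := A) (M' := D), e.toLinearEquiv.finrank_eq, Module.finrank_matrix]
    simp [pow_two]
  let φ : D →ₐ[K] Matrix (Fin m) (Fin m) A :=
    (e.toAlgHom.restrictScalars K).comp (Algebra.TensorProduct.includeRight)
  let b := Module.finBasis K D
  let T : Set A := Set.range (fun t : Fin (Module.finrank K D) × Fin m × Fin m => φ (b t.1) t.2.1 t.2.2)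
  let E := IntermediateField.adjoin K T
  haveI : FiniteDimensional K E := by
    apply IntermediateField.finiteDimensional_adjoin
    intro x _
    exact Algebra.IsIntegral.isIntegral x
  let N := IntermediateField.normalClosure K E A
  haveI : FiniteDimensional K N := normalClosure.is_finiteDimensional K E A
  haveI : Normal K N := normalClosure.normal K E A
  haveI : IsGalois K N := {}
  have hEN : E ≤ N := IntermediateField.le_normalClosure E
  have hent : ∀ d i j, φ d i j ∈ N := by
    intro d i j
    rw [← b.sum_repr d, map_sum, Matrix.sum_apply]
    apply sum_mem
    intro t _
    rw [map_smul, Matrix.smul_apply]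
    apply IntermediateField.smul_mem
    exact hEN (IntermediateField.subset_adjoin K T ⟨(t, i, j), rfl⟩)
  let ι : Matrix (Fin m) (Fin m) N →ₐ[K] Matrix (Fin m) (Fin m) A := N.val.mapMatrix
  have hι : Function.Injective ι := by
    intro M M' h
    ext i j
    exact congrFun (congrFun h i) j
  refine ⟨N, inferInstance, inferInstance, inferInstance, inferInstance, m, hm, ⟨?_⟩⟩
  exact (AlgEquiv.ofInjective ι hι).symm.toAlgHom.comp (φ.codRestrict ι.range (fun d =>
    ⟨Matrix.of (fun i j => ⟨φ d i j, hent d i j⟩), by ext i j; rfl⟩))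

lemma sylow_field {K N : Type u} [Field K] [Field N] [Algebra K N] [FiniteDimensional K N] [IsGalois K N]
    (p : ℕ) (hp : p.Prime) : ∃ (F : IntermediateField K N) (n : ℕ),
      Module.finrank F N = p ^ n ∧ ¬ p ∣ Module.finrank K F := by
  haveI : Fact p.Prime := ⟨hp⟩
  let P : Sylow p Gal(N/K) := default
  have h1 := IntermediateField.finrank_fixedField_eq_card (F := K) (E := N) (P : Subgroup Gal(N/K))
  obtain ⟨n, hn⟩ := IsPGroup.iff_card.mp P.isPGroup'
  refine ⟨IntermediateField.fixedField (P : Subgroup Gal(N/K)), n, h1.trans hn, ?_⟩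
  have h2 := Module.finrank_mul_finrank K (IntermediateField.fixedField (P : Subgroup Gal(N/K))) N
  have h3 := Subgroup.card_mul_index (P : Subgroup Gal(N/K))
  rw [IsGalois.card_aut_eq_finrank, ← h2, h1, mul_comm] at h3
  rw [← Nat.eq_of_mul_eq_mul_right Nat.card_pos h3]
  exact P.not_dvd_index

theorem main {K : Type u} {D : Type v} [Field K] [NumberField K] [DivisionRing D] [Algebra K D]
    [FiniteDimensional K D] (hc : Cen K D) (ha : Anti K D) :
    Module.finrank K D = 1 ∨ Module.finrank K D = 4 := by
  obtain ⟨N, _, _, _, _, m, hm, ⟨φ⟩⟩ := splitting K D hc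
  have hpos : 0 < Module.finrank K D := Module.finrank_pos
  have hodd : ∀ p : ℕ, p.Prime → p ≠ 2 → ¬ p ∣ m := by
    intro p hp hp2 hpm
    obtain ⟨F, n, hn, hF⟩ := sylow_field (K := K) (N := N) p hp
    obtain ⟨r, d, D', _, _, _, hc', ha', hfd, -, hmr, hr, hd, -⟩ := reduce (F := F) hc ha m hm φ
    rw [hn] at hd
    have hdo : Odd d := ((hp.odd_of_ne_two hp2).pow).of_dvd_nat hd
    have h1 := odd_case hc' ha' (by rw [hfd]; exact hdo.pow)
    rw [hfd] at h1
    have h2 : d = 1 := by simpa using h1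
    rw [h2, mul_one] at hmr
    rw [hmr] at hpm
    exact hF (hpm.trans hr)
  obtain ⟨F, n, hn, hF⟩ := sylow_field (K := K) (N := N) 2 Nat.prime_two
  haveI : NumberField F := NumberField.of_module_finite K F
  obtain ⟨r, d, D', _, _, _, hc', ha', hfd, ⟨φ'⟩, hmr, hr, hd, -⟩ := reduce (F := F) hc ha m hm φ
  have hd2 := tower.{u, v} n F N D' d hn hc' ha' hfd φ'
  have hr1 : r = 1 := by
    by_contra hne
    obtain ⟨q, hq, hqr⟩ := Nat.exists_prime_and_dvd hne
    by_cases hq2 : q = 2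
    · subst hq2; exact hF (hqr.trans hr)
    · exact hodd q hq hq2 (by rw [hmr]; exact hqr.mul_right d)
  rw [hr1, one_mul] at hmr
  rw [hm] at hpos ⊢
  rw [hmr] at hpos ⊢
  interval_cases d
  · simp at hpos
  · left; norm_num
  · right; norm_num

end Alg

universe u v
theorem exponent_two_division_algebra_over_number_field_is_quaternion
    (K : Type u) [Field K] [NumberField K]
    (D : Type v) [DivisionRing D] [Algebra K D] [FiniteDimensional K D]
    (hcentral : Subalgebra.center K D = ⊥)
    (hexp2 : Nonempty (D ≃ₐ[K] Dᵐᵒᵖ)) :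
    Module.finrank K D = 1 ∨ Module.finrank K D = 4 := by
  apply Alg.main
  · intro z hz
    have h1 : z ∈ Subalgebra.center K D := Subalgebra.mem_center_iff.mpr (fun b => (hz b).symm)
    rw [hcentral, Algebra.mem_bot] at h1
    obtain ⟨k, hk⟩ := h1
    exact ⟨k, hk.symm⟩
  · obtain ⟨e⟩ := hexp2
    refine ⟨(MulOpposite.opLinearEquiv K).symm.toLinearMap ∘ₗ e.toLinearEquiv.toLinearMap, ?_, ?_⟩
    · change MulOpposite.unop (e 1) = 1
      rw [map_one]; rfl
    · intro x y
      change MulOpposite.unop (e (x * y)) = MulOpposite.unop (e y) * MulOpposite.unop (e x)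
      rw [map_mul]; rfl
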